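/- Suppose θ is inner and N-regular, and let (e,h,f) be a regular θ-adapted sl2-triple. Then every Cartan subspace of g_1 has dimension k_{−1}. -/

import Mathlib

open LieAlgebra Module

variable (k : Type*) [Field k] [IsAlgClosed k] [CharZero k]
variable (g : Type*) [LieRing g] [LieAlgebra k g] [FiniteDimensional k g]
  [LieAlgebra.IsSemisimple k g]

/-- The `ζ^i`-eigenspace of the automorphism `θ`, i.e. the graded piece `g_i`. -/
noncomputable def gradePiece {m : ℕ} (ζ : k) (θ : g ≃ₗ[k] g) (i : ZMod m) : Submodule k g :=
  Module.End.eigenspace (θ : g →ₗ[k] g) (ζ ^ i.val)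

/-- The centraliser `z(x) = {y : ⁅x, y⁆ = 0}` of `x`. -/
noncomputable def zc (x : g) : Submodule k g := LinearMap.ker (LieAlgebra.ad k g x)

/-- Truncated exponential of an endomorphism; it agrees with the exponential series for
nilpotent endomorphisms of a finite-dimensional space. -/
noncomputable def expEnd (N : Module.End k g) : Module.End k g :=
  ∑ i ∈ Finset.range (Module.finrank k g + 1), ((i.factorial : k))⁻¹ • N ^ i

/-- The group `Int g` of inner automorphisms: the subgroup of the automorphism group
generated by `exp (ad n)` for `n` with `ad n` nilpotent. -/
noncomputable def IntG : Subgroup (g ≃ₗ[k] g) :=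
  Subgroup.closure {τ | ∃ n : g, IsNilpotent (LieAlgebra.ad k g n) ∧
    (τ : g →ₗ[k] g) = expEnd k g (LieAlgebra.ad k g n)}

/-- A Cartan subspace of `g_1`: a commutative subspace consisting of semisimple elements,
maximal among subspaces of `g_1` with these two properties. -/
def IsCartanSubspace (m : ℕ) (ζ : k) (θ : g ≃ₗ[k] g) (c : Submodule k g) : Prop :=
  c ≤ gradePiece k g ζ θ (1 : ZMod m) ∧
  (∀ x ∈ c, ∀ y ∈ c, ⁅x, y⁆ = 0) ∧
  (∀ x ∈ c, (LieAlgebra.ad k g x).IsSemisimple) ∧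
  ∀ c' : Submodule k g, c' ≤ gradePiece k g ζ θ (1 : ZMod m) →
    (∀ x ∈ c', ∀ y ∈ c', ⁅x, y⁆ = 0) → (∀ x ∈ c', (LieAlgebra.ad k g x).IsSemisimple) →
    c ≤ c' → c = c'

/-- Polynomial functions on `g`: functions arising from the symmetric algebra of `g*`. -/
def IsPolyFun (F : g → k) : Prop :=
  ∃ p : MvPolynomial (Module.Dual k g) k, ∀ x, F x = MvPolynomial.eval (fun φ => φ x) p

/-- The number `k_i = Σ_{c ∈ ℤ, c ≡ i (mod m)} dim {v ∈ z(e) : ⁅h, v⁆ = 2c • v}`. -/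
noncomputable def kNum (m : ℕ) (e h : g) (i : ZMod m) : ℕ :=
  ∑ᶠ c : ℤ, if ((c : ZMod m) = i) then
    Module.finrank k ↥(zc k g e ⊓ Module.End.eigenspace (LieAlgebra.ad k g h) (2 * (c : k)))
  else 0


namespace NReg

set_option linter.unusedSectionVars false

/-- `sl2`-relations among endomorphisms. -/
structure Sl2 {K V : Type*} [Field K] [AddCommGroup V] [Module K V]
    (E F H : Module.End K V) : Prop where
  he : ∀ v, H (E v) = E (H v) + (2 : K) • E v
  hf : ∀ v, H (F v) = F (H v) - (2 : K) • F v
  ef : ∀ v, E (F v) = F (E v) + H v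

namespace Sl2

section
variable {K V : Type*} [Field K] [AddCommGroup V] [Module K V] {E F H : Module.End K V}

lemma symm (s : Sl2 E F H) : Sl2 F E (-H) where
  he v := by simp [s.hf]; abel
  hf v := by simp [s.he]; abel
  ef v := by simp [s.ef]

lemma he_pow (s : Sl2 E F H) (j : ℕ) (v : V) :
    H ((E ^ j) v) = (E ^ j) (H v) + (2 * j : K) • (E ^ j) v := by
  induction j generalizing v with
  | zero => simp
  | succ j ih =>
    rw [pow_succ, Module.End.mul_apply, Module.End.mul_apply, ih, s.he, map_add, map_smul]
    push_cast
    module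

lemma hf_pow (s : Sl2 E F H) (j : ℕ) (v : V) :
    H ((F ^ j) v) = (F ^ j) (H v) - (2 * j : K) • (F ^ j) v := by
  have := s.symm.he_pow j v
  simp only [LinearMap.neg_apply, map_neg] at this
  rw [neg_eq_iff_eq_neg] at this
  rw [this]
  module

/-- Casimir. -/
def cas (E F H : Module.End K V) : Module.End K V :=
  (2 : K) • (F * E) + H + (2⁻¹ : K) • (H * H)

lemma cas_apply (v : V) : cas E F H v = (2 : K) • F (E v) + H v + (2⁻¹ : K) • H (H v) := by
  simp [cas]

lemma cas_H (s : Sl2 E F H) (v : V) : cas E F H (H v) = H (cas E F H v) := by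
  have h : H (F (E v)) = F (E (H v)) := by rw [s.hf, s.he]; simp
  simp [cas_apply, h]

lemma cas_E [CharZero K] (s : Sl2 E F H) (v : V) : cas E F H (E v) = E (cas E F H v) := by
  simp only [cas_apply, map_add, map_smul, s.ef, s.he]
  have : (2 : K) ≠ 0 := two_ne_zero
  match_scalars <;> field_simp <;> ring

lemma cas_symm [CharZero K] (s : Sl2 E F H) : cas F E (-H) = cas E F H := by
  ext v
  simp only [cas_apply, s.ef, LinearMap.neg_apply, map_neg]
  module

lemma cas_F [CharZero K] (s : Sl2 E F H) (v : V) : cas E F H (F v) = F (cas E F H v) := by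
  rw [← s.cas_symm]
  exact s.symm.cas_E v

lemma ef_pow (s : Sl2 E F H) (n : ℕ) (v : V) (hv : E v = 0) :
    E ((F ^ (n + 1)) v) = (F ^ n) (((n : K) + 1) • (H v - (n : K) • v)) := by
  induction n with
  | zero => simp [s.ef, hv]
  | succ n ih =>
    rw [pow_succ', Module.End.mul_apply, s.ef, ih, s.hf_pow]
    simp only [map_smul, map_sub]
    rw [pow_succ' F n]
    simp only [Module.End.mul_apply]
    push_cast
    module

lemma hE (s : Sl2 E F H) (v : V) (hv : E v = 0) : E (H v) = 0 := by
  have := s.he v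
  rw [hv] at this; simpa using this.symm

lemma ef_prod (s : Sl2 E F H) (n : ℕ) (v : V) (hv : E v = 0) :
    (E ^ n) ((F ^ n) v) = ((n.factorial : K)) •
      (Polynomial.aeval H (∏ i ∈ Finset.range n, (Polynomial.X - Polynomial.C (i : K)))) v := by
  induction n generalizing v with
  | zero => simp
  | succ n ih =>
    rw [pow_succ, Module.End.mul_apply, s.ef_pow n v hv, ih]
    · rw [Finset.prod_range_succ]
      simp only [map_mul, Module.End.mul_apply, map_sub, Polynomial.aeval_X, Polynomial.aeval_C,
        Nat.factorial_succ, map_smul, LinearMap.sub_apply, Module.algebraMap_end_apply]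
      push_cast
      module
    · simp [hv, s.hE v hv]

end

section
variable {K V : Type*} [Field K] [CharZero K] [AddCommGroup V] [Module K V]
  [FiniteDimensional K V] {E F H : Module.End K V}

lemma nilp (s : Sl2 E F H) : ∃ n, E ^ n = 0 := by
  by_contra! contra
  let A : Module.End K (Module.End K V) := LinearMap.mulLeft K H - LinearMap.mulRight K H
  have hinj : Function.Injective (fun n : ℕ => (2 * n : K)) := fun a b hab => by simpa using hab
  have aux : ∀ n : ℕ, A.HasEigenvector (2 * n : K) (E ^ n) := by
    intro n
    refine ⟨?_, contra n⟩
    rw [Module.End.mem_eigenspace_iff]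
    ext v
    simp [A, s.he_pow]
  have := Module.End.eigenvectors_linearIndependent' A (fun n : ℕ => (2 * n : K)) hinj _ aux
  exact not_finite_iff_infinite.mpr inferInstance (this.finite)

lemma nilpF (s : Sl2 E F H) : ∃ n, F ^ n = 0 := s.symm.nilp

/-- on `ker E`, generalized `H`-eigenvectors are honest ones with natural eigenvalue. -/
lemma prim (s : Sl2 E F H) {v : V} {μ : K} (hv : E v = 0)
    (hμ : v ∈ H.maxGenEigenspace μ) (h0 : v ≠ 0) : ∃ d : ℕ, μ = d ∧ H v = (d : K) • v := by
  obtain ⟨N, hN⟩ := s.nilpF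
  have h1 := s.ef_prod N v hv
  rw [hN] at h1
  simp only [LinearMap.zero_apply, map_zero] at h1
  have h2 := (smul_eq_zero.mp h1.symm).resolve_left (by exact_mod_cast N.factorial_ne_zero)
  rw [Module.End.mem_maxGenEigenspace] at hμ
  obtain ⟨M, hM⟩ := hμ
  -- coprimality tool
  have key : ∀ (p : Polynomial K) (w : V), p.eval μ ≠ 0 → (Polynomial.aeval H p) w = 0 →
      ((H - μ • 1) ^ M) w = 0 → w = 0 := by
    intro p w hp h3 h4
    have hc : IsCoprime p ((Polynomial.X - Polynomial.C μ) ^ M) := by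
      apply IsCoprime.pow_right
      rw [isCoprime_comm, Irreducible.coprime_iff_not_dvd (Polynomial.irreducible_X_sub_C μ),
        Polynomial.dvd_iff_isRoot]
      exact hp
    obtain ⟨a, b, hab⟩ := hc
    have := congrArg (fun q => (Polynomial.aeval H q) w) hab
    simp only [map_add, map_mul, LinearMap.add_apply, Module.End.mul_apply, h3, map_zero,
      map_pow, map_sub, Polynomial.aeval_X, Polynomial.aeval_C, map_one, Module.End.one_apply,
      zero_add] at this
    rw [Algebra.algebraMap_eq_smul_one, h4, map_zero] at this
    exact this.symm
  by_cases hd : ∃ i ∈ Finset.range N, μ = (i : K)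
  · obtain ⟨d, hdN, rfl⟩ := hd
    refine ⟨d, rfl, ?_⟩
    rw [← sub_eq_zero]
    have e1 : H v - (d : K) • v = (H - (d : K) • 1) v := by simp
    rw [e1]
    apply key (∏ i ∈ (Finset.range N).erase d, (Polynomial.X - Polynomial.C (i : K)))
    · rw [Polynomial.eval_prod, Finset.prod_ne_zero_iff]
      intro i hi
      simp only [Polynomial.eval_sub, Polynomial.eval_X, Polynomial.eval_C]
      rw [sub_ne_zero]
      exact_mod_cast (Finset.ne_of_mem_erase hi).symm
    · rw [← Finset.prod_erase_mul _ _ hdN] at h2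
      simpa [Algebra.algebraMap_eq_smul_one, Nat.cast_smul_eq_nsmul] using h2
    · rw [← Module.End.mul_apply, ← pow_succ, pow_succ', Module.End.mul_apply, hM, map_zero]
  · exfalso
    push Not at hd
    apply h0
    apply key _ v _ h2 hM
    rw [Polynomial.eval_prod, Finset.prod_ne_zero_iff]
    intro i hi
    simpa [sub_ne_zero] using hd i hi

lemma exists_top (s : Sl2 E F H) {v : V} (h0 : v ≠ 0) :
    ∃ j, (E ^ j) v ≠ 0 ∧ E ((E ^ j) v) = 0 := by
  classical
  obtain ⟨N, hN⟩ := s.nilp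
  have hex : ∃ n, (E ^ n) v = 0 := ⟨N, by simp [hN]⟩
  obtain ⟨n, h1, h2⟩ := Nat.exists_not_and_succ_of_not_zero_of_exists (by simpa using h0) hex
  exact ⟨n, h1, by rwa [pow_succ', Module.End.mul_apply] at h2⟩

lemma cas_prim {v : V} {d : K} (hv : E v = 0) (hd : H v = d • v) :
    cas E F H v = (d * (d + 2) / 2) • v := by
  simp only [cas_apply, hv, hd, map_zero, map_smul]
  match_scalars
  field_simp
  ring

lemma cas_inj {a b : ℕ} (h : (a : K) * (a + 2) / 2 = (b : K) * (b + 2) / 2) : a = b := by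
  have h2 : (2 : K) ≠ 0 := two_ne_zero
  have h3 : (a : K) * (a + 2) = b * (b + 2) := by
    field_simp at h
    exact h
  have : a * (a + 2) = b * (b + 2) := by exact_mod_cast h3
  nlinarith

/-- Common eigenvectors. -/
lemma common (s : Sl2 E F H) {v : V} {μ χ : K} (h0 : v ≠ 0) (hH : H v = μ • v)
    (hC : cas E F H v = χ • v) :
    ∃ d i j : ℕ, μ = d - 2 * j ∧ d = i + j ∧ χ = (d : K) * (d + 2) / 2 ∧
      (E ^ j) v ≠ 0 ∧ E ((E ^ j) v) = 0 ∧ (F ^ i) v ≠ 0 ∧ F ((F ^ i) v) = 0 := by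
  have casE : ∀ n, cas E F H ((E ^ n) v) = χ • (E ^ n) v := by
    intro n
    induction n with
    | zero => simpa using hC
    | succ n ih => rw [pow_succ', Module.End.mul_apply, s.cas_E, ih, map_smul]
  have casF : ∀ n, cas E F H ((F ^ n) v) = χ • (F ^ n) v := by
    intro n
    induction n with
    | zero => simpa using hC
    | succ n ih => rw [pow_succ', Module.End.mul_apply, s.cas_F, ih, map_smul]
  obtain ⟨j, hj0, hj⟩ := s.exists_top h0
  obtain ⟨i, hi0, hi⟩ := s.symm.exists_top h0
  have e1 : H ((E ^ j) v) = (μ + 2 * j) • (E ^ j) v := by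
    rw [s.he_pow, hH, map_smul]; module
  have e2 : (-H) ((F ^ i) v) = (2 * i - μ) • (F ^ i) v := by
    rw [LinearMap.neg_apply, s.hf_pow, hH, map_smul]; module
  have mg : ∀ (T : Module.End K V) (w : V) (ν : K), T w = ν • w → w ∈ T.maxGenEigenspace ν := by
    intro T w ν hw
    rw [Module.End.mem_maxGenEigenspace]
    exact ⟨1, by simp [hw]⟩
  obtain ⟨d, hd, -⟩ := s.prim hj (mg _ _ _ e1) hj0
  obtain ⟨d', hd', -⟩ := s.symm.prim hi (mg _ _ _ e2) hi0
  have c1 := cas_prim (F := F) hj e1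
  have c2 := cas_prim (F := E) hi e2
  rw [s.cas_symm] at c2
  rw [casE, hd] at c1
  rw [casF, hd'] at c2
  have c1' := smul_left_injective K hj0 c1
  have c2' := smul_left_injective K hi0 c2
  have hdd : d = d' := cas_inj (K := K) (by rw [← c1', ← c2'])
  subst hdd
  have hsum : (2 : K) * d = 2 * (i + j) := by linear_combination -hd - hd'
  refine ⟨d, i, j, by linear_combination hd, ?_, c1', hj0, hj, hi0, hi⟩
  have := mul_left_cancel₀ (two_ne_zero) hsum
  exact_mod_cast this

end

section
variable {K V : Type*} [Field K] [CharZero K] [IsAlgClosed K] [AddCommGroup V] [Module K V]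
  [FiniteDimensional K V] {E F H : Module.End K V}

/-- simultaneous generalized eigenvectors are honest -/
lemma ss_aux (s : Sl2 E F H) {v : V} {μ χ : K} (hμ : v ∈ H.maxGenEigenspace μ)
    (hχ : v ∈ (cas E F H).maxGenEigenspace χ) : H v = μ • v ∧ cas E F H v = χ • v := by
  have mE : ∀ (n : ℕ) (w : V) (ν : K), w ∈ H.maxGenEigenspace ν →
      (E ^ n) w ∈ H.maxGenEigenspace (ν + 2 * n) := by
    intro n w ν hw
    rw [Module.End.mem_maxGenEigenspace] at hw ⊢
    obtain ⟨M, hM⟩ := hw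
    refine ⟨M, ?_⟩
    have : ∀ (M : ℕ) (w : V), ((H - (ν + 2 * n) • 1) ^ M) ((E ^ n) w) =
        (E ^ n) (((H - ν • 1) ^ M) w) := by
      intro M
      induction M with
      | zero => simp
      | succ M ih =>
        intro w
        rw [pow_succ, Module.End.mul_apply, pow_succ, Module.End.mul_apply, ← ih]
        congr 1
        simp [s.he_pow]
        module
    rw [this, hM, map_zero]
  have cE : ∀ (n : ℕ), Commute (cas E F H) (E ^ n) := by
    intro n
    apply Commute.pow_right
    ext w
    exact s.cas_E w
  have cH : Commute (cas E F H) H := by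
    ext w; exact s.cas_H w
  -- every nonzero such vector has the same length
  have len : ∀ (w : V), w ≠ 0 → w ∈ H.maxGenEigenspace μ → w ∈ (cas E F H).maxGenEigenspace χ →
      ∃ j d : ℕ, (E ^ j) w ≠ 0 ∧ E ((E ^ j) w) = 0 ∧ H ((E ^ j) w) = (d : K) • (E ^ j) w ∧
        μ + 2 * j = d ∧ χ = (d : K) * (d + 2) / 2 := by
    intro w w0 w1 w2
    obtain ⟨j, hj0, hj⟩ := s.exists_top w0
    obtain ⟨d, hd, hd'⟩ := s.prim hj (mE j w μ w1) hj0
    refine ⟨j, d, hj0, hj, hd', hd, ?_⟩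
    have c1 := cas_prim (F := F) hj hd'
    have m1 : (E ^ j) w ∈ (cas E F H).maxGenEigenspace χ :=
      Module.End.mapsTo_maxGenEigenspace_of_comm (cE j) χ w2
    have m2 : (E ^ j) w ∈ (cas E F H).maxGenEigenspace ((d : K) * (d + 2) / 2) := by
      rw [Module.End.mem_maxGenEigenspace]
      exact ⟨1, by simp [c1]⟩
    by_contra hne
    exact hj0 ((Submodule.disjoint_def.mp
      (Module.End.disjoint_genEigenspace (cas E F H) hne ⊤ ⊤)) _ m1 m2)
  have lenu : ∀ (w w' : V) , w ∈ H.maxGenEigenspace μ → w ∈ (cas E F H).maxGenEigenspace χ →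
      w' ∈ H.maxGenEigenspace μ → w' ∈ (cas E F H).maxGenEigenspace χ →
      ∀ j, (E ^ j) w ≠ 0 → E ((E ^ j) w) = 0 → (E ^ j) w' = 0 → w' = 0 := by
    intro w w' a1 a2 b1 b2 j hj hj' hw'
    by_contra b0
    have a0 : w ≠ 0 := by rintro rfl; simp at hj
    obtain ⟨j1, d1, x1, x2, x3, x4, x5⟩ := len w a0 a1 a2
    obtain ⟨j2, d2, y1, y2, y3, y4, y5⟩ := len w' b0 b1 b2
    have hdd : d1 = d2 := cas_inj (K := K) (by rw [← x5, ← y5])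
    subst hdd
    have hjj : j1 = j2 := by
      have : (j1 : K) = j2 := by
        have : (2 : K) * j1 = 2 * j2 := by linear_combination x4 - y4
        exact mul_left_cancel₀ two_ne_zero this
      exact_mod_cast this
    subst hjj
    have : j = j1 := by
      rcases lt_trichotomy j j1 with h | h | h
      · exfalso; apply x1
        obtain ⟨t, rfl⟩ := Nat.exists_eq_add_of_lt h
        rw [show j + t + 1 = t + (1 + j) by ring, pow_add, pow_add, pow_one, Module.End.mul_apply,
          Module.End.mul_apply, hj', map_zero]
      · exact h
      · exfalso; apply hj
        obtain ⟨t, rfl⟩ := Nat.exists_eq_add_of_lt h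
        rw [show j1 + t + 1 = t + (1 + j1) by ring, pow_add, pow_add, pow_one,
          Module.End.mul_apply, Module.End.mul_apply, x2, map_zero]
    subst this
    exact y1 hw'
  by_cases h0 : v = 0
  · subst h0; simp
  obtain ⟨j, d, hj0, hj, hd, hμd, hχd⟩ := len v h0 hμ hχ
  have H1 : Commute H H := Commute.refl _
  constructor
  · rw [← sub_eq_zero]
    refine lenu v _ hμ hχ (Submodule.sub_mem _ ?_ (Submodule.smul_mem _ _ hμ))
      (Submodule.sub_mem _ ?_ (Submodule.smul_mem _ _ hχ)) j hj0 hj ?_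
    · exact Module.End.mapsTo_maxGenEigenspace_of_comm H1 μ hμ
    · exact Module.End.mapsTo_maxGenEigenspace_of_comm cH χ hχ
    · have := s.he_pow j v
      rw [hd, ← hμd] at this
      rw [add_smul] at this
      rw [map_sub, map_smul, add_right_cancel this, sub_self]
  · rw [← sub_eq_zero]
    refine lenu v _ hμ hχ (Submodule.sub_mem _ ?_ (Submodule.smul_mem _ _ hμ))
      (Submodule.sub_mem _ ?_ (Submodule.smul_mem _ _ hχ)) j hj0 hj ?_
    · exact Module.End.mapsTo_maxGenEigenspace_of_comm cH.symm μ hμ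
    · exact Module.End.mapsTo_maxGenEigenspace_of_comm (Commute.refl _) χ hχ
    · rw [map_sub, map_smul]
      have := (cE j)
      have h2 : (E ^ j) ((cas E F H) v) = cas E F H ((E ^ j) v) := by
        rw [← Module.End.mul_apply, ← this.eq, Module.End.mul_apply]
      rw [h2, cas_prim hj hd, hχd, sub_self]

/-- Induction principle: a submodule containing all common eigenvectors is everything. -/
lemma top_of_common (s : Sl2 E F H) (U : Submodule K V)
    (hU : ∀ (v : V) (d i j : ℕ), d = i + j → H v = ((d : K) - 2 * j) • v →
      cas E F H v = ((d : K) * (d + 2) / 2) • v → F ((F ^ i) v) = 0 → E ((E ^ j) v) = 0 → v ∈ U) :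
    U = ⊤ := by
  have cH : Commute (cas E F H) H := by
    ext w; exact s.cas_H w
  let f : Bool → Module.End K V := fun b => if b then H else cas E F H
  have hcomm : Pairwise fun i j ↦ ∀ φ : K, Set.MapsTo (f i) ((f j).maxGenEigenspace φ)
      ((f j).maxGenEigenspace φ) := by
    intro a b _ φ
    apply Module.End.mapsTo_maxGenEigenspace_of_comm
    rcases a with _ | _ <;> rcases b with _ | _
    · exact Commute.refl _
    · exact cH.symm
    · exact cH
    · exact Commute.refl _
  have := Module.End.iSup_iInf_maxGenEigenspace_eq_top_of_forall_mapsTo f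
    (fun a b φ => by
      by_cases hab : a = b
      · subst hab
        exact Module.End.mapsTo_maxGenEigenspace_of_comm (Commute.refl _) φ
      · exact hcomm hab φ) (fun b => Module.End.iSup_maxGenEigenspace_eq_top _)
  rw [eq_top_iff, ← this, iSup_le_iff]
  intro χ v hv
  by_cases h0 : v = 0
  · rw [h0]; exact U.zero_mem
  rw [Submodule.mem_iInf] at hv
  obtain ⟨h1, h2⟩ := s.ss_aux (hv true) (hv false)
  obtain ⟨d, i, j, c1, c2, c3, c4, c5, c6, c7⟩ := s.common h0 h1 h2
  exact hU v d i j c2 (by rw [h1, c1]) (by rw [h2, c3]) c7 c5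

/-- A nonzero subspace stable under `H`-scalar and Casimir has a common eigenvector. -/
lemma exists_common (s : Sl2 E F H) (U : Submodule K V) (μ : K) (hne : U ≠ ⊥)
    (hH : ∀ v ∈ U, H v = μ • v) (hC : ∀ v ∈ U, cas E F H v ∈ U) :
    ∃ v ∈ U, ∃ d i j : ℕ, v ≠ 0 ∧ μ = d - 2 * j ∧ d = i + j ∧
      cas E F H v = ((d : K) * (d + 2) / 2) • v ∧
      (E ^ j) v ≠ 0 ∧ E ((E ^ j) v) = 0 ∧ (F ^ i) v ≠ 0 ∧ F ((F ^ i) v) = 0 := by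
  have : Nontrivial U := (Submodule.nontrivial_iff_ne_bot).mpr hne
  obtain ⟨χ, hχ⟩ := Module.End.exists_eigenvalue ((cas E F H).restrict hC)
  obtain ⟨w, hw⟩ := hχ.exists_hasEigenvector
  have h1 := hw.apply_eq_smul
  have h0 : (w : V) ≠ 0 := by simpa using hw.2
  have h1' : cas E F H (w : V) = χ • (w : V) := by simpa using congrArg Subtype.val h1
  obtain ⟨d, i, j, c1, c2, c3, c4⟩ := s.common h0 (hH w w.2) h1'
  exact ⟨w, w.2, d, i, j, h0, c1, c2, by rw [h1', c3], c4⟩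

/-- S1 -/
lemma iSup_eigenspace (s : Sl2 E F H) : ⨆ n : ℤ, H.eigenspace (n : K) = ⊤ := by
  apply s.top_of_common
  intro v d i j _ hH _ _ _
  apply Submodule.mem_iSup_of_mem ((d : ℤ) - 2 * j)
  rw [Module.End.mem_eigenspace_iff, hH]
  push_cast
  rfl

lemma ef_common (s : Sl2 E F H) {v : V} {d i j : ℕ} (hd : d = i + j)
    (hH : H v = ((d : K) - 2 * j) • v)
    (hC : cas E F H v = ((d : K) * (d + 2) / 2) • v) :
    (2 : K) • E (F v) = ((2 : K) * i * (j + 1)) • v := by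
  rw [← s.cas_symm, cas_apply] at hC
  simp only [LinearMap.neg_apply, map_neg, hH, map_smul] at hC
  have h3 : (2 : K) • E (F v) = ((d : K) * (d + 2) / 2) • v + ((d : K) - 2 * j) • v
    - (2⁻¹ : K) • (((d : K) - 2 * j) • ((d : K) - 2 * j) • v) := by
    rw [← hC]; module
  rw [h3, hd]
  push_cast
  match_scalars
  field_simp
  ring

/-- S3 -/
lemma range_sup_ker (s : Sl2 E F H) : LinearMap.range E ⊔ LinearMap.ker F = ⊤ := by
  apply s.top_of_common
  intro v d i j hd hH hC hF hE
  rcases Nat.eq_zero_or_pos i with rfl | hi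
  · exact Submodule.mem_sup_right (by simpa using hF)
  · apply Submodule.mem_sup_left
    have h2 := s.ef_common hd hH hC
    have hne : ((2 : K) * i * (j + 1)) ≠ 0 := by
      have : (i : K) ≠ 0 := by exact_mod_cast hi.ne'
      have : (j : K) + 1 ≠ 0 := by exact_mod_cast j.succ_ne_zero
      simp [*]
    refine ⟨(((2 : K) * i * (j + 1))⁻¹ * 2) • F v, ?_⟩
    rw [map_smul, mul_smul, h2, smul_smul, inv_mul_cancel₀ hne, one_smul]

/-- S2, injectivity -/
lemma inj (s : Sl2 E F H) {n : ℤ} (hn : n < 0) {v : V} (hv : H v = (n : K) • v)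
    (hE : E v = 0) : v = 0 := by
  by_contra h0
  obtain ⟨d, hd, -⟩ := s.prim hE (μ := n) (by
    rw [Module.End.mem_maxGenEigenspace]; exact ⟨1, by simp [hv]⟩) h0
  have : n = d := by exact_mod_cast hd
  lia

lemma ker_natural (s : Sl2 E F H) {n : K} {v : V} (h0 : v ≠ 0) (hv : H v = n • v)
    (hE : E v = 0) : ∃ d : ℕ, n = d := by
  obtain ⟨d, hd, -⟩ := s.prim hE (μ := n) (by
    rw [Module.End.mem_maxGenEigenspace]; exact ⟨1, by simp [hv]⟩) h0
  exact ⟨d, hd⟩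

/-- S2, surjectivity -/
lemma surj (s : Sl2 E F H) {n : ℤ} (hn : 0 < n) {w : V} (hw : H w = (n : K) • w) :
    ∃ v, H v = ((n - 2 : ℤ) : K) • v ∧ E v = w := by
  let U := H.eigenspace (n : K)
  have memU : ∀ v, v ∈ U ↔ H v = (n : K) • v := fun v => Module.End.mem_eigenspace_iff
  have hHF : ∀ v ∈ U, H (F v) = ((n - 2 : ℤ) : K) • F v := by
    intro v hv
    rw [s.hf, (memU v).mp hv, map_smul]; push_cast; module
  have hU : ∀ v ∈ U, (E * F) v ∈ U := by
    intro v hv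
    rw [memU, Module.End.mul_apply, s.he, hHF v hv, map_smul]; push_cast; module
  have hinj : Function.Injective ((E * F).restrict hU) := by
    rw [← LinearMap.ker_eq_bot]
    by_contra hne
    have hne' : LinearMap.ker (E * F) ⊓ U ≠ ⊥ := by
      intro h
      apply hne
      rw [LinearMap.ker_eq_bot']
      intro m hm
      have : (m : V) ∈ LinearMap.ker (E * F) ⊓ U :=
        ⟨by simpa using congrArg Subtype.val hm, m.2⟩
      rw [h] at this
      simpa using this
    obtain ⟨v, ⟨hv1, hv2⟩, d, i, j, h0, c1, c2, c3, -, -, c4, c5⟩ :=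
      s.exists_common _ (n : K) hne' (fun v hv => (memU v).mp hv.2) (by
        rintro v ⟨hv1, hv2⟩
        refine ⟨?_, ?_⟩
        · change E (F (cas E F H v)) = 0
          rw [← s.cas_F, ← s.cas_E]
          have : E (F v) = 0 := hv1
          rw [this, map_zero]
        · change _ ∈ U
          rw [memU, ← s.cas_H, (memU v).mp hv2, map_smul])
    have h2 := s.ef_common c2 (by rw [(memU v).mp hv2, c1]) c3
    have h3 : E (F v) = 0 := hv1
    rw [h3, smul_zero] at h2
    have h4 := (smul_eq_zero.mp h2.symm).resolve_right h0
    have hnij : n = (d : ℤ) - 2 * j := by exact_mod_cast c1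
    have hi : 0 < i := by lia
    have : (2 * i * (j + 1) : ℕ) = 0 := by exact_mod_cast h4
    simp at this
    lia
  have hsurj := LinearMap.surjective_of_injective hinj
  obtain ⟨u, hu⟩ := hsurj ⟨w, (memU w).mpr hw⟩
  refine ⟨F u, hHF u u.2, ?_⟩
  simpa using congrArg Subtype.val hu

lemma F_pow_inj (s : Sl2 E F H) {n : ℕ} {v : V} (hv : H v = (n : K) • v)
    (hF : (F ^ n) v = 0) : v = 0 := by
  by_contra h0
  let U := H.eigenspace (n : K)
  have memU : ∀ v, v ∈ U ↔ H v = (n : K) • v := fun v => Module.End.mem_eigenspace_iff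
  have hne' : LinearMap.ker (F ^ n) ⊓ U ≠ ⊥ := by
    intro h
    have : v ∈ LinearMap.ker (F ^ n) ⊓ U := ⟨hF, (memU v).mpr hv⟩
    rw [h] at this
    exact h0 (by simpa using this)
  have cF : Commute (cas E F H) (F ^ n) := by
    apply Commute.pow_right
    ext w
    exact s.cas_F w
  obtain ⟨v, ⟨hv1, hv2⟩, d, i, j, h0, c1, c2, c3, -, -, c4, c5⟩ :=
    s.exists_common _ (n : K) hne' (fun v hv => (memU v).mp hv.2) (by
      rintro v ⟨hv1, hv2⟩
      refine ⟨?_, ?_⟩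
      · change (F ^ n) (cas E F H v) = 0
        rw [← Module.End.mul_apply, ← cF.eq, Module.End.mul_apply]
        have : (F ^ n) v = 0 := hv1
        rw [this, map_zero]
      · change _ ∈ U
        rw [memU, ← s.cas_H, (memU v).mp hv2, map_smul])
  have hnij : (n : ℤ) = (d : ℤ) - 2 * j := by exact_mod_cast c1
  have hi : n ≤ i := by lia
  obtain ⟨t, rfl⟩ := Nat.exists_eq_add_of_le hi
  apply c4
  have : (F ^ n) v = 0 := hv1
  rw [add_comm, pow_add, Module.End.mul_apply, this, map_zero]

end
end Sl2
end NReg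


namespace NReg

set_option linter.unusedSectionVars false

namespace Sl2

section
variable {K V : Type*} [Field K] [IsAlgClosed K] [CharZero K] [AddCommGroup V] [Module K V]
  [FiniteDimensional K V] {E F H : Module.End K V}

open Module

lemma E_mem (s : Sl2 E F H) {μ : K} {v : V} (hv : v ∈ H.eigenspace μ) :
    E v ∈ H.eigenspace (μ + 2) := by
  rw [End.mem_eigenspace_iff] at *
  rw [s.he, hv, map_smul, add_smul]

lemma F_mem (s : Sl2 E F H) {μ : K} {v : V} (hv : v ∈ H.eigenspace μ) :
    F v ∈ H.eigenspace (μ - 2) := by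
  rw [End.mem_eigenspace_iff] at *
  rw [s.hf, hv, map_smul, sub_smul]

lemma mem_neg {μ : K} {v : V} : v ∈ (-H).eigenspace μ ↔ v ∈ H.eigenspace (-μ) := by
  rw [End.mem_eigenspace_iff, End.mem_eigenspace_iff]
  simp only [LinearMap.neg_apply, neg_smul]
  exact neg_eq_iff_eq_neg

lemma eig_neg (H : Module.End K V) (μ : K) : (-H).eigenspace μ = H.eigenspace (-μ) :=
  Submodule.ext fun _ => mem_neg

lemma finrank_map_add (A : V →ₗ[K] V) (P : Submodule K V) :
    finrank K (P.map A) + finrank K (LinearMap.ker A ⊓ P : Submodule K V) = finrank K P := by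
  have h := LinearMap.finrank_range_add_finrank_ker (A.domRestrict P)
  rw [LinearMap.range_domRestrict] at h
  rw [← h]
  congr 1
  rw [LinearMap.ker_domRestrict, inf_comm]
  have : Submodule.map P.subtype (Submodule.submoduleOf (LinearMap.ker A) P)
    = P ⊓ LinearMap.ker A := by
    rw [Submodule.submoduleOf, Submodule.map_comap_subtype]
  rw [← this]
  exact (Submodule.equivSubtypeMap P _).finrank_eq.symm

lemma dim_ker_eq (s : Sl2 E F H) : finrank K (LinearMap.ker F) = finrank K (LinearMap.ker E) := by
  have key : ∀ {E F H : Module.End K V}, Sl2 E F H →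
      finrank K (LinearMap.ker E) ≤ finrank K (LinearMap.ker F) := by
    intro E F H s
    have h1 := s.range_sup_ker
    have h2 := Submodule.finrank_add_le_finrank_add_finrank (LinearMap.range E) (LinearMap.ker F)
    rw [h1, finrank_top] at h2
    have h3 := LinearMap.finrank_range_add_finrank_ker E
    omega
  exact le_antisymm (key s.symm) (key s)

lemma dim01 (s : Sl2 E F H) :
    finrank K (H.eigenspace (0 : K)) + finrank K (H.eigenspace (1 : K))
      ≤ finrank K (LinearMap.ker E) := by
  have ind : iSupIndep (fun n : ℕ => H.eigenspace ((n : ℕ) : K)) :=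
    (End.eigenspaces_iSupIndep H).comp Nat.cast_injective
  set P : Submodule K V := ⨆ n : ℕ, H.eigenspace (n : K) with hP
  set Q : Submodule K V := ⨆ n : ℕ, H.eigenspace ((n + 2 : ℕ) : K) with hQ
  have h1 := finrank_map_add E P
  have h2 : finrank K (LinearMap.ker E ⊓ P : Submodule K V) ≤ finrank K (LinearMap.ker E) :=
    Submodule.finrank_mono inf_le_left
  have h3 : P.map E ≤ Q := by
    rw [hP, Submodule.map_iSup]
    refine iSup_le fun n => ?_
    rintro _ ⟨v, hv, rfl⟩
    refine Submodule.mem_iSup_of_mem n ?_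
    have := s.E_mem hv
    push_cast
    exact this
  have h4 := Submodule.finrank_mono h3
  set R : Submodule K V := H.eigenspace (0 : K) ⊔ H.eigenspace (1 : K) with hR
  have h01 : Disjoint (H.eigenspace (0 : K)) (H.eigenspace (1 : K)) := by
    have := ind.pairwiseDisjoint (show (0 : ℕ) ≠ 1 by norm_num)
    simpa [Function.onFun] using this
  have hRd : Disjoint R Q := by
    have := ind.disjoint_biSup_biSup (s := ({0, 1} : Set ℕ)) (t := {n | 2 ≤ n}) (by
      rw [Set.disjoint_left]; intro n hn; simp at hn ⊢; omega)
    refine this.mono ?_ ?_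
    · rw [hR]
      refine sup_le ?_ ?_
      · intro v hv
        exact Submodule.mem_iSup_of_mem 0 (Submodule.mem_iSup_of_mem (by simp) (by simpa using hv))
      · intro v hv
        exact Submodule.mem_iSup_of_mem 1 (Submodule.mem_iSup_of_mem (by simp) (by simpa using hv))
    · refine iSup_le fun n v hv => ?_
      exact Submodule.mem_iSup_of_mem (n + 2) (Submodule.mem_iSup_of_mem (by simp) hv)
  have hRP : R ⊔ Q ≤ P := by
    refine sup_le (sup_le ?_ ?_) (iSup_le fun n v hv => Submodule.mem_iSup_of_mem (n + 2) hv)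
    · intro v hv
      exact Submodule.mem_iSup_of_mem 0 (by simpa using hv)
    · intro v hv
      exact Submodule.mem_iSup_of_mem 1 (by simpa using hv)
  have h5 := Submodule.finrank_mono hRP
  have h6 := Submodule.finrank_sup_add_finrank_inf_eq R Q
  have h7 := Submodule.finrank_sup_add_finrank_inf_eq (H.eigenspace (0 : K)) (H.eigenspace (1 : K))
  rw [hRd.eq_bot, finrank_bot] at h6
  rw [h01.eq_bot, finrank_bot, ← hR] at h7
  omega

lemma Fpow_mem (s : Sl2 E F H) {μ : K} {v : V} (j : ℕ) (hv : v ∈ H.eigenspace μ) :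
    (F ^ j) v ∈ H.eigenspace (μ - 2 * j) := by
  induction j with
  | zero => simpa using hv
  | succ j ih =>
    have := s.F_mem ih
    rw [pow_succ', Module.End.mul_apply]
    convert this using 2
    push_cast; ring

lemma dim_neg_le (s : Sl2 E F H) (n : ℕ) :
    finrank K (H.eigenspace (n : K)) ≤ finrank K (H.eigenspace (-(n : K))) := by
  have h1 := finrank_map_add (F ^ n) (H.eigenspace (n : K))
  have h2 : LinearMap.ker (F ^ n) ⊓ H.eigenspace (n : K) = ⊥ := by
    rw [eq_bot_iff]
    rintro v ⟨h1, h2⟩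
    exact s.F_pow_inj (End.mem_eigenspace_iff.1 h2) h1
  rw [h2, finrank_bot] at h1
  rw [← h1, add_zero]
  refine Submodule.finrank_mono ?_
  rintro _ ⟨v, hv, rfl⟩
  have := s.Fpow_mem n hv
  convert this using 2
  ring

lemma dim_neg (s : Sl2 E F H) (n : ℕ) :
    finrank K (H.eigenspace (n : K)) = finrank K (H.eigenspace (-(n : K))) := by
  refine le_antisymm (s.dim_neg_le n) ?_
  have := s.symm.dim_neg_le n
  rwa [eig_neg, eig_neg, neg_neg] at this

lemma dim_ker_eig (s : Sl2 E F H) (n : ℕ) :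
    finrank K (H.eigenspace ((n : K) + 2))
      + finrank K (LinearMap.ker E ⊓ H.eigenspace (n : K) : Submodule K V)
      = finrank K (H.eigenspace (n : K)) := by
  have : (H.eigenspace (n : K)).map E = H.eigenspace ((n : K) + 2) := by
    apply le_antisymm
    · rintro _ ⟨v, hv, rfl⟩
      exact s.E_mem hv
    · intro w hw
      obtain ⟨v, hv, rfl⟩ := s.surj (n := (n : ℤ) + 2) (by positivity) (w := w)
        (by push_cast; exact End.mem_eigenspace_iff.1 hw)
      refine ⟨v, End.mem_eigenspace_iff.2 ?_, rfl⟩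
      simpa using hv
  rw [← this, finrank_map_add E]

lemma dim_ker_eig_eq (s : Sl2 E F H) (n : ℤ) :
    finrank K (LinearMap.ker E ⊓ H.eigenspace (n : K) : Submodule K V) =
      finrank K (LinearMap.ker F ⊓ H.eigenspace (-(n : K)) : Submodule K V) := by
  rcases lt_or_ge n 0 with hn | hn
  · have h1 : LinearMap.ker E ⊓ H.eigenspace (n : K) = ⊥ := by
      rw [eq_bot_iff]
      rintro v ⟨h1, h2⟩
      exact s.inj hn (End.mem_eigenspace_iff.1 h2) h1
    have h2 : LinearMap.ker F ⊓ H.eigenspace (-(n : K)) = ⊥ := by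
      rw [eq_bot_iff]
      rintro v ⟨h1, h2⟩
      rw [← eig_neg] at h2
      exact s.symm.inj hn (End.mem_eigenspace_iff.1 h2) h1
    rw [h1, h2, finrank_bot]
  · obtain ⟨n, rfl⟩ := Int.eq_ofNat_of_zero_le hn
    have h1 := s.dim_ker_eig n
    have h2 := s.symm.dim_ker_eig n
    rw [eig_neg, eig_neg] at h2
    have h3 := s.dim_neg n
    have h4 := s.dim_neg (n + 2)
    rw [Nat.cast_add, Nat.cast_ofNat] at h4
    have h5 : ((n : ℤ) : K) = (n : K) := Int.cast_natCast n
    rw [h5]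
    omega

lemma even_of (s : Sl2 E F H) (h1 : H.eigenspace (1 : K) = ⊥) :
    ⨆ n : ℤ, H.eigenspace (2 * (n : K)) = ⊤ := by
  have key : ∀ {E F H : Module.End K V}, Sl2 E F H → H.eigenspace (1 : K) = ⊥ →
      ∀ n : ℕ, H.eigenspace ((2 * n + 1 : ℕ) : K) = ⊥ := by
    intro E F H s h1 n
    induction n with
    | zero => simpa using h1
    | succ n ih =>
      rw [eq_bot_iff]
      intro w hw
      obtain ⟨v, hv, rfl⟩ := s.surj (n := (2 * (n + 1 : ℕ) + 1 : ℕ)) (by positivity) (w := w)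
        (by push_cast; exact_mod_cast End.mem_eigenspace_iff.1 hw)
      have : v ∈ H.eigenspace ((2 * n + 1 : ℕ) : K) := by
        rw [End.mem_eigenspace_iff, hv]
        congr 1
        push_cast; ring
      rw [ih] at this
      simp [(Submodule.mem_bot K).1 this]
  have h1' : (-H).eigenspace (1 : K) = ⊥ := by
    have := s.dim_neg 1
    rw [Nat.cast_one, h1, finrank_bot] at this
    rw [eig_neg]
    exact Submodule.finrank_eq_zero.1 this.symm
  rw [eq_top_iff, ← s.iSup_eigenspace]
  refine iSup_le fun n => ?_
  rcases Int.even_or_odd' n with ⟨c, rfl | rfl⟩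
  · refine le_trans (le_of_eq ?_) (le_iSup (fun n : ℤ => H.eigenspace (2 * (n : K))) c)
    push_cast; rfl
  · have : H.eigenspace ((2 * c + 1 : ℤ) : K) = ⊥ := by
      rcases le_or_gt 0 c with hc | hc
      · obtain ⟨c, rfl⟩ := Int.eq_ofNat_of_zero_le hc
        have := key s h1 c
        exact_mod_cast this
      · obtain ⟨d, hd⟩ := Int.eq_ofNat_of_zero_le (show 0 ≤ -c - 1 by omega)
        have := key s.symm h1' d
        rw [eig_neg] at this
        convert this using 2
        have : c = -d - 1 := by omega
        rw [this]; push_cast; ring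
    rw [this]
    exact bot_le
end
end Sl2
end NReg


namespace NReg

set_option linter.unusedSectionVars false

section RankFacts

open Module LieAlgebra LieSubalgebra Polynomial

/-- Lower semicontinuity of the rank along a line. -/
lemma exists_rank_le {K V : Type*} [Field K] [Infinite K] [AddCommGroup V] [Module K V]
    [FiniteDimensional K V] (A B : Module.End K V) (p : K[X]) (hp : p ≠ 0) :
    ∃ t : K, p.eval t ≠ 0 ∧
      finrank K (LinearMap.range A) ≤ finrank K (LinearMap.range (A + t • B)) := by
  classical
  obtain ⟨u, hu⟩ : ∃ u : V →ₗ[K] V, ∀ y ∈ LinearMap.range A, A (u y) = y := by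
    obtain ⟨σ, hσ⟩ := (A.rangeRestrict).exists_rightInverse_of_surjective A.range_rangeRestrict
    obtain ⟨π, hπ⟩ := Submodule.exists_isCompl (LinearMap.range A)
    refine ⟨σ ∘ₗ (Submodule.projectionOnto _ _ hπ), fun y hy => ?_⟩
    have h1 : Submodule.projectionOnto _ _ hπ y = ⟨y, hy⟩ :=
      Submodule.projectionOnto_apply_left hπ ⟨y, hy⟩
    rw [LinearMap.comp_apply, h1]
    have := congrArg Subtype.val (LinearMap.congr_fun hσ ⟨y, hy⟩)
    simpa using this
  set W := LinearMap.range A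
  obtain ⟨Wc, hW⟩ := Submodule.exists_isCompl W
  set pr := Submodule.projectionOnto W Wc hW
  -- endomorphisms of W
  let A' : Module.End K W := pr ∘ₗ A ∘ₗ u ∘ₗ W.subtype
  let B' : Module.End K W := pr ∘ₗ B ∘ₗ u ∘ₗ W.subtype
  have hA' : A' = 1 := by
    ext w
    simp only [A', LinearMap.comp_apply, Submodule.subtype_apply, hu w.1 w.2]
    exact congrArg Subtype.val (Submodule.projectionOnto_apply_left hW w)
  let bs := finBasis K W
  let M : Matrix _ _ K[X] := (1 : Matrix _ _ K[X]) + (X : K[X]) • (LinearMap.toMatrix bs bs B').map C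
  have hM : ∀ t, M.det.eval t = LinearMap.det (A' + t • B') := by
    intro t
    rw [← LinearMap.det_toMatrix bs, ← coe_evalRingHom, RingHom.map_det]
    congr 1
    rw [hA']
    ext i j
    simp [M, Matrix.one_apply, LinearMap.toMatrix_one]
    split_ifs <;> simp [mul_comm]
  have hM0 : M.det ≠ 0 := by
    intro h
    have := hM 0
    rw [h, zero_smul, add_zero, hA'] at this
    simp at this
  obtain ⟨t, ht⟩ : ∃ t, (p * M.det).eval t ≠ 0 := by
    by_contra! h
    exact mul_ne_zero hp hM0 (Polynomial.funext (fun t => by simpa using h t))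
  rw [eval_mul] at ht
  refine ⟨t, left_ne_zero_of_mul ht, ?_⟩
  have h2 := right_ne_zero_of_mul ht
  rw [hM] at h2
  have h3 : A' + t • B' = (pr ∘ₗ (A + t • B)) ∘ₗ (u ∘ₗ W.subtype) := by
    ext w; simp [A', B']
  have hinj : LinearMap.range (A' + t • B') = ⊤ := by
    have : IsUnit (A' + t • B') := (LinearMap.isUnit_iff_isUnit_det _).2 (isUnit_iff_ne_zero.2 h2)
    exact LinearMap.range_eq_top.2 ((Module.End.isUnit_iff _).1 this).surjective
  have h4 : finrank K W ≤ finrank K ((LinearMap.range (A + t • B)).map pr) := by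
    rw [← finrank_top K W, ← hinj, h3]
    refine Submodule.finrank_mono ?_
    rw [← LinearMap.range_comp]
    exact LinearMap.range_comp_le_range _ _
  exact h4.trans (Submodule.finrank_map_le _ _)

variable {K L : Type*} [Field K] [IsAlgClosed K] [CharZero K] [LieRing L] [LieAlgebra K L]
  [FiniteDimensional K L] [LieAlgebra.IsKilling K L]

lemma reg_cartan {x : L} (hx : LieAlgebra.IsRegular K x) : (engel K x).IsCartanSubalgebra := by
  have h : (finrank K L : Cardinal) ≤ Cardinal.mk K :=
    Cardinal.natCast_le_aleph0.trans <| Cardinal.infinite_iff.mp inferInstance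
  refine ⟨?_, normalizer_engel _ _⟩
  apply isNilpotent_of_forall_le_engel
  intro y hy
  set Ex : {engel K z | z ∈ engel K x} := ⟨engel K x, x, self_mem_engel _ _, rfl⟩
  suffices IsBot Ex from @this ⟨engel K y, y, hy, rfl⟩
  apply engel_isBot_of_isMin h (engel K x) Ex le_rfl
  rintro ⟨_, y, hy, rfl⟩ hyx
  suffices finrank K (engel K x) ≤ finrank K (engel K y) by
    suffices engel K y = engel K x from this.ge
    apply LieSubalgebra.toSubmodule_injective
    exact Submodule.eq_of_le_of_finrank_le hyx this
  rw [(isRegular_iff_finrank_engel_eq_rank K x).mp hx]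
  apply rank_le_finrank_engel

lemma ker_le_engel (x : L) : LinearMap.ker (ad K L x) ≤ (engel K x).toSubmodule := by
  intro y hy
  rw [LieSubalgebra.mem_toSubmodule, mem_engel_iff]
  exact ⟨1, by simpa using hy⟩

lemma reg_ker {x : L} (hx : LieAlgebra.IsRegular K x) :
    LinearMap.ker (ad K L x) = (engel K x).toSubmodule := by
  refine le_antisymm (ker_le_engel x) ?_
  have := reg_cartan hx
  intro y hy
  have h := LieAlgebra.IsKilling.instIsLieAbelianOfIsCartanSubalgebra K L (engel K x)
  have h1 := h.trivial ⟨x, self_mem_engel K x⟩ ⟨y, hy⟩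
  simpa [Subtype.ext_iff] using h1

lemma reg_finrank_ker {x : L} (hx : LieAlgebra.IsRegular K x) :
    finrank K (LinearMap.ker (ad K L x)) = LieAlgebra.rank K L := by
  rw [reg_ker hx]
  exact (isRegular_iff_finrank_engel_eq_rank K x).1 hx

/-- Characteristic polynomial along a line. -/
lemma exists_charpoly_line {V : Type*} [AddCommGroup V] [Module K V] [FiniteDimensional K V]
    (A B : Module.End K V) (n : ℕ) :
    ∃ q : K[X], ∀ t, q.eval t = (A + t • B).charpoly.coeff n := by
  classical
  let bs := finBasis K V
  let M : Matrix _ _ K[X] :=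
    (LinearMap.toMatrix bs bs A).map C + (X : K[X]) • (LinearMap.toMatrix bs bs B).map C
  refine ⟨M.charpoly.coeff n, fun t => ?_⟩
  rw [← LinearMap.charpoly_toMatrix _ bs, ← coe_evalRingHom, ← coeff_map, ← Matrix.charpoly_map]
  congr 2
  ext i j
  simp [M]
  ring

lemma rank_le_ker (x : L) : LieAlgebra.rank K L ≤ finrank K (LinearMap.ker (ad K L x)) := by
  obtain ⟨y, hy⟩ := LieAlgebra.exists_isRegular K L
  obtain ⟨q, hq⟩ := exists_charpoly_line (ad K L x) (ad K L (y - x)) (LieAlgebra.rank K L)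
  have hq0 : q ≠ 0 := by
    rintro rfl
    have := hq 1
    rw [one_smul, ← map_add, add_sub_cancel, eval_zero] at this
    exact hy this.symm
  obtain ⟨t, ht, hr⟩ := exists_rank_le (ad K L x) (ad K L (y - x)) q hq0
  rw [hq] at ht
  rw [← map_smul, ← map_add] at ht hr
  have h1 := reg_finrank_ker (x := x + t • (y - x)) ht
  have h2 := LinearMap.finrank_range_add_finrank_ker (ad K L x)
  have h3 := LinearMap.finrank_range_add_finrank_ker (ad K L (x + t • (y - x)))
  omega

end RankFacts

lemma maxGen_eq_eig {K V : Type*} [Field K] [AddCommGroup V] [Module K V]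
    (A : Module.End K V) (hA : ⨆ μ : K, A.eigenspace μ = ⊤) (ν : K) :
    A.maxGenEigenspace ν = A.eigenspace ν := by
  have h1 : A.eigenspace ν ≤ A.maxGenEigenspace ν :=
    Module.End.genEigenspace_le_maximal A ν 1
  have h2 : A.eigenspace ν ⊔ (⨆ μ : K, ⨆ _ : μ ≠ ν, A.eigenspace μ) = ⊤ := by
    rw [eq_top_iff, ← hA]
    refine iSup_le fun μ => ?_
    by_cases h : μ = ν
    · rw [h]; exact le_sup_left
    · refine le_sup_of_le_right ?_
      exact le_iSup_of_le μ (le_iSup_of_le h le_rfl)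
  have h3 : Disjoint (A.maxGenEigenspace ν) (⨆ μ : K, ⨆ _ : μ ≠ ν, A.eigenspace μ) := by
    refine (Module.End.independent_maxGenEigenspace A ν).mono_right ?_
    exact iSup_mono fun μ => iSup_mono fun _ => Module.End.genEigenspace_le_maximal A μ 1
  have h4 := sup_inf_assoc_of_le (⨆ μ : K, ⨆ _ : μ ≠ ν, A.eigenspace μ) h1
  rw [h2, top_inf_eq, inf_comm, h3.eq_bot, sup_bot_eq] at h4
  exact h4

section Triple
open Module LieAlgebra LieSubalgebra

variable {K L : Type*} [Field K] [IsAlgClosed K] [CharZero K] [LieRing L] [LieAlgebra K L]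
  [FiniteDimensional K L] [LieAlgebra.IsKilling K L]

lemma sl2_ad {e h f : L} (hhe : ⁅h, e⁆ = (2 : K) • e) (hhf : ⁅h, f⁆ = -((2 : K) • f))
    (hef : ⁅e, f⁆ = h) : Sl2 (ad K L e) (ad K L f) (ad K L h) where
  he v := by
    simp only [ad_apply]
    rw [leibniz_lie h e v, hhe, smul_lie, add_comm]
  hf v := by
    simp only [ad_apply]
    rw [leibniz_lie h f v, hhf, neg_lie, smul_lie, add_comm, sub_eq_add_neg]
  ef v := by
    simp only [ad_apply]
    rw [leibniz_lie e f v, hef, add_comm]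

/-- Consequences of regularity. -/
lemma regular_triple {e h f : L}
    (s : Sl2 (ad K L e) (ad K L f) (ad K L h))
    (her : finrank K (LinearMap.ker (ad K L e)) = LieAlgebra.rank K L) :
    (ad K L h).eigenspace (1 : K) = ⊥ ∧ LieAlgebra.IsRegular K h := by
  have h0 := s.dim01
  have h1 := rank_le_ker (K := K) h
  have e0 : (ad K L h).eigenspace (0 : K) = LinearMap.ker (ad K L h) := End.eigenspace_zero _
  rw [e0, her] at h0
  have h2 : finrank K ((ad K L h).eigenspace (1 : K)) = 0 := by omega
  refine ⟨Submodule.finrank_eq_zero.1 h2, ?_⟩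
  rw [isRegular_iff_finrank_engel_eq_rank]
  have h3 : finrank K (LinearMap.ker (ad K L h)) = LieAlgebra.rank K L := by omega
  rw [← h3]
  have : (engel K h).toSubmodule = LinearMap.ker (ad K L h) := by
    refine le_antisymm ?_ (ker_le_engel h)
    have hss : ⨆ μ : K, (ad K L h).eigenspace μ = ⊤ := by
      rw [eq_top_iff, ← s.iSup_eigenspace]
      exact iSup_le fun n => le_iSup (fun μ : K => (ad K L h).eigenspace μ) (n : K)
    have := maxGen_eq_eig (ad K L h) hss 0
    intro x hx
    rw [End.eigenspace_zero] at this
    rw [← this]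
    rw [LieSubalgebra.mem_toSubmodule, mem_engel_iff] at hx
    rw [End.mem_maxGenEigenspace]
    simpa using hx
  change finrank K (engel K h).toSubmodule = _
  rw [this]

lemma t_abelian {h x y : L} (hh : LieAlgebra.IsRegular K h) (hx : ⁅h, x⁆ = 0) (hy : ⁅h, y⁆ = 0) :
    ⁅x, y⁆ = 0 := by
  have hc := reg_cartan hh
  have h := LieAlgebra.IsKilling.instIsLieAbelianOfIsCartanSubalgebra K L (engel K h)
  have h1 := h.trivial ⟨x, ker_le_engel _ (by simpa using hx)⟩ ⟨y, ker_le_engel _ (by simpa using hy)⟩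
  simpa [Subtype.ext_iff] using h1

lemma t_semisimple {h x : L} (hh : LieAlgebra.IsRegular K h) (hx : ⁅h, x⁆ = 0) :
    (ad K L x).IsSemisimple := by
  have hc := reg_cartan hh
  exact LieAlgebra.IsKilling.isSemisimple_ad_of_mem_isCartanSubalgebra (H := engel K h)
    (ker_le_engel _ (by simpa using hx))

end Triple
end NReg


namespace NReg

set_option linter.unusedSectionVars false

section HighestWeight
open Module LieAlgebra

variable {K L M : Type*} [Field K] [CharZero K] [LieRing L] [LieAlgebra K L]
  [AddCommGroup M] [Module K M]

/-- Vectors obtained from `η` by repeatedly applying lowering operators. -/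
inductive Low (h : L) (D : L →ₗ[K] Module.End K M) (η : M) : M → ℕ → Prop
  | base : Low h D η η 0
  | step {w : M} {p : ℕ} (y : L) (n : ℕ) (hn : 0 < n) (hy : ⁅h, y⁆ = (-(n : K)) • y)
      (hw : Low h D η w p) : Low h D η (D y w) (p + n)

/-- The submodule spanned by the lowered vectors. -/
def lowSpan (h : L) (D : L →ₗ[K] Module.End K M) (η : M) : Submodule K M :=
  Submodule.span K {w | ∃ p, Low h D η w p}

variable {h : L} {D : L →ₗ[K] Module.End K M} {η : M}

lemma low_weight (hD : ∀ x y v, D ⁅x, y⁆ v = D x (D y v) - D y (D x v)) {μ : K}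
    (hμ : D h η = μ • η) {w : M} {p : ℕ} (hw : Low h D η w p) :
    D h w = (μ - p) • w := by
  induction hw with
  | base => simpa using hμ
  | @step w p y n hn hy hw ih =>
    have h1 := hD h y w
    rw [hy, ih, map_smul, map_smul, LinearMap.smul_apply] at h1
    have h2 : D h (D y w) = (-(n : K)) • D y w + (μ - p) • D y w := by rw [h1]; abel
    rw [h2, ← add_smul]
    congr 1
    push_cast; ring

lemma lowSpan_lower {y : L} {n : ℕ} (hn : 0 < n) (hy : ⁅h, y⁆ = (-(n : K)) • y) {w : M}
    (hw : w ∈ lowSpan h D η) : D y w ∈ lowSpan h D η := by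
  refine Submodule.span_induction (p := fun w _ => D y w ∈ lowSpan h D η) ?_ ?_ ?_ ?_ hw
  · rintro w ⟨p, hp⟩
    exact Submodule.subset_span ⟨_, Low.step y n hn hy hp⟩
  · simp
  · intro a b _ _ ha hb
    rw [map_add]; exact add_mem ha hb
  · intro c a _ ha
    rw [map_smul]; exact Submodule.smul_mem _ _ ha

lemma lowSpan_stable (hD : ∀ x y v, D ⁅x, y⁆ v = D x (D y v) - D y (D x v))
    (htop : ⨆ n : ℤ, (ad K L h).eigenspace (n : K) = ⊤)
    (hb : ∀ (n : ℕ) (x : L), ⁅h, x⁆ = (n : K) • x → ∃ a : K, D x η = a • η)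
    (x : L) {w : M} (hw : w ∈ lowSpan h D η) : D x w ∈ lowSpan h D η := by
  have key : ∀ w p, Low h D η w p → ∀ x, D x w ∈ lowSpan h D η := by
    intro w p hw
    induction hw with
    | base =>
      intro x
      have hx : x ∈ ⨆ n : ℤ, (ad K L h).eigenspace (n : K) := by rw [htop]; trivial
      refine Submodule.iSup_induction _ (motive := fun x => D x η ∈ lowSpan h D η) hx ?_ ?_ ?_
      · intro n x hx
        rw [End.mem_eigenspace_iff, ad_apply] at hx
        rcases le_or_gt 0 n with hn | hn
        · obtain ⟨n, rfl⟩ := Int.eq_ofNat_of_zero_le hn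
          obtain ⟨a, ha⟩ := hb n x (by simpa using hx)
          rw [ha]
          exact Submodule.smul_mem _ _ (Submodule.subset_span ⟨0, Low.base⟩)
        · obtain ⟨m, hm⟩ := Int.eq_ofNat_of_zero_le (show 0 ≤ -n by omega)
          have : n = -(m : ℤ) := by omega
          subst this
          refine Submodule.subset_span ⟨_, Low.step x m (by omega) (by simpa using hx) Low.base⟩
      · simp
      · intro a b ha hb
        rw [map_add, LinearMap.add_apply]; exact add_mem ha hb
    | @step w p y n hn hy hw ih =>
      intro x
      have h1 := hD x y w
      have h2 : D x (D y w) = D ⁅x, y⁆ w + D y (D x w) := by rw [h1]; abel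
      rw [h2]
      exact add_mem (ih _) (lowSpan_lower hn hy (ih x))
  refine Submodule.span_induction (p := fun w _ => D x w ∈ lowSpan h D η) ?_ ?_ ?_ ?_ hw
  · rintro w ⟨p, hp⟩
    exact key w p hp x
  · simp
  · intro a b _ _ ha hb
    rw [map_add]; exact add_mem ha hb
  · intro c a _ ha
    rw [map_smul]; exact Submodule.smul_mem _ _ ha

lemma lowSpan_top (hD : ∀ x y v, D ⁅x, y⁆ v = D x (D y v) - D y (D x v)) {μ : K}
    (hμ : D h η = μ • η) {w : M} (hw : w ∈ lowSpan h D η) (hwμ : D h w = μ • w) :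
    ∃ a : K, w = a • η := by
  have h1 : lowSpan h D η ≤ (Submodule.span K {η}) ⊔
      (⨆ ν : K, ⨆ _ : ν ≠ μ, (D h).eigenspace ν) := by
    refine Submodule.span_le.2 ?_
    rintro w ⟨p, hp⟩
    have h2 := low_weight hD hμ hp
    by_cases hp0 : p = 0
    · subst hp0
      refine Submodule.mem_sup_left ?_
      have aux : ∀ w p, Low h D η w p → p = 0 → w = η := by
        intro w p hw
        cases hw with
        | base => exact fun _ => rfl
        | step y n hn hy hw => intro h0; omega
      rw [aux w 0 hp rfl]
      exact Submodule.mem_span_singleton_self _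
    · refine Submodule.mem_sup_right ?_
      refine Submodule.mem_iSup_of_mem (μ - p) (Submodule.mem_iSup_of_mem ?_ ?_)
      · intro h
        apply hp0
        have : (p : K) = 0 := by linear_combination -h
        exact_mod_cast this
      · exact End.mem_eigenspace_iff.2 h2
  obtain ⟨a, ha, r, hr, rfl⟩ := Submodule.mem_sup.1 (h1 hw)
  obtain ⟨a, rfl⟩ := Submodule.mem_span_singleton.1 ha
  have hr2 : r ∈ (D h).eigenspace μ := by
    rw [End.mem_eigenspace_iff]
    rw [map_add, map_smul, hμ, smul_add, smul_comm μ a] at hwμ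
    exact add_left_cancel hwμ
  have := (Submodule.disjoint_def.1 (End.eigenspaces_iSupIndep (D h) μ)) r hr2 hr
  exact ⟨a, by simp [this]⟩

end HighestWeight

section ExpSum
open Module

/-- Truncated exponential. -/
noncomputable def expSum (K : Type*) {B : Type*} [Field K] [Ring B] [Algebra K B] (n : ℕ) (X : B) : B :=
  ∑ i ∈ Finset.range n, ((i.factorial : K))⁻¹ • X ^ i

lemma expSum_add {K B : Type*} [Field K] [CharZero K] [Ring B] [Algebra K B] {X Y : B} {a b : ℕ}
    (hXY : Commute X Y) (hX : X ^ a = 0) (hY : Y ^ b = 0) :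
    ∃ n, (X + Y) ^ n = 0 ∧ expSum K a X * expSum K b Y = expSum K n (X + Y) := by
  let _ : Module ℚ B := Module.compHom B (algebraMap ℚ K)
  have hs : ∀ (q : ℚ) (x : B), q • x = (q : K) • x := fun q x => rfl
  have he : ∀ (n : ℕ) (x : B), x ^ n = 0 → IsNilpotent.exp x = expSum K n x := by
    intro n x hx
    rw [IsNilpotent.exp_eq_sum hx, expSum]
    refine Finset.sum_congr rfl fun i _ => ?_
    rw [hs]; push_cast; rfl
  have hn : IsNilpotent (X + Y) := hXY.isNilpotent_add ⟨a, hX⟩ ⟨b, hY⟩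
  obtain ⟨n, hn⟩ := hn
  refine ⟨n, hn, ?_⟩
  rw [← he _ _ hX, ← he _ _ hY, ← he _ _ hn, IsNilpotent.exp_add_of_commute hXY ⟨a, hX⟩ ⟨b, hY⟩]

end ExpSum

section Slots
open Module

variable {K L ι : Type*} [Field K] [CharZero K] [AddCommGroup L] [Module K L]
  [Fintype ι] [DecidableEq ι]

/-- Multilinear forms. -/
def MF (K L ι : Type*) [Field K] [AddCommGroup L] [Module K L] :=
  MultilinearMap K (fun _ : ι => L) K

noncomputable instance : AddCommGroup (MF K L ι) :=
  inferInstanceAs (AddCommGroup (MultilinearMap K (fun _ : ι => L) K))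

noncomputable instance : Module K (MF K L ι) :=
  inferInstanceAs (Module K (MultilinearMap K (fun _ : ι => L) K))

noncomputable instance : FunLike (MF K L ι) (ι → L) K :=
  inferInstanceAs (FunLike (MultilinearMap K (fun _ : ι => L) K) (ι → L) K)

@[ext] lemma MF.ext {w w' : MF K L ι} (h : ∀ v, w v = w' v) : w = w' := DFunLike.ext _ _ h

@[simp] lemma MF.add_apply (w w' : MF K L ι) (v : ι → L) : (w + w') v = w v + w' v := rfl
@[simp] lemma MF.smul_apply (c : K) (w : MF K L ι) (v : ι → L) : (c • w) v = c • w v := rfl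
@[simp] lemma MF.neg_apply (w : MF K L ι) (v : ι → L) : (-w) v = - w v := rfl
@[simp] lemma MF.zero_apply (v : ι → L) : (0 : MF K L ι) v = 0 := rfl

/-- Evaluation at a tuple, as a linear functional. -/
noncomputable def MF.ev (v : ι → L) : MF K L ι →ₗ[K] K where
  toFun w := w v
  map_add' _ _ := rfl
  map_smul' _ _ := rfl

lemma MF.sum_apply {J : Type*} (s : Finset J) (w : J → MF K L ι) (v : ι → L) :
    (∑ j ∈ s, w j) v = ∑ j ∈ s, w j v := map_sum (MF.ev v) w s

lemma MF.update_add (w : MF K L ι) (v : ι → L) (i : ι) (x y : L) :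
    w (Function.update v i (x + y)) = w (Function.update v i x) + w (Function.update v i y) :=
  MultilinearMap.map_update_add (show MultilinearMap K (fun _ : ι => L) K from w) v i x y

lemma MF.update_smul (w : MF K L ι) (v : ι → L) (i : ι) (c : K) (x : L) :
    w (Function.update v i (c • x)) = c • w (Function.update v i x) :=
  MultilinearMap.map_update_smul (show MultilinearMap K (fun _ : ι => L) K from w) v i c x

/-- Precomposition by a family. -/
noncomputable def preF (τ : ι → Module.End K L) : Module.End K (MF K L ι) where
  toFun w := MultilinearMap.compLinearMap (show MultilinearMap K (fun _ : ι => L) K from w) τ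
  map_add' _ _ := rfl
  map_smul' _ _ := rfl

lemma preF_apply (τ : ι → Module.End K L) (w : MF K L ι) (v : ι → L) :
    preF τ w v = w (fun i => τ i (v i)) := rfl

lemma preF_update (i : ι) (A : Module.End K L) (w : MF K L ι) (v : ι → L) :
    preF (Function.update (fun _ => LinearMap.id) i A) w v
      = w (Function.update v i (A (v i))) := by
  rw [preF_apply]
  congr 1
  ext j
  by_cases hj : j = i
  · subst hj; simp
  · simp [hj]

/-- The operator acting on a single slot. -/
noncomputable def slot (i : ι) : Module.End K L →ₗ[K] Module.End K (MF K L ι) where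
  toFun A := preF (Function.update (fun _ => LinearMap.id) i A)
  map_add' A B := by
    ext w v
    simp only [LinearMap.add_apply, MF.add_apply, preF_update, MF.update_add]
  map_smul' c A := by
    ext w v
    simp only [LinearMap.smul_apply, MF.smul_apply, preF_update, MF.update_smul, RingHom.id_apply]

lemma slot_apply (i : ι) (A : Module.End K L) (w : MF K L ι) (v : ι → L) :
    slot i A w v = w (Function.update v i (A (v i))) := preF_update i A w v

lemma slot_mul (i : ι) (A B : Module.End K L) :
    slot i A * slot i B = (slot i (B * A) : Module.End K (MF K L ι)) := by
  ext w v
  simp [slot_apply]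

lemma slot_one (i : ι) : (slot i 1 : Module.End K (MF K L ι)) = 1 := by
  ext w v
  simp [slot_apply]

lemma slot_pow (i : ι) (A : Module.End K L) (n : ℕ) :
    (slot i A : Module.End K (MF K L ι)) ^ n = slot i (A ^ n) := by
  induction n with
  | zero => simp [slot_one]
  | succ n ih => rw [pow_succ, ih, slot_mul, pow_succ']

lemma slot_comm {i j : ι} (hij : i ≠ j) (A B : Module.End K L) :
    Commute (slot i A : Module.End K (MF K L ι)) (slot j B) := by
  ext w v
  simp only [Module.End.mul_apply, slot_apply, Function.update_of_ne hij,
    Function.update_of_ne hij.symm]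
  rw [Function.update_comm hij]

lemma slot_expSum (i : ι) (A : Module.End K L) (n : ℕ) :
    (slot i (expSum K n A) : Module.End K (MF K L ι)) = expSum K n (slot i A) := by
  simp only [expSum, map_sum, map_smul, slot_pow]

/-- Precomposition. -/
noncomputable def pre (τ : Module.End K L) : Module.End K (MF K L ι) := preF (fun _ => τ)

lemma pre_apply (τ : Module.End K L) (w : MF K L ι) (v : ι → L) :
    pre τ w v = w (fun i => τ (v i)) := rfl

lemma pre_mul (τ σ : Module.End K L) :
    pre (τ * σ) = (pre σ * pre τ : Module.End K (MF K L ι)) := by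
  ext w v
  simp [pre_apply]

/-- The sum over all slots. -/
noncomputable def dact (A : Module.End K L) : Module.End K (MF K L ι) := ∑ i, slot i A

lemma dact_lin_add (A B : Module.End K L) :
    (dact (A + B) : Module.End K (MF K L ι)) = dact A + dact B := by
  simp [dact, Finset.sum_add_distrib]

lemma dact_lin_smul (c : K) (A : Module.End K L) :
    (dact (c • A) : Module.End K (MF K L ι)) = c • dact A := by
  simp [dact, Finset.smul_sum]

lemma dact_apply (A : Module.End K L) (w : MF K L ι) (v : ι → L) :
    dact A w v = ∑ i, w (Function.update v i (A (v i))) := by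
  simp [dact, slot_apply, MF.sum_apply]

lemma dact_comm (A B : Module.End K L) :
    (dact A * dact B - dact B * dact A : Module.End K (MF K L ι)) = - dact (A * B - B * A) := by
  simp only [dact, Finset.sum_mul_sum]
  rw [Finset.sum_comm (f := fun i j => (slot i B * slot j A : Module.End K (MF K L ι)))]
  rw [← Finset.sum_sub_distrib, ← Finset.sum_neg_distrib]
  refine Finset.sum_congr rfl fun i _ => ?_
  rw [← Finset.sum_sub_distrib, Finset.sum_eq_single i]
  · rw [slot_mul, slot_mul, ← map_sub, ← map_neg]; congr 1; abel
  · intro j _ hj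
    rw [(slot_comm hj.symm A B).eq, sub_self]
  · simp

lemma pre_expSum {A : Module.End K L} {N : ℕ} (hA : A ^ N = 0) :
    ∃ n, (pre (expSum K N A) : Module.End K (MF K L ι)) = expSum K n (dact A) := by
  have key : ∀ s : Finset ι, ∃ n, (∑ i ∈ s, slot i A : Module.End K (MF K L ι)) ^ n = 0 ∧
      ∀ (w : MF K L ι) v, expSum K n (∑ i ∈ s, slot i A : Module.End K (MF K L ι)) w v
        = w (fun i => if i ∈ s then expSum K N A (v i) else v i) := by
    intro s
    induction s using Finset.induction_on with
    | empty => exact ⟨1, by simp, fun w v => by simp [expSum]⟩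
    | insert j s hj ih =>
      obtain ⟨n, hn, hw⟩ := ih
      have hc : Commute (slot j A : Module.End K (MF K L ι)) (∑ i ∈ s, slot i A) := by
        refine Commute.sum_right _ _ _ fun i hi => slot_comm ?_ _ _
        rintro rfl; exact hj hi
      have h0 : (slot j A : Module.End K (MF K L ι)) ^ N = 0 := by rw [slot_pow, hA, map_zero]
      obtain ⟨n', hn', he⟩ := expSum_add (K := K) hc h0 hn
      rw [Finset.sum_insert hj]
      refine ⟨n', hn', fun w v => ?_⟩
      rw [← he, Module.End.mul_apply, ← slot_expSum, slot_apply, hw]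
      congr 1
      ext i
      by_cases hi : i = j
      · subst hi; simp [hj]
      · simp [hi]
  obtain ⟨n, _, hw⟩ := key Finset.univ
  refine ⟨n, ?_⟩
  ext w v
  rw [dact, hw]
  simp [pre_apply]

lemma expSum_mem {B : Module.End K (MF K L ι)} {W : Submodule K (MF K L ι)}
    (hB : ∀ w ∈ W, B w ∈ W) (n : ℕ) {w : MF K L ι} (hw : w ∈ W) : expSum K n B w ∈ W := by
  rw [expSum, LinearMap.sum_apply]
  refine Submodule.sum_mem _ fun i _ => ?_
  rw [LinearMap.smul_apply]
  refine Submodule.smul_mem _ _ ?_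
  clear * - hB hw
  induction i with
  | zero => simpa using hw
  | succ i ih => rw [pow_succ', Module.End.mul_apply]; exact hB _ ih

end Slots
end NReg


namespace NReg

set_option linter.unusedSectionVars false

section Inner
open Module LieAlgebra

variable {K L : Type*} [Field K] [CharZero K]

/-- The determinant as a multilinear form. -/
noncomputable def detMF {Q ι : Type*} [AddCommGroup Q] [Module K Q] [Fintype ι] [DecidableEq ι]
    (B : Basis ι K Q) : MF K Q ι := B.det.toMultilinearMap

lemma detMF_apply {Q ι : Type*} [AddCommGroup Q] [Module K Q] [Fintype ι] [DecidableEq ι]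
    (B : Basis ι K Q) (v : ι → Q) : detMF B v = B.det v := rfl

lemma det_trace {Q ι : Type*} [AddCommGroup Q] [Module K Q] [Fintype ι] [DecidableEq ι]
    (B : Basis ι K Q) (A : Module.End K Q) : ∃ a : K, dact A (detMF B) = a • detMF B := by
  let φ : Q [⋀^ι]→ₗ[K] K :=
    { (show MultilinearMap K (fun _ : ι => Q) K from dact A (detMF B)) with
      map_eq_zero_of_eq' := by
        intro v i j hv hij
        change dact A (detMF B) v = 0
        rw [dact_apply]
        simp only [detMF_apply]
        rw [← Finset.sum_subset (Finset.subset_univ {i, j}), Finset.sum_pair hij]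
        · have h1 : Function.update v j (A (v j)) =
              Function.update v i (A (v i)) ∘ Equiv.swap i j := by
            ext l
            by_cases hli : l = i
            · subst hli
              simp [hij, hij.symm, hv]
            · by_cases hlj : l = j
              · subst hlj
                simp [hv]
              · simp [hli, hlj, Equiv.swap_apply_of_ne_of_ne]
          rw [h1, B.det.map_swap _ hij]
          simp
        · intro l _ hl
          simp only [Finset.mem_insert, Finset.mem_singleton, not_or] at hl
          refine B.det.map_eq_zero_of_eq _ ?_ hij
          rw [Function.update_of_ne (Ne.symm hl.1), Function.update_of_ne (Ne.symm hl.2), hv] }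
  have h := AlternatingMap.eq_smul_basis_det B φ
  refine ⟨φ B, ?_⟩
  ext v
  have := congrArg (fun ψ : Q [⋀^ι]→ₗ[K] K => ψ v) h
  exact this

lemma det_update_self {Q ι : Type*} [AddCommGroup Q] [Module K Q] [Fintype ι] [DecidableEq ι]
    (B : Basis ι K Q) (j : ι) (w : Q) : B.det (Function.update B j w) = B.coord j w := by
  have : (B.det.toMultilinearMap.toLinearMap B j) = B.coord j := by
    refine B.ext fun l => ?_
    rw [MultilinearMap.toLinearMap_apply]
    by_cases h : l = j
    · subst h
      simp [B.det_self]
    · have : B.det (Function.update B j (B l)) = 0 :=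
        B.det.map_eq_zero_of_eq _ (i := j) (j := l) (by simp [h]) (Ne.symm h)
      simp [Finsupp.single_apply, h]
      exact this
  exact LinearMap.congr_fun this w

variable [LieRing L] [LieAlgebra K L] [FiniteDimensional K L]

/-- The pulled back determinant form. -/
noncomputable def etaI (I : Submodule K L) :
    MF K L (Fin (finrank K (L ⧸ I))) :=
  MultilinearMap.compLinearMap
    (show MultilinearMap K (fun _ : Fin (finrank K (L ⧸ I)) => L ⧸ I) K from
      detMF (finBasis K (L ⧸ I))) (fun _ => I.mkQ)

lemma etaI_apply (I : Submodule K L) (v) :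
    etaI I v = (finBasis K (L ⧸ I)).det (fun i => I.mkQ (v i)) := rfl

lemma dact_etaI (I : Submodule K L) (A : Module.End K L) (hA : ∀ y ∈ I, A y ∈ I) :
    ∃ a : K, dact A (etaI I) = a • etaI I := by
  obtain ⟨a, ha⟩ := det_trace (finBasis K (L ⧸ I)) (I.mapQ I A hA)
  refine ⟨a, ?_⟩
  ext v
  have h1 : dact (I.mapQ I A hA) (detMF (finBasis K (L ⧸ I))) (fun i => I.mkQ (v i)) = _ :=
    congrArg (fun w => w (fun i => I.mkQ (v i))) ha
  rw [dact_apply] at h1 ⊢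
  rw [MF.smul_apply, etaI_apply]
  refine Eq.trans (Finset.sum_congr rfl fun i _ => ?_) h1
  rw [etaI_apply, detMF_apply]
  congr 1
  ext j
  by_cases hj : j = i
  · subst hj; simp
  · simp [hj]

/-- The dual action on multilinear forms. -/
noncomputable def dD (K L ι : Type*) [Field K] [CharZero K] [LieRing L] [LieAlgebra K L]
    [Fintype ι] [DecidableEq ι] : L →ₗ[K] Module.End K (MF K L ι) where
  toFun x := - dact (ad K L x)
  map_add' x y := by rw [map_add, dact_lin_add, neg_add]
  map_smul' c x := by rw [map_smul, dact_lin_smul, smul_neg, RingHom.id_apply]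

lemma dD_apply {ι : Type*} [Fintype ι] [DecidableEq ι] (x : L) (w : MF K L ι) :
    dD K L ι x w = - dact (ad K L x) w := rfl

lemma dD_lie {ι : Type*} [Fintype ι] [DecidableEq ι] (x y : L) (w : MF K L ι) :
    dD K L ι ⁅x, y⁆ w = dD K L ι x (dD K L ι y w) - dD K L ι y (dD K L ι x w) := by
  have h := dact_comm (ι := ι) (ad K L x) (ad K L y)
  have h2 : ad K L x * ad K L y - ad K L y * ad K L x = ad K L ⁅x, y⁆ := by
    ext z
    simp only [LinearMap.sub_apply, Module.End.mul_apply, ad_apply, lie_lie]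
  rw [h2] at h
  have h3 := LinearMap.congr_fun h w
  simp only [dD_apply, map_neg, neg_neg]
  simp only [LinearMap.sub_apply, Module.End.mul_apply, LinearMap.neg_apply] at h3
  exact h3.symm

instance {ι : Type*} [Fintype ι] [DecidableEq ι] : FiniteDimensional K (MF K L ι) :=
  inferInstanceAs (FiniteDimensional K (MultilinearMap K (fun _ : ι => L) K))

lemma inner_stable_W {ι : Type*} [Fintype ι] [DecidableEq ι] {θ : L ≃ₗ[K] L}
    (hθ : θ ∈ Subgroup.closure {τ : L ≃ₗ[K] L | ∃ n : L, IsNilpotent (ad K L n) ∧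
      (τ : L →ₗ[K] L) = expSum K (finrank K L + 1) (ad K L n)})
    (W : Submodule K (MF K L ι)) (hW : ∀ x, ∀ w ∈ W, dD K L ι x w ∈ W) :
    ∀ w ∈ W, pre (θ : L →ₗ[K] L) w ∈ W := by
  induction hθ using Subgroup.closure_induction with
  | mem τ hτ =>
    obtain ⟨n, hn, he⟩ := hτ
    intro w hw
    have h0 : (ad K L n) ^ (finrank K L + 1) = 0 := by
      have h1 := (LinearMap.charpoly_eq_X_pow_iff (ad K L n)).2 (fun v => by
        obtain ⟨j, hj⟩ := hn
        exact ⟨j, by rw [hj]; rfl⟩)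
      have h2 := LinearMap.aeval_self_charpoly (ad K L n)
      rw [h1, map_pow, Polynomial.aeval_X] at h2
      rw [pow_succ, h2, zero_mul]
    obtain ⟨m, hm⟩ := pre_expSum (ι := ι) h0
    rw [he, hm]
    refine expSum_mem ?_ m hw
    intro w hw
    have := W.neg_mem (hW n w hw)
    rwa [dD_apply, neg_neg] at this
  | one =>
    intro w hw
    have : pre ((1 : L ≃ₗ[K] L) : L →ₗ[K] L) w = w := by ext v; rfl
    rwa [this]
  | mul τ σ _ _ h1 h2 =>
    intro w hw
    have : pre ((τ * σ : L ≃ₗ[K] L) : L →ₗ[K] L) w = pre (σ : L →ₗ[K] L) (pre (τ : L →ₗ[K] L) w) := by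
      ext v; rfl
    rw [this]
    exact h2 _ (h1 _ hw)
  | inv τ _ h1 =>
    intro w hw
    have hinj : Function.Injective (pre (ι := ι) (τ : L →ₗ[K] L)) := by
      intro a b hab
      have h3 : ∀ a : MF K L ι, pre ((τ⁻¹ : L ≃ₗ[K] L) : L →ₗ[K] L) (pre (τ : L →ₗ[K] L) a) = a := by
        intro a; ext v
        rw [pre_apply, pre_apply]
        congr 1
        ext i
        exact τ.apply_symm_apply (v i)
      rw [← h3 a, hab, h3]
    have hmap : W.map (pre (τ : L →ₗ[K] L)) = W := by
      refine Submodule.eq_of_le_of_finrank_eq ?_ ?_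
      · rintro _ ⟨a, ha, rfl⟩
        exact h1 a ha
      · exact (Submodule.equivMapOfInjective _ hinj W).finrank_eq.symm
    rw [← hmap] at hw
    obtain ⟨a, ha, rfl⟩ := hw
    have : pre ((τ⁻¹ : L ≃ₗ[K] L) : L →ₗ[K] L) (pre (τ : L →ₗ[K] L) a) = a := by
      ext v
      rw [pre_apply, pre_apply]
      congr 1
      ext i
      exact τ.apply_symm_apply (v i)
    rwa [this]

/-- An inner automorphism fixing `h` preserves every subspace stable under the
non-negative part. -/
lemma inner_stable {h : L} {θ : L ≃ₗ[K] L}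
    (hθ : θ ∈ Subgroup.closure {τ : L ≃ₗ[K] L | ∃ n : L, IsNilpotent (ad K L n) ∧
      (τ : L →ₗ[K] L) = expSum K (finrank K L + 1) (ad K L n)})
    (hθb : ∀ x y : L, θ ⁅x, y⁆ = ⁅θ x, θ y⁆) (hθh : θ h = h)
    (htop : ⨆ n : ℤ, (ad K L h).eigenspace (n : K) = ⊤) (I : Submodule K L)
    (hI : ∀ (n : ℕ) (x : L), ⁅h, x⁆ = (n : K) • x → ∀ y ∈ I, ⁅x, y⁆ ∈ I) :
    ∀ y ∈ I, θ y ∈ I := by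
  have hb : ∀ (n : ℕ) (x : L), ⁅h, x⁆ = (n : K) • x → ∃ a : K, dD K L _ x (etaI I) = a • etaI I := by
    intro n x hx
    obtain ⟨a, ha⟩ := dact_etaI I (ad K L x) (fun y hy => hI n x hx y hy)
    exact ⟨-a, by rw [dD_apply, ha, neg_smul]⟩
  obtain ⟨μ, hμ⟩ := hb 0 h (by simp)
  have hst := fun x w hw => lowSpan_stable (M := MF K L _) (D := dD K L _) dD_lie htop hb x (w := w) hw
  have h1 := inner_stable_W hθ (lowSpan h (dD K L _) (etaI I)) hst _
    (Submodule.subset_span ⟨0, Low.base⟩)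
  have h2 : dD K L _ h (pre (θ : L →ₗ[K] L) (etaI I)) = μ • pre (θ : L →ₗ[K] L) (etaI I) := by
    ext v
    have h3 := congrArg (fun w => w (fun i => θ (v i))) hμ
    rw [MF.smul_apply, pre_apply]
    refine Eq.trans ?_ h3
    rw [dD_apply, dD_apply, MF.neg_apply, MF.neg_apply, dact_apply, dact_apply]
    congr 1
    refine Finset.sum_congr rfl fun i _ => ?_
    rw [pre_apply]
    congr 1
    ext j
    by_cases hj : j = i
    · subst hj
      simp [hθb, hθh]
    · simp [hj]
  obtain ⟨a, ha⟩ := lowSpan_top dD_lie hμ h1 h2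
  intro y hy
  by_contra hne
  have hne' : I.mkQ (θ y) ≠ 0 := by simpa using hne
  set B := finBasis K (L ⧸ I) with hB
  obtain ⟨j, hj⟩ : ∃ j, B.coord j (I.mkQ (θ y)) ≠ 0 := by
    by_contra! h0
    exact hne' (B.ext_elem fun j => by simpa using h0 j)
  choose u hu using fun i => I.mkQ_surjective (B i)
  have h5 := congrArg (fun w => w (Function.update (fun i => θ.symm (u i)) j y)) ha
  rw [MF.smul_apply, pre_apply, etaI_apply, etaI_apply] at h5
  have h6 : (fun i => I.mkQ ((θ : L →ₗ[K] L) (Function.update (fun i => θ.symm (u i)) j y i)))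
      = Function.update B j (I.mkQ (θ y)) := by
    ext i
    by_cases hi : i = j
    · subst hi; simp
    · simp only [Function.update_of_ne hi, LinearEquiv.coe_coe, LinearEquiv.apply_symm_apply, hu]
  rw [h6, det_update_self] at h5
  apply hj
  rw [h5, smul_eq_mul]
  refine mul_eq_zero_of_right _ ?_
  refine AlternatingMap.map_coord_zero _ j ?_
  simpa using hy

end Inner
end NReg


namespace NReg

set_option linter.unusedSectionVars false

section ThetaAct
open Module LieAlgebra

variable {K L : Type*} [Field K] [IsAlgClosed K] [CharZero K] [LieRing L] [LieAlgebra K L]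
  [FiniteDimensional K L] [LieAlgebra.IsKilling K L]

lemma mem_eig {h x : L} {a : K} : x ∈ (ad K L h).eigenspace a ↔ ⁅h, x⁆ = a • x := by
  rw [End.mem_eigenspace_iff, ad_apply]

lemma lie_eig {h x y : L} {a b : K} (hx : ⁅h, x⁆ = a • x) (hy : ⁅h, y⁆ = b • y) :
    ⁅h, ⁅x, y⁆⁆ = (a + b) • ⁅x, y⁆ := by
  rw [leibniz_lie, hx, hy, smul_lie, lie_smul, add_smul]

lemma theta_J {h : L} {θ : L ≃ₗ[K] L}
    (hθ : θ ∈ Subgroup.closure {τ : L ≃ₗ[K] L | ∃ n : L, IsNilpotent (ad K L n) ∧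
      (τ : L →ₗ[K] L) = expSum K (finrank K L + 1) (ad K L n)})
    (hθb : ∀ x y : L, θ ⁅x, y⁆ = ⁅θ x, θ y⁆) (hθh : θ h = h)
    (htop : ⨆ n : ℤ, (ad K L h).eigenspace (n : K) = ⊤) (J : Submodule K L)
    (hJ2 : J ≤ (ad K L h).eigenspace 2)
    (hJ : ∀ x : L, ⁅h, x⁆ = 0 → ∀ y ∈ J, ⁅x, y⁆ ∈ J) :
    ∀ y ∈ J, θ y ∈ J := by
  intro y hy
  let R : Submodule K L := ⨆ (n : ℕ) (_ : 3 ≤ n), (ad K L h).eigenspace (n : K)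
  have hR : ∀ (n : ℕ), 3 ≤ n → (ad K L h).eigenspace (n : K) ≤ R := fun n hn =>
    le_iSup_of_le n (le_iSup_of_le hn le_rfl)
  have hst : ∀ (n : ℕ) (x : L), ⁅h, x⁆ = (n : K) • x → ∀ y ∈ J ⊔ R, ⁅x, y⁆ ∈ J ⊔ R := by
    intro n x hx
    have hJR : J ≤ (J ⊔ R).comap (ad K L x) := by
      intro y hy
      rw [Submodule.mem_comap, ad_apply]
      rcases Nat.eq_zero_or_pos n with h0 | h0
      · exact le_sup_left (α := Submodule K L) (hJ x (by simpa [h0] using hx) y hy)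
      · refine le_sup_right (α := Submodule K L) (hR (n + 2) (by omega) ?_)
        rw [mem_eig]
        push_cast
        exact lie_eig hx (mem_eig.1 (hJ2 hy))
    have hRR : R ≤ (J ⊔ R).comap (ad K L x) := by
      refine iSup_le fun l => iSup_le fun hl => ?_
      intro y hy
      rw [Submodule.mem_comap, ad_apply]
      refine le_sup_right (α := Submodule K L) (hR (n + l) (by omega) ?_)
      rw [mem_eig]
      push_cast
      exact lie_eig hx (mem_eig.1 hy)
    intro y hy
    exact sup_le hJR hRR hy
  have h1 := inner_stable hθ hθb hθh htop (J ⊔ R) hst y (le_sup_left (α := Submodule K L) hy)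
  obtain ⟨j, hj, r, hr, hjr⟩ := Submodule.mem_sup.1 h1
  have h2 : θ y ∈ (ad K L h).eigenspace 2 := by
    rw [mem_eig]
    have := congrArg θ (mem_eig.1 (hJ2 hy))
    rwa [hθb, hθh, map_smul] at this
  have h3 : r ∈ (ad K L h).eigenspace 2 := by
    have : r = θ y - j := by rw [← hjr]; abel
    rw [this]
    exact Submodule.sub_mem _ h2 (hJ2 hj)
  have h4 := (End.eigenspaces_iSupIndep (ad K L h)) 2
  have h5 : R ≤ ⨆ (μ : K) (_ : μ ≠ 2), (ad K L h).eigenspace μ := by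
    refine iSup_le fun l => iSup_le fun hl => ?_
    refine le_iSup_of_le (l : K) (le_iSup_of_le ?_ le_rfl)
    have : l ≠ 2 := by omega
    exact_mod_cast this
  have h6 : r = 0 := by
    have := h4.le_bot ⟨h3, h5 hr⟩
    simpa using this
  rw [← hjr, h6, add_zero]
  exact hj

variable {e h f : L}

lemma ze_t (s : Sl2 (ad K L e) (ad K L f) (ad K L h)) 
    (h1 : (ad K L h).eigenspace (1 : K) = ⊥) (hh : LieAlgebra.IsRegular K h)
    {y : L} (hy : ⁅h, y⁆ = 0) (hey : ⁅e, y⁆ = 0) : y = 0 := by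
  have hfy : ⁅f, y⁆ = 0 := by
    refine s.inj (n := -2) (by norm_num) (v := ⁅f, y⁆) ?_ ?_
    · have := s.hf y
      simp only [ad_apply, hy, lie_zero, zero_sub] at this ⊢
      rw [this]; push_cast; rw [neg_smul]
    · have := s.ef y
      simp only [ad_apply, hy, hey, lie_zero, zero_add] at this ⊢
      exact this
  have hpos : ∀ c : ℕ, ∀ x : L, ⁅h, x⁆ = (2 * (c : K)) • x → ⁅y, x⁆ = 0 := by
    intro c
    induction c with
    | zero => intro x hx; exact t_abelian (K := K) hh hy (by simpa using hx)
    | succ c ih =>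
      intro x hx
      obtain ⟨v, hv, rfl⟩ := s.surj (n := 2 * ((c : ℤ) + 1)) (by positivity) (w := x) (by
        rw [ad_apply, hx]; push_cast; rfl)
      rw [ad_apply] at hv
      have := ih v (by rw [hv]; congr 1; push_cast; ring)
      rw [ad_apply, leibniz_lie, this, ← lie_skew y e, hey]
      simp
  have hneg : ∀ c : ℕ, ∀ x : L, ⁅h, x⁆ = (-(2 * (c : K))) • x → ⁅y, x⁆ = 0 := by
    intro c
    induction c with
    | zero => intro x hx; exact t_abelian (K := K) hh hy (by simpa using hx)
    | succ c ih =>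
      intro x hx
      obtain ⟨v, hv, rfl⟩ := s.symm.surj (n := 2 * ((c : ℤ) + 1)) (by positivity) (w := x) (by
        rw [LinearMap.neg_apply, ad_apply, hx]; push_cast; rw [← neg_smul, neg_neg])
      rw [LinearMap.neg_apply, ad_apply] at hv
      have := ih v (by
        rw [← neg_inj, hv, ← neg_smul]; congr 1; push_cast; ring)
      rw [ad_apply, leibniz_lie, this, ← lie_skew y f, hfy]
      simp
  have htop : LinearMap.ker (ad K L y) = ⊤ := by
    rw [eq_top_iff, ← s.even_of h1]
    refine iSup_le fun n => ?_
    intro x hx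
    rw [mem_eig] at hx
    rw [LinearMap.mem_ker, ad_apply]
    obtain ⟨c, rfl | rfl⟩ := Int.eq_nat_or_neg n
    · exact hpos c x (by simpa using hx)
    · exact hneg c x (by simpa using hx)
  have h2 : ad K L y = 0 := LinearMap.ker_eq_top.1 htop
  have h3 : y ∈ LieAlgebra.center K L := by
    rw [LieModule.mem_maxTrivSubmodule]
    intro x
    have := LinearMap.congr_fun h2 x
    rw [ad_apply, LinearMap.zero_apply] at this
    rw [← lie_skew, this, neg_zero]
  simpa using h3

lemma theta_t (s : Sl2 (ad K L e) (ad K L f) (ad K L h)) 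
    (h1 : (ad K L h).eigenspace (1 : K) = ⊥) (hh : LieAlgebra.IsRegular K h) {θ : L ≃ₗ[K] L}
    (hθ : θ ∈ Subgroup.closure {τ : L ≃ₗ[K] L | ∃ n : L, IsNilpotent (ad K L n) ∧
      (τ : L →ₗ[K] L) = expSum K (finrank K L + 1) (ad K L n)})
    (hθb : ∀ x y : L, θ ⁅x, y⁆ = ⁅θ x, θ y⁆) (hθh : θ h = h) (hhe : ⁅h, e⁆ = (2 : K) • e)
    {ζ : K} (hζ : ζ ≠ 0) (hθe : θ e = ζ • e) {u : L} (hu : ⁅h, u⁆ = 0) : θ u = u := by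
  have key : ∀ y ∈ (ad K L h).eigenspace 2, θ ⁅u, y⁆ = ⁅u, θ y⁆ := by
    have hst : ∀ y ∈ (ad K L h).eigenspace 2, ad K L u y ∈ (ad K L h).eigenspace 2 := by
      intro y hy
      rw [mem_eig] at hy ⊢
      have := lie_eig (a := (0 : K)) (by simpa using hu) hy
      simpa using this
    have hss := (t_semisimple (K := K) hh hu).iSup_eigenspace_eq_top
    have h3 := Submodule.inf_iSup_genEigenspace (p := (ad K L h).eigenspace 2) (f := ad K L u) hst 1
    intro y hy
    have hy' : y ∈ ⨆ μ : K, (ad K L h).eigenspace 2 ⊓ (ad K L u).genEigenspace μ 1 := by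
      rw [← h3]; exact ⟨hy, by
        have : (⨆ μ : K, (ad K L u).genEigenspace μ 1) = ⊤ := hss
        rw [this]; trivial⟩
    clear hy
    induction hy' using Submodule.iSup_induction' with
    | zero => simp
    | add a b _ _ ha hb =>
      rw [lie_add, map_add, map_add, lie_add, ha, hb]
    | mem μ x hx => 
      have h4 := theta_J hθ hθb hθh s.iSup_eigenspace ((ad K L h).eigenspace 2 ⊓ (ad K L u).eigenspace μ)
        inf_le_left ?_ x hx
      · have h5 := mem_eig.1 h4.2
        have h6 : ⁅u, x⁆ = μ • x := mem_eig.1 hx.2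
        rw [h5, h6, map_smul]
      · rintro w hw z ⟨hz1, hz2⟩
        refine ⟨?_, ?_⟩
        · have := lie_eig (a := (0 : K)) (by simpa using hw) (mem_eig.1 hz1)
          exact mem_eig.2 (by simpa using this)
        · have := lie_eig (h := u) (a := (0 : K)) (by simpa using t_abelian (K := K) hh hu hw) (mem_eig.1 hz2)
          exact mem_eig.2 (by simpa using this)
  have h2 := key e (mem_eig.2 hhe)
  rw [hθb, hθe, lie_smul, lie_smul] at h2
  have h3 := smul_right_injective L hζ h2
  rw [← sub_eq_zero, ← sub_lie] at h3
  have h4 : ⁅h, θ u⁆ = 0 := by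
    have := congrArg θ hu
    rwa [hθb, hθh, map_zero] at this
  rw [← sub_eq_zero]
  exact ze_t s h1 hh (by rw [lie_sub, h4, hu, sub_zero]) (by rw [← lie_skew, h3, neg_zero])

lemma theta_act (s : Sl2 (ad K L e) (ad K L f) (ad K L h)) 
    (h1 : (ad K L h).eigenspace (1 : K) = ⊥) (hh : LieAlgebra.IsRegular K h) {θ : L ≃ₗ[K] L}
    (hθ : θ ∈ Subgroup.closure {τ : L ≃ₗ[K] L | ∃ n : L, IsNilpotent (ad K L n) ∧
      (τ : L →ₗ[K] L) = expSum K (finrank K L + 1) (ad K L n)})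
    (hθb : ∀ x y : L, θ ⁅x, y⁆ = ⁅θ x, θ y⁆) (hθh : θ h = h) (hhe : ⁅h, e⁆ = (2 : K) • e)
    {ζ : K} (hζ : ζ ≠ 0) (hθe : θ e = ζ • e) (hθf : θ f = ζ⁻¹ • f) (c : ℤ) {x : L}
    (hx : ⁅h, x⁆ = (2 * (c : K)) • x) : θ x = ζ ^ c • x := by
  have hpos : ∀ c : ℕ, ∀ x : L, ⁅h, x⁆ = (2 * (c : K)) • x → θ x = ζ ^ c • x := by
    intro c
    induction c with
    | zero =>
      intro x hx
      rw [pow_zero, one_smul]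
      exact theta_t s h1 hh hθ hθb hθh hhe hζ hθe (by simpa using hx)
    | succ c ih =>
      intro x hx
      obtain ⟨v, hv, rfl⟩ := s.surj (n := 2 * ((c : ℤ) + 1)) (by positivity) (w := x) (by
        rw [ad_apply, hx]; push_cast; rfl)
      rw [ad_apply] at hv
      have := ih v (by rw [hv]; congr 1; push_cast; ring)
      rw [ad_apply, hθb, this, hθe, smul_lie, lie_smul, smul_smul, pow_succ']
  have hneg : ∀ c : ℕ, ∀ x : L, ⁅h, x⁆ = (-(2 * (c : K))) • x → θ x = (ζ⁻¹) ^ c • x := by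
    intro c
    induction c with
    | zero =>
      intro x hx
      rw [pow_zero, one_smul]
      exact theta_t s h1 hh hθ hθb hθh hhe hζ hθe (by simpa using hx)
    | succ c ih =>
      intro x hx
      obtain ⟨v, hv, rfl⟩ := s.symm.surj (n := 2 * ((c : ℤ) + 1)) (by positivity) (w := x) (by
        rw [LinearMap.neg_apply, ad_apply, hx]; push_cast; rw [← neg_smul, neg_neg])
      rw [LinearMap.neg_apply, ad_apply] at hv
      have := ih v (by
        rw [← neg_inj, hv, ← neg_smul]; congr 1; push_cast; ring)
      rw [ad_apply, hθb, this, hθf, smul_lie, lie_smul, smul_smul, pow_succ']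
  obtain ⟨c, rfl | rfl⟩ := Int.eq_nat_or_neg c
  · simpa using hpos c x (by simpa using hx)
  · simpa using hneg c x (by simpa using hx)

end ThetaAct
end NReg


namespace NReg

set_option linter.unusedSectionVars false

section Slice
open Module LieAlgebra

lemma finrank_finset_sup {K V ι : Type*} [Field K] [AddCommGroup V] [Module K V]
    [FiniteDimensional K V] (N : ι → Submodule K V) (ind : iSupIndep N) (s : Finset ι) :
    finrank K (s.sup N : Submodule K V) = ∑ i ∈ s, finrank K (N i) := by
  classical
  induction s using Finset.induction_on with
  | empty => simp
  | insert a s ha ih =>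
    rw [Finset.sup_insert, Finset.sum_insert ha, ← ih, ← Submodule.finrank_sup_add_finrank_inf_eq]
    have : Disjoint (N a) (s.sup N) := by
      refine (ind a).mono_right ?_
      refine Finset.sup_le fun i hi => ?_
      refine le_iSup_of_le i (le_iSup_of_le ?_ le_rfl)
      rintro rfl; exact ha hi
    rw [this.eq_bot, finrank_bot, add_zero]

lemma finrank_finsum {K V ι : Type*} [Field K] [AddCommGroup V] [Module K V]
    [FiniteDimensional K V] (N : ι → Submodule K V) (ind : iSupIndep N) :
    finrank K (⨆ i, N i : Submodule K V) = ∑ᶠ i, finrank K (N i) := by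
  classical
  have hf := WellFoundedGT.finite_ne_bot_of_iSupIndep ind
  rw [finsum_eq_sum_of_support_subset (s := hf.toFinset) _ ?_, ← finrank_finset_sup N ind]
  · suffices hE : ⨆ i, N i = hf.toFinset.sup N by rw [hE]
    apply le_antisymm
    · refine iSup_le fun i => ?_
      by_cases h : N i = ⊥
      · rw [h]; exact bot_le
      · exact Finset.le_sup (f := N) (by simpa using h)
    · exact Finset.sup_le fun i _ => le_iSup N i
  · intro i hi
    simp only [Function.mem_support] at hi
    simp only [Set.Finite.coe_toFinset, Set.mem_ofPred_eq]
    rintro h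
    exact hi (by rw [h, finrank_bot])

lemma inf_eig {K V : Type*} [Field K] [CharZero K] [AddCommGroup V] [Module K V]
    [FiniteDimensional K V] {H : Module.End K V}
    (htop : ⨆ n : ℤ, H.eigenspace (2 * (n : K)) = ⊤) {P : Submodule K V}
    (hP : ∀ x ∈ P, H x ∈ P) : ⨆ n : ℤ, P ⊓ H.eigenspace (2 * (n : K)) = P := by
  apply le_antisymm
  · exact iSup_le fun n => inf_le_left
  have h1 := Submodule.inf_iSup_genEigenspace (p := P) (f := H) hP 1
  have h2 : (⨆ μ : K, H.genEigenspace μ 1) = ⊤ := by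
    rw [eq_top_iff, ← htop]
    exact iSup_le fun n => le_iSup (fun μ : K => H.genEigenspace μ 1) (2 * (n : K))
  rw [h2, inf_top_eq] at h1
  conv_lhs => rw [h1]
  refine iSup_le fun μ => ?_
  by_cases hμ : ∃ n : ℤ, 2 * (n : K) = μ
  · obtain ⟨n, rfl⟩ := hμ
    exact le_iSup (fun n : ℤ => P ⊓ H.eigenspace (2 * (n : K))) n
  · have h3 := (End.eigenspaces_iSupIndep H) μ
    have h4 : (⊤ : Submodule K V) ≤ ⨆ (j : K) (_ : j ≠ μ), H.eigenspace j := by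
      rw [← htop]
      refine iSup_le fun n => le_iSup_of_le (2 * (n : K)) (le_iSup_of_le ?_ le_rfl)
      rintro rfl; exact hμ ⟨n, rfl⟩
    rw [top_le_iff.1 h4, disjoint_top] at h3
    have h5 : P ⊓ H.genEigenspace μ 1 ≤ ⊥ := by
      refine inf_le_right.trans ?_
      exact h3.le
    exact h5.trans bot_le

/-- a graded basis -/
lemma graded_basis {K V : Type*} [Field K] [CharZero K] [AddCommGroup V] [Module K V]
    [FiniteDimensional K V] {H : Module.End K V}
    (htop : ⨆ n : ℤ, H.eigenspace (2 * (n : K)) = ⊤) {P : Submodule K V}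
    (hP : ∀ x ∈ P, H x ∈ P) : ∃ (b : Basis (Fin (finrank K P)) K P) (d : Fin (finrank K P) → ℤ),
      ∀ i, H (b i) = (2 * (d i : K)) • (b i : V) := by
  let S : Set V := {x | x ∈ P ∧ ∃ n : ℤ, H x = (2 * (n : K)) • x}
  have hS : Submodule.span K S = P := by
    apply le_antisymm
    · exact Submodule.span_le.2 fun x hx => hx.1
    · conv_lhs => rw [← inf_eig htop hP]
      refine iSup_le fun n x hx => Submodule.subset_span ⟨hx.1, n, End.mem_eigenspace_iff.1 hx.2⟩
  obtain ⟨B, hB, hsp, hli⟩ := exists_linearIndependent K S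
  rw [hS] at hsp
  have hr : Set.range ((↑) : B → V) = B := Subtype.range_coe
  let b1 := Basis.span hli
  rw [hr] at b1
  let b2 : Basis B K P := (Basis.span hli).map (LinearEquiv.ofEq _ _ (by rw [hr, hsp]))
  have hb2 : ∀ i, (b2 i : V) = i := fun i => by
    simp [b2, Basis.span_apply]
  have : Fintype B := FiniteDimensional.fintypeBasisIndex b2
  let eqv : B ≃ Fin (finrank K P) := Fintype.equivFinOfCardEq (Module.finrank_eq_card_basis b2).symm
  have h3 : ∀ i : B, ∃ n : ℤ, H (i : V) = (2 * (n : K)) • (i : V) := fun i => (hB i.2).2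
  choose d hd using h3
  refine ⟨b2.reindex eqv, fun i => d (eqv.symm i), fun i => ?_⟩
  rw [Basis.reindex_apply, hb2]
  exact hd _

variable {K L : Type*} [Field K] [IsAlgClosed K] [CharZero K] [LieRing L] [LieAlgebra K L]
  [FiniteDimensional K L] [LieAlgebra.IsKilling K L] {e h f : L}

lemma slice_dim {m : ℕ} (s : Sl2 (ad K L e) (ad K L f) (ad K L h))
    (h1 : (ad K L h).eigenspace (1 : K) = ⊥) {θ : L ≃ₗ[K] L}
    (hθb : ∀ x y : L, θ ⁅x, y⁆ = ⁅θ x, θ y⁆) (hθh : θ h = h) 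
    {ζ : K} (hm : 1 ≤ m) (hζ : IsPrimitiveRoot ζ m)
    (hact : ∀ (c : ℤ) (x : L), ⁅h, x⁆ = (2 * (c : K)) • x → θ x = ζ ^ c • x) :
    finrank K (LinearMap.ker (ad K L f) ⊓ End.eigenspace (θ : L →ₗ[K] L) ζ : Submodule K L) =
    ∑ᶠ c : ℤ, if ((c : ZMod m) = -1) then
      finrank K (LinearMap.ker (ad K L e) ⊓ (ad K L h).eigenspace (2 * (c : K)) : Submodule K L)
      else 0 := by
  classical
  have hζ0 : ζ ≠ 0 := hζ.ne_zero (by omega)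
  set W := (LinearMap.ker (ad K L f) ⊓ End.eigenspace (θ : L →ₗ[K] L) ζ : Submodule K L) with hW
  have hst : ∀ x ∈ W, ad K L h x ∈ W := by
    rintro x ⟨hx1, hx2⟩
    refine ⟨?_, ?_⟩
    · have hx1' : ad K L f x = 0 := hx1
      have := s.hf x
      rw [hx1', map_zero] at this
      simp only [smul_zero, sub_zero] at this
      exact this.symm
    · have hx2' : θ x = ζ • x := End.mem_eigenspace_iff.1 hx2
      refine End.mem_eigenspace_iff.2 ?_
      simp only [LinearEquiv.coe_coe, ad_apply]
      rw [hθb, hθh, hx2', lie_smul]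
  have htop := s.even_of h1
  have hind : iSupIndep fun n : ℤ => (ad K L h).eigenspace (2 * (n : K)) := by
    refine (End.eigenspaces_iSupIndep (ad K L h)).comp ?_
    intro a b hab
    have h2 := mul_left_cancel₀ (two_ne_zero : (2 : K) ≠ 0) hab
    exact_mod_cast h2
  have hind2 : iSupIndep fun n : ℤ => W ⊓ (ad K L h).eigenspace (2 * (-(n : ℤ) : K)) := by
    have := (hind.mono (fun n => (inf_le_right : W ⊓ _ ≤ _))).comp (f := fun n : ℤ => -n) neg_injective
    simpa [Function.comp_def] using this
  have h3 : ⨆ n : ℤ, W ⊓ (ad K L h).eigenspace (2 * (-(n : ℤ) : K)) = W := by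
    refine Eq.trans ?_ (inf_eig htop hst)
    refine Equiv.iSup_congr (Equiv.neg ℤ) fun n => ?_
    simp
  conv_lhs => rw [← h3]
  rw [finrank_finsum _ hind2]
  refine finsum_congr fun c => ?_
  have hdim := s.dim_ker_eig_eq (2 * c)
  rw [Int.cast_mul, Int.cast_two, ← mul_neg] at hdim
  have hpow : ζ ^ (-c) = ζ ↔ (c : ZMod m) = -1 := by
    have h4 : ζ ^ (-c) = ζ ↔ ζ ^ (c + 1) = 1 := by
      rw [zpow_neg, zpow_add₀ hζ0, zpow_one]
      have := zpow_ne_zero c hζ0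
      constructor
      · intro h5
        nth_rw 2 [← h5]
        exact mul_inv_cancel₀ this
      · intro h5
        exact inv_eq_of_mul_eq_one_right h5
    rw [h4, hζ.zpow_eq_one_iff_dvd, ← ZMod.intCast_zmod_eq_zero_iff_dvd]
    push_cast
    rw [eq_neg_iff_add_eq_zero]
  split_ifs with hc
  · rw [hdim]
    suffices hE : W ⊓ (ad K L h).eigenspace (2 * -(c : K)) =
        LinearMap.ker (ad K L f) ⊓ (ad K L h).eigenspace (2 * -(c : K)) by rw [hE]
    apply le_antisymm
    · exact inf_le_inf_right _ inf_le_left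
    · rintro x ⟨hx1, hx2⟩
      refine ⟨⟨hx1, ?_⟩, hx2⟩
      refine End.mem_eigenspace_iff.2 ?_
      have := hact (-c) x (by push_cast; exact mem_eig.1 hx2)
      rwa [hpow.2 hc] at this
  · have : W ⊓ (ad K L h).eigenspace (2 * (-(c : ℤ) : K)) = ⊥ := by
      rw [eq_bot_iff]
      rintro x ⟨⟨hx0, hx1⟩, hx2⟩
      have h5 : θ x = ζ • x := End.mem_eigenspace_iff.1 hx1
      have h6 := hact (-c) x (by push_cast; exact mem_eig.1 hx2)
      by_contra hne
      have h7 : ζ ^ (-c) - ζ = 0 := by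
        have : (ζ ^ (-c) - ζ) • x = 0 := by rw [sub_smul, ← h5, ← h6, sub_self]
        exact (smul_eq_zero.1 this).resolve_right hne
      exact hc (hpow.1 (sub_eq_zero.1 h7))
    rw [this, finrank_bot]

end Slice
end NReg


namespace NReg

set_option linter.unusedSectionVars false

section PolyLemmas
open MvPolynomial

variable {K ι : Type*} [Field K] [CharZero K] [Fintype ι]

lemma coeff_pd (i : ι) (F : MvPolynomial ι K) (s : ι →₀ ℕ) :
    coeff s (pderiv i F) = coeff (s + Finsupp.single i 1) F * (s i + 1) := by
  classical
  induction F using MvPolynomial.induction_on' with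
  | monomial t a =>
    rw [pderiv_monomial, coeff_monomial, coeff_monomial]
    by_cases h : t = s + Finsupp.single i 1
    · subst h
      simp
    · rw [if_neg h, zero_mul]
      split_ifs with h2
      · by_cases h3 : t i = 0
        · simp [h3]
        · exfalso; apply h
          rw [← h2]
          ext j
          by_cases hj : j = i
          · subst hj; simp; omega
          · simp [Ne.symm hj]
      · rfl
  | add p q hp hq => rw [map_add, coeff_add, coeff_add, hp, hq, add_mul]

lemma dual_aeval (F : MvPolynomial ι K) (u l : ι → K) :
    TrivSqZeroExt.snd (aeval (fun i => (TrivSqZeroExt.inl (u i) + TrivSqZeroExt.inr (l i) : DualNumber K)) F)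
      = ∑ i, l i * eval u (pderiv i F) ∧
    TrivSqZeroExt.fst (aeval (fun i => (TrivSqZeroExt.inl (u i) + TrivSqZeroExt.inr (l i) : DualNumber K)) F)
      = eval u F := by
  classical
  induction F using MvPolynomial.induction_on with
  | C a => simp [TrivSqZeroExt.algebraMap_eq_inl]
  | add p q hp hq =>
    simp only [map_add, TrivSqZeroExt.snd_add, TrivSqZeroExt.fst_add, hp.1, hp.2, hq.1, hq.2, mul_add,
      Finset.sum_add_distrib]
    exact ⟨trivial, trivial⟩
  | mul_X p j hp =>
    rw [map_mul, aeval_X]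
    refine ⟨?_, ?_⟩
    · rw [TrivSqZeroExt.snd_mul, hp.1, hp.2]
      simp only [TrivSqZeroExt.snd_add, TrivSqZeroExt.fst_add, TrivSqZeroExt.snd_inl,
        TrivSqZeroExt.snd_inr, TrivSqZeroExt.fst_inl, TrivSqZeroExt.fst_inr, zero_add, add_zero,
        smul_eq_mul, MulOpposite.smul_eq_mul_unop, MulOpposite.unop_op, pderiv_mul, map_add, map_mul,
        eval_X, mul_add, Finset.sum_add_distrib, pderiv_X]
      rw [add_comm]
      congr 1
      · rw [Finset.sum_mul]; exact Finset.sum_congr rfl fun i _ => by ring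
      · rw [Finset.sum_eq_single j]
        · simp; ring
        · intro b _ hb; simp [hb.symm]
        · simp
    · rw [TrivSqZeroExt.fst_mul, hp.2]; simp

lemma chain_rule (F : MvPolynomial ι K) (a : ι → K) (g : ι → Polynomial K)
    (hg : ∀ i, Polynomial.derivative (g i) = Polynomial.C (a i)) :
    Polynomial.derivative (aeval g F)
     = ∑ i, Polynomial.C (a i) * aeval g (pderiv i F) := by
  classical
  induction F using MvPolynomial.induction_on with
  | C a => simp [Polynomial.algebraMap_eq]
  | add p q hp hq =>
    simp only [map_add, hp, hq, mul_add, Finset.sum_add_distrib]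
  | mul_X p j hp =>
    rw [map_mul, aeval_X, Polynomial.derivative_mul, hp, hg]
    simp only [pderiv_mul, map_add, map_mul, aeval_X, mul_add, Finset.sum_add_distrib, pderiv_X]
    congr 1
    · rw [Finset.sum_mul]; exact Finset.sum_congr rfl fun i _ => by ring
    · rw [Finset.sum_eq_single j]
      · simp; ring
      · intro b _ hb; simp [hb.symm]
      · simp

lemma transl {F : MvPolynomial ι K} {a : ι → K} (h : ∑ i, C (a i) * pderiv i F = 0) (u : ι → K) :
    eval (u + a) F = eval u F := by
  set q := aeval (fun i => Polynomial.C (u i) + Polynomial.C (a i) * Polynomial.X) F with hq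
  have h1 : Polynomial.derivative q = 0 := by
    rw [hq, chain_rule (a := a) _ _ (fun i => by simp)]
    have := congrArg (aeval (fun i => Polynomial.C (u i) + Polynomial.C (a i) * Polynomial.X)) h
    rw [map_sum, map_zero] at this
    rw [← this]
    refine Finset.sum_congr rfl fun i _ => ?_
    rw [map_mul, aeval_C]; rfl
  have h2 : q.natDegree = 0 := Polynomial.derivative_eq_zero.1 h1
  rw [Polynomial.natDegree_eq_zero] at h2
  obtain ⟨c, hc⟩ := h2
  have h3 : ∀ t : K, q.eval t = eval (u + t • a) F := by
    intro t
    have h4 : (Polynomial.aeval t).comp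
        (aeval (fun i => Polynomial.C (u i) + Polynomial.C (a i) * Polynomial.X)) =
          aeval (u + t • a) := by
      ext i
      simp only [AlgHom.comp_apply, aeval_X, map_add, map_mul, Polynomial.aeval_C, Polynomial.aeval_X,
        Algebra.algebraMap_self, RingHom.id_apply, Pi.add_apply, Pi.smul_apply, smul_eq_mul]
      ring
    exact DFunLike.congr_fun h4 F
  have h4 := h3 0
  have h5 := h3 1
  rw [← hc] at h4 h5
  simp at h4 h5
  rw [← h4, h5]

lemma hom_coeff (F : MvPolynomial ι K) (u : ι → K) (d : ℕ) :
    (aeval (fun i => Polynomial.C (u i) * Polynomial.X) F : Polynomial K).coeff d =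
      eval u (homogeneousComponent d F) := by
  classical
  induction F using MvPolynomial.induction_on' with
  | monomial t a =>
    rw [homogeneousComponent_of_mem (isHomogeneous_monomial (n := t.degree) a rfl), aeval_monomial]
    have h1 : (t.prod fun i k => (Polynomial.C (u i) * Polynomial.X) ^ k) =
        Polynomial.C (t.prod fun i k => u i ^ k) * Polynomial.X ^ t.degree := by
      simp only [Finsupp.prod, mul_pow, Finset.prod_mul_distrib, Finsupp.degree, map_prod, map_pow]
      rw [Finset.prod_pow_eq_pow_sum]
      rfl
    rw [h1, Polynomial.algebraMap_eq, ← mul_assoc, ← Polynomial.C_mul, Polynomial.coeff_C_mul_X_pow]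
    split_ifs
    · rw [eval_monomial]
    · simp
  | add p q hp hq => rw [map_add, Polynomial.coeff_add, hp, hq, map_add, map_add]

/-- the algebraic core of the density lemma -/
lemma density_core {F : MvPolynomial ι K} 
    (hd : ∀ u : ι → K, ∃ a u', u = a + u' ∧ (∀ t : K, eval (t • u') F = 0) ∧
      ∃ l : ι → ι → K, ∑ i, (C (a i) + ∑ j, C (l i j) * X j) * pderiv i F = 0) : F = 0 := by
  classical
  by_contra hF
  have hex : ∃ d, ∃ s : ι →₀ ℕ, s.degree = d ∧ coeff s F ≠ 0 := by
    obtain ⟨s, hs⟩ := MvPolynomial.ne_zero_iff.1 hF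
    exact ⟨_, s, rfl, hs⟩
  set d := Nat.find hex with hdd
  obtain ⟨s0, hs0, hs0'⟩ := Nat.find_spec hex
  have hmin : ∀ s : ι →₀ ℕ, s.degree < d → coeff s F = 0 := by
    intro s hs
    by_contra h
    exact Nat.find_min hex hs ⟨s, rfl, h⟩
  set G := homogeneousComponent d F with hG
  have hG0 : G ≠ 0 := by
    intro h
    have := congrArg (coeff s0) h
    rw [hG, coeff_homogeneousComponent, if_pos hs0, coeff_zero] at this
    exact hs0' this
  apply hG0
  refine MvPolynomial.funext fun u => ?_
  rw [map_zero]
  obtain ⟨a, u', rfl, hu', l, hl⟩ := hd u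
  have h1 : ∑ i, C (a i) * pderiv i G = 0 := by
    ext s
    have h2 := congrArg (coeff s) hl
    rw [coeff_sum, coeff_zero] at h2 ⊢
    by_cases hs : s.degree + 1 = d
    · rw [← h2]
      refine Finset.sum_congr rfl fun i _ => ?_
      rw [add_mul, coeff_add, coeff_C_mul, coeff_C_mul, coeff_pd, coeff_pd, hG,
        coeff_homogeneousComponent, if_pos (by simpa [Finsupp.degree_single] using hs), Finset.sum_mul, coeff_sum]
      rw [left_eq_add]
      refine Finset.sum_eq_zero fun j _ => ?_
      rw [mul_assoc, coeff_C_mul, coeff_X_mul']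
      split_ifs with hj
      · rw [coeff_pd, hmin, zero_mul, mul_zero]
        have : s = (s - Finsupp.single j 1) + Finsupp.single j 1 := by
          ext r
          by_cases hr : r = j
          · subst hr
            have : s r ≠ 0 := by simpa using hj
            simp; omega
          · simp [Ne.symm hr]
        have h4 : s.degree = (s - Finsupp.single j 1).degree + 1 := by
          conv_lhs => rw [this]
          simp
        simp only [map_add, Finsupp.degree_single]
        omega
      · rw [mul_zero]
    · refine Finset.sum_eq_zero fun i _ => ?_
      rw [coeff_C_mul, coeff_pd, hG, coeff_homogeneousComponent, if_neg, zero_mul, mul_zero]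
      simpa [Finsupp.degree_single] using hs
  rw [add_comm, transl h1]
  -- one variable polynomial
  set q : Polynomial K := aeval (fun i => Polynomial.C (u' i) * Polynomial.X) F with hq
  have hq0 : q = 0 := by
    refine Polynomial.funext fun t => ?_
    rw [Polynomial.eval_zero, ← hu' t]
    have h4 : (Polynomial.aeval t).comp
        (aeval (fun i => Polynomial.C (u' i) * Polynomial.X)) = aeval (t • u') := by
      ext i
      simp only [AlgHom.comp_apply, aeval_X, map_add, map_mul, Polynomial.aeval_C, Polynomial.aeval_X,
        Algebra.algebraMap_self, RingHom.id_apply, Pi.add_apply, Pi.smul_apply, smul_eq_mul]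
      ring
    exact DFunLike.congr_fun h4 F
  have hq2 : q.coeff d = eval u' G := hom_coeff F u' d
  rw [← hq2, hq0, Polynomial.coeff_zero]

end PolyLemmas
end NReg


namespace NReg

set_option linter.unusedSectionVars false

section Gen
open MvPolynomial LieAlgebra Module

variable {K L ι : Type*} [Field K] [CharZero K] [Fintype ι] [LieRing L] [LieAlgebra K L]
  [FiniteDimensional K L]

/-- matrix of `ad x` -/
noncomputable def adM (K : Type*) {L : Type*} [Field K] [LieRing L] [LieAlgebra K L]
    [FiniteDimensional K L] (x : L) : Matrix (Fin (finrank K L)) (Fin (finrank K L)) K :=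
  LinearMap.toMatrix (finBasis K L) (finBasis K L) (ad K L x)

lemma adM_add (x y : L) : adM K (x + y) = adM K x + adM K y := by simp [adM]
lemma adM_smul (a : K) (x : L) : adM K (a • x) = a • adM K x := by simp [adM]
lemma adM_sum (u : ι → K) (b : ι → L) : adM K (∑ i, u i • b i) = ∑ i, u i • adM K (b i) := by
  simp [adM]
lemma adM_lie (x y : L) : adM K ⁅x, y⁆ = adM K x * adM K y - adM K y * adM K x := by
  unfold adM
  rw [← LinearMap.toMatrix_mul, ← LinearMap.toMatrix_mul, ← map_sub]
  congr 1
  ext z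
  simp only [LinearMap.sub_apply, Module.End.mul_apply, ad_apply, lie_lie]
lemma adM_charpoly (x : L) : (adM K x).charpoly = (ad K L x).charpoly :=
  LinearMap.charpoly_toMatrix _ _

/-- generic matrix over the affine space `p + span b` -/
noncomputable def gen (K : Type*) {L ι : Type*} [Field K] [Fintype ι] [LieRing L] [LieAlgebra K L]
    [FiniteDimensional K L] (p : L) (b : ι → L) :
    Matrix (Fin (finrank K L)) (Fin (finrank K L)) (MvPolynomial ι K) :=
  (adM K p).map C + ∑ i, (X i : MvPolynomial ι K) • (adM K (b i)).map C

/-- pullback of polynomials in coefficients of the characteristic polynomial -/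
noncomputable def phi (K : Type*) {L ι : Type*} [Field K] [Fintype ι] [LieRing L] [LieAlgebra K L]
    [FiniteDimensional K L] (p : L) (b : ι → L) : MvPolynomial ℕ K →ₐ[K] MvPolynomial ι K :=
  aeval (fun j => (gen K p b).charpoly.coeff j)

/-- value of a polynomial in coefficients of the characteristic polynomial -/
noncomputable def Qf {K L : Type*} [Field K] [LieRing L] [LieAlgebra K L]
    [FiniteDimensional K L] (G : MvPolynomial ℕ K) (x : L) : K :=
  eval (fun j => (ad K L x).charpoly.coeff j) G

lemma map_phi {R : Type*} [CommRing R] [Algebra K R] (ψ : MvPolynomial ι K →ₐ[K] R) (p : L) (b : ι → L)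
    (G : MvPolynomial ℕ K) :
    ψ (phi K p b G) = aeval (fun j => ((gen K p b).map ψ).charpoly.coeff j) G := by
  unfold phi
  rw [← AlgHom.comp_apply, comp_aeval]
  congr 2
  ext j
  have := Matrix.charpoly_map (gen K p b) ψ.toRingHom
  change ψ.toRingHom _ = (((gen K p b).map ψ.toRingHom).charpoly).coeff j
  rw [this, Polynomial.coeff_map]

lemma gen_map {R : Type*} [CommRing R] [Algebra K R] (r : ι → R) (p : L) (b : ι → L) :
    (gen K p b).map (aeval r) = (adM K p).map (algebraMap K R) +
      ∑ i, r i • (adM K (b i)).map (algebraMap K R) := by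
  ext s t
  simp [gen, Matrix.sum_apply]

lemma eval_phi (p : L) (b : ι → L) (G : MvPolynomial ℕ K) (u : ι → K) :
    eval u (phi K p b G) = Qf G (p + ∑ i, u i • b i) := by
  have h := map_phi (aeval u) p b G
  rw [gen_map] at h
  have h2 : (adM K p).map (algebraMap K K) + ∑ i, u i • (adM K (b i)).map (algebraMap K K) =
      adM K (p + ∑ i, u i • b i) := by
    rw [adM_add, adM_sum]; rfl
  rw [h2, adM_charpoly] at h
  exact h

lemma phi_eq_zero_iff [Infinite K] (p : L) (b : ι → L) (G : MvPolynomial ℕ K) :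
    phi K p b G = 0 ↔ ∀ v ∈ Submodule.span K (Set.range b), Qf G (p + v) = 0 := by
  constructor
  · intro h v hv
    obtain ⟨u, rfl⟩ := (Submodule.mem_span_range_iff_exists_fun K).1 hv
    rw [← eval_phi, h, map_zero]
  · intro h
    refine MvPolynomial.funext fun u => ?_
    rw [eval_phi, map_zero]
    exact h _ ((Submodule.mem_span_range_iff_exists_fun K).2 ⟨u, rfl⟩)

lemma charpoly_dual {n : Type*} [Fintype n] [DecidableEq n] (A Y : Matrix n n K) :
    (A.map (algebraMap K (DualNumber K)) +
      (DualNumber.eps : DualNumber K) • (Y * A - A * Y).map (algebraMap K (DualNumber K))).charpoly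
      = (A.map (algebraMap K (DualNumber K))).charpoly := by
  set A' := A.map (algebraMap K (DualNumber K)) with hA
  set Y' := Y.map (algebraMap K (DualNumber K)) with hY
  have h1 : (Y * A - A * Y).map (algebraMap K (DualNumber K)) = Y' * A' - A' * Y' := by
    rw [hA, hY, Matrix.map_sub _ (map_sub _), Matrix.map_mul, Matrix.map_mul]
  have hee : (DualNumber.eps : DualNumber K) * DualNumber.eps = 0 := DualNumber.eps_mul_eps
  set ε := (DualNumber.eps : DualNumber K)
  have hM : (1 + ε • Y') * (1 - ε • Y') = 1 := by
    rw [add_mul, mul_sub, mul_sub]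
    simp [smul_smul, hee]
  have hM' : (1 - ε • Y') * (1 + ε • Y') = 1 := by
    rw [sub_mul, mul_add, mul_add]
    simp [smul_smul, hee]
  let M : (Matrix n n (DualNumber K))ˣ := ⟨1 + ε • Y', 1 - ε • Y', hM, hM'⟩
  rw [← Matrix.charpoly_units_conj M A', h1, ← Matrix.coe_units_inv]
  congr 1
  change _ = (1 + ε • Y') * A' * (1 - ε • Y')
  rw [mul_sub, mul_one, add_mul, one_mul]
  simp only [Matrix.smul_mul, Matrix.mul_smul, add_mul, smul_smul, hee, zero_smul, smul_sub]
  abel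

lemma inf_inv [Infinite K] (p : L) (b : ι → L) (G : MvPolynomial ℕ K) (y : L) (a : ι → K) (l : ι → ι → K)
    (ha : ⁅y, p⁆ = ∑ i, a i • b i) (hl : ∀ j, ⁅y, b j⁆ = ∑ i, l i j • b i) :
    ∑ i, (C (a i) + ∑ j, C (l i j) * X j) * pderiv i (phi K p b G) = 0 := by
  refine MvPolynomial.funext fun u => ?_
  simp only [map_sum, map_mul, map_add, eval_C, eval_X, map_zero]
  have h := (dual_aeval (phi K p b G) u (fun i => a i + ∑ j, l i j * u j)).1
  rw [← h, map_phi, gen_map]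
  set x := p + ∑ i, u i • b i with hx
  have hyx : ⁅y, x⁆ = ∑ i, (a i + ∑ j, l i j * u j) • b i := by
    rw [hx, lie_add, ha, lie_sum]
    simp only [lie_smul, hl, add_smul, Finset.sum_add_distrib, Finset.sum_smul, Finset.smul_sum, smul_smul]
    congr 1
    rw [Finset.sum_comm]
    exact Finset.sum_congr rfl fun i _ => Finset.sum_congr rfl fun j _ => by rw [mul_comm]
  have h2 : (adM K p).map (algebraMap K (DualNumber K)) +
      ∑ i, (TrivSqZeroExt.inl (u i) + TrivSqZeroExt.inr (a i + ∑ j, l i j * u j) : DualNumber K) •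
        (adM K (b i)).map (algebraMap K (DualNumber K)) =
      (adM K x).map (algebraMap K (DualNumber K)) + (DualNumber.eps : DualNumber K) •
        (adM K y * adM K x - adM K x * adM K y).map (algebraMap K (DualNumber K)) := by
    rw [← adM_lie, hyx, adM_sum, hx, adM_add, adM_sum]
    ext s t
    all_goals simp [Matrix.sum_apply, TrivSqZeroExt.algebraMap_eq_inl]
    · erw [TrivSqZeroExt.fst_sum]
      refine Finset.sum_congr rfl fun i _ => ?_
      simp
    · erw [TrivSqZeroExt.snd_sum]
      refine Finset.sum_congr rfl fun i _ => ?_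
      simp [mul_comm]
  rw [h2, charpoly_dual]
  have h3 : (fun j => ((adM K x).map (algebraMap K (DualNumber K))).charpoly.coeff j) =
    fun j => algebraMap K (DualNumber K) ((adM K x).charpoly.coeff j) := by
    ext1 j
    rw [Matrix.charpoly_map, Polynomial.coeff_map]
  rw [h3]
  have h4 : aeval (fun j => algebraMap K (DualNumber K) ((adM K x).charpoly.coeff j)) G =
     algebraMap K (DualNumber K) (aeval (fun j => (adM K x).charpoly.coeff j) G) := by
    exact aeval_algebraMap_apply _ _ _
  rw [h4, TrivSqZeroExt.algebraMap_eq_inl]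
  simp

/-- Density lemma. -/
lemma density [Infinite K] (p : L) (P U : Submodule K L) (Y : Set L)
    (hY : ∀ y ∈ Y, ∀ x ∈ P, ⁅y, x⁆ ∈ P) (hp : p ∈ P) 
    (hPU : ∀ v ∈ P, ∃ y ∈ Y, ∃ u ∈ U, v = ⁅y, p⁆ + u) (G : MvPolynomial ℕ K)
    (hU : ∀ u ∈ U, Qf G (p + u) = 0) : ∀ x ∈ P, Qf G x = 0 := by
  set b : Fin (finrank K P) → L := fun i => (finBasis K P i : L) with hb
  have hspan : Submodule.span K (Set.range b) = P := by
    have h1 := (finBasis K P).span_eq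
    have h2 := congrArg (Submodule.map P.subtype) h1
    rw [Submodule.map_span, ← Set.range_comp, Submodule.map_top, Submodule.range_subtype] at h2
    exact h2
  have hco : ∀ x ∈ P, ∃ u : Fin (finrank K P) → K, x = ∑ i, u i • b i := by
    intro x hx
    rw [← hspan] at hx
    obtain ⟨u, hu⟩ := (Submodule.mem_span_range_iff_exists_fun K).1 hx
    exact ⟨u, hu.symm⟩
  have hbP : ∀ i, b i ∈ P := fun i => (finBasis K P i).2
  have h0 : phi K p b G = 0 := by
    refine density_core fun u => ?_
    obtain ⟨y, hy, w, hw, hyw⟩ := hPU (∑ i, u i • b i) (Submodule.sum_mem _ fun i _ => P.smul_mem _ (hbP i))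
    obtain ⟨a, ha⟩ := hco _ (hY y hy p hp)
    choose l hl using fun j => hco _ (hY y hy (b j) (hbP j))
    refine ⟨a, u - a, by abel, ?_, fun i j => l j i, inf_inv p b G y a _ ha hl⟩
    intro t
    rw [eval_phi]
    have : ∑ i, (t • (u - a)) i • b i = t • w := by
      have h5 : w = ∑ i, u i • b i - ∑ i, a i • b i := by rw [hyw, ha]; abel
      rw [h5, ← Finset.sum_sub_distrib, Finset.smul_sum]
      refine Finset.sum_congr rfl fun i _ => ?_
      simp [mul_smul, sub_smul]
    rw [this]
    exact hU _ (U.smul_mem _ hw)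
  intro x hx
  have := (phi_eq_zero_iff p b G).1 h0 (x - p) (by rw [hspan]; exact P.sub_mem hx hp)
  simpa using this

end Gen
end NReg


namespace NReg

set_option linter.unusedSectionVars false

section Jordan
open LieAlgebra Module LieSubalgebra

variable {K L : Type*} [Field K] [IsAlgClosed K] [CharZero K] [LieRing L] [LieAlgebra K L]
  [FiniteDimensional K L]

lemma charpoly_eq_ss {V : Type*} [AddCommGroup V] [Module K V] [FiniteDimensional K V]
    (A S : Module.End K V) (hc : Commute A S) (hS : S.IsSemisimple) (hN : IsNilpotent (A - S)) :
    A.charpoly = S.charpoly := by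
  have h1 : ∀ μ, A.charpoly.rootMultiplicity μ ≤ S.charpoly.rootMultiplicity μ := by
    intro μ
    rw [← LinearMap.finrank_maxGenEigenspace_eq]
    refine le_trans ?_ (LinearMap.finrank_eigenspace_le S μ)
    apply Submodule.finrank_mono
    intro v hv
    rw [Module.End.mem_eigenspace_iff]
    rw [Module.End.maxGenEigenspace_eq] at hv
    exact Module.End.apply_eq_of_mem_of_comm_of_isFinitelySemisimple_of_isNil hv hc
      hS.isFinitelySemisimple hN
  have sA := IsAlgClosed.splits A.charpoly
  have sS := IsAlgClosed.splits S.charpoly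
  have h2 : A.charpoly.roots = S.charpoly.roots := by
    classical
    refine Multiset.eq_of_le_of_card_le (Multiset.le_iff_count.2 fun μ => ?_) ?_
    · simpa using h1 μ
    · rw [← sA.natDegree_eq_card_roots, ← sS.natDegree_eq_card_roots, LinearMap.charpoly_natDegree,
        LinearMap.charpoly_natDegree]
  rw [sA.eq_prod_roots_of_monic (LinearMap.charpoly_monic _), h2,
     ← sS.eq_prod_roots_of_monic (LinearMap.charpoly_monic _)]

variable [LieAlgebra.IsKilling K L]

lemma jordan (y : L) : ∃ s : L, (ad K L s).IsSemisimple ∧ IsNilpotent (ad K L y - ad K L s) ∧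
    (∀ z : L, ⁅y, z⁆ = 0 → ⁅s, z⁆ = 0) := by
  obtain ⟨N, -, S, hSa, hN, hS, hSN⟩ := (ad K L y).exists_isNilpotent_isSemisimple
  have hS₀ : Commute (ad K L y) S := Algebra.commute_of_mem_adjoin_self hSa
  rw [eq_sub_of_add_eq hSN.symm] at hN
  have aux {α : K} {z : L} (hz : z ∈ (ad K L y).maxGenEigenspace α) : S z = α • z := by
    rw [Module.End.maxGenEigenspace_eq] at hz
    exact Module.End.apply_eq_of_mem_of_comm_of_isFinitelySemisimple_of_isNil hz hS₀
      hS.isFinitelySemisimple hN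
  have h_der (u z : L) : S ⁅u, z⁆ = ⁅S u, z⁆ + ⁅u, S z⁆ := by
    have hu : u ∈ ⨆ α, (ad K L y).maxGenEigenspace α := by
      rw [Module.End.iSup_maxGenEigenspace_eq_top]; trivial
    have hz : z ∈ ⨆ α, (ad K L y).maxGenEigenspace α := by
      rw [Module.End.iSup_maxGenEigenspace_eq_top]; trivial
    induction hu using Submodule.iSup_induction' with
    | mem α u hu =>
      induction hz using Submodule.iSup_induction' with
      | mem β z hz =>
        have : ⁅u, z⁆ ∈ (ad K L y).maxGenEigenspace (α + β) :=
          LieModule.lie_mem_maxGenEigenspace_toEnd hu hz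
        rw [aux hu, aux hz, aux this, smul_lie, lie_smul, ← add_smul]
      | zero => simp
      | add _ _ _ _ h h' => simp only [lie_add, map_add, h, h']; abel
    | zero => simp
    | add _ _ _ _ h h' => simp only [add_lie, map_add, h, h']; abel
  replace h_der : ∀ y z : L, S ⁅y, z⁆ = ⁅y, S z⁆ - ⁅z, S y⁆ := by
    simp_rw [← lie_skew (S _) _, add_comm, ← sub_eq_add_neg] at h_der; assumption
  let S' : LieDerivation K L L := ⟨S, h_der⟩
  obtain ⟨s, hs⟩ := LieDerivation.IsKilling.exists_eq_ad S'
  have hs' : ad K L s = S := by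
    rw [← LieDerivation.coe_ad_apply_eq_ad_apply s, hs]
  refine ⟨s, hs' ▸ hS, hs' ▸ hN, fun z hz => ?_⟩
  have : S z = (0 : K) • z := aux (Module.End.genEigenspace_le_maximal _ 0 1
    (Module.End.mem_eigenspace_iff.2 (by simpa using hz)))
  rw [← hs'] at this
  simpa using this

lemma comm_ad {a b : L} (h : ⁅a, b⁆ = 0) : Commute (ad K L a) (ad K L b) := by
  ext z
  simp only [Module.End.mul_apply, ad_apply]
  rw [leibniz_lie a b z, h, zero_lie, zero_add]

lemma ad_inj {a : L} (h : ad K L a = 0) : a = 0 := by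
  have : a ∈ LieAlgebra.center K L := by
    rw [LieModule.mem_maxTrivSubmodule]
    intro z
    have := LinearMap.congr_fun h z
    rw [← lie_skew, neg_eq_zero]
    exact this
  rw [LieAlgebra.center_eq_bot] at this
  simpa using this

variable {θ : L ≃ₗ[K] L}

/-- Averaging. -/
lemma avg {m : ℕ} (hm : 1 ≤ m) {ζ : K} (hζ : ζ ^ m = 1) (hθb : ∀ x y : L, θ ⁅x, y⁆ = ⁅θ x, θ y⁆)
    (hθm : θ ^ m = 1) {p : L} (hp : θ p = ζ • p) (Z : Submodule K L) (hZ : ∀ z ∈ Z, θ z ∈ Z)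
    {v : L} (hv : θ v = ζ • v) (hvr : v ∈ LinearMap.range (ad K L p) ⊔ Z) :
    ∃ y, θ y = y ∧ ∃ u ∈ Z ⊓ Module.End.eigenspace (θ : L →ₗ[K] L) ζ, v = ⁅y, p⁆ + u := by
  have hζ0 : ζ ≠ 0 := by rintro rfl; rw [zero_pow (by omega)] at hζ; exact zero_ne_one hζ
  obtain ⟨w, ⟨a, rfl⟩, b, hb, rfl⟩ := Submodule.mem_sup.1 hvr
  simp only [ad_apply] at hv ⊢
  have hm0 : (m : K) ≠ 0 := by exact_mod_cast (by omega : m ≠ 0)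
  have hpw : ∀ {x : L} (j : ℕ), θ x = ζ • x → (θ ^ j) x = ζ ^ j • x := by
    intro x j hx
    induction j with
    | zero => simp
    | succ j ih => rw [pow_succ', LinearEquiv.mul_apply, ih, map_smul, hx, smul_smul, pow_succ]
  have hbr : ∀ (j : ℕ) (x y : L), (θ ^ j) ⁅x, y⁆ = ⁅(θ ^ j) x, (θ ^ j) y⁆ := by
    intro j
    induction j with
    | zero => simp
    | succ j ih => intro x y; simp [pow_succ', LinearEquiv.mul_apply, ih, hθb]
  have hZj : ∀ (j : ℕ), ∀ z ∈ Z, (θ ^ j) z ∈ Z := by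
    intro j
    induction j with
    | zero => simp
    | succ j ih => intro x hx; rw [pow_succ', LinearEquiv.mul_apply]; exact hZ _ (ih _ hx)
  have hsum : ∀ (ξ : K), ξ ≠ 0 → ξ ^ m = 1 → ∀ x : L, θ (∑ j ∈ Finset.range m, (ξ⁻¹) ^ j • (θ ^ j) x) =
      ξ • ∑ j ∈ Finset.range m, (ξ⁻¹) ^ j • (θ ^ j) x := by
    intro ξ hξ0 hξ x
    rw [map_sum, Finset.smul_sum]
    have h1 := Finset.sum_range_succ' (fun j => ξ • (ξ⁻¹) ^ j • (θ ^ j) x) m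
    rw [Finset.sum_range_succ] at h1
    have h2 : ξ • (ξ⁻¹) ^ m • (θ ^ m) x = ξ • (ξ⁻¹) ^ 0 • (θ ^ 0) x := by
      rw [hθm, inv_pow, hξ]; simp
    rw [h2, add_left_inj] at h1
    rw [h1]
    refine Finset.sum_congr rfl fun j _ => ?_
    rw [map_smul, smul_smul, pow_succ', pow_succ', LinearEquiv.mul_apply, ← mul_assoc,
      mul_inv_cancel₀ hξ0, one_mul]
  refine ⟨-((m : K)⁻¹ • ∑ j ∈ Finset.range m, (θ ^ j) a), ?_,
    (m : K)⁻¹ • ∑ j ∈ Finset.range m, (ζ⁻¹) ^ j • (θ ^ j) b, ⟨?_, ?_⟩, ?_⟩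
  · rw [map_neg, map_smul]
    have := hsum 1 one_ne_zero (one_pow _) a
    simp only [inv_one, one_pow, one_smul] at this
    rw [this]
  · exact Z.smul_mem _ (Z.sum_mem fun j _ => Z.smul_mem _ (hZj j b hb))
  · rw [SetLike.mem_coe, Module.End.mem_eigenspace_iff]
    change θ _ = _
    rw [map_smul, hsum ζ hζ0 hζ b, smul_comm]
  · rw [neg_lie, lie_skew, lie_smul, ← smul_add, lie_sum, ← Finset.sum_add_distrib]
    have : ∀ j ∈ Finset.range m, ⁅p, (θ ^ j) a⁆ + ζ⁻¹ ^ j • (θ ^ j) b = ⁅p, a⁆ + b := by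
      intro j _
      have h1 := hpw j hv
      rw [map_add, hbr, hpw j hp, smul_lie] at h1
      have h2 := congrArg (fun x => ζ⁻¹ ^ j • x) h1
      have h3 : ζ⁻¹ ^ j * ζ ^ j = 1 := by rw [← mul_pow, inv_mul_cancel₀ hζ0, one_pow]
      simpa only [smul_add, smul_smul, h3, one_smul] using h2
    rw [Finset.sum_congr rfl this, Finset.sum_const, Finset.card_range, ← Nat.cast_smul_eq_nsmul K,
      smul_smul, inv_mul_cancel₀ hm0, one_smul]

lemma fixed_act (hθb : ∀ x y : L, θ ⁅x, y⁆ = ⁅θ x, θ y⁆) {ζ : K} : ∀ y ∈ {y : L | θ y = y},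
    ∀ x ∈ Module.End.eigenspace (θ : L →ₗ[K] L) ζ, ⁅y, x⁆ ∈ Module.End.eigenspace (θ : L →ₗ[K] L) ζ := by
  intro y hy x hx
  rw [Module.End.mem_eigenspace_iff] at hx ⊢
  change θ _ = _ at hx
  change θ _ = _
  rw [hθb, hx, lie_smul]
  congr 2

lemma dens_slice {m : ℕ} (hm : 1 ≤ m) {ζ : K} (hζ : ζ ^ m = 1)
    (hθb : ∀ x y : L, θ ⁅x, y⁆ = ⁅θ x, θ y⁆)
    (hθm : θ ^ m = 1) {e h f : L} (s : Sl2 (ad K L e) (ad K L f) (ad K L h))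
    (hθe : θ e = ζ • e) (hθf : θ f = ζ⁻¹ • f) (G : MvPolynomial ℕ K)
    (hU : ∀ u ∈ LinearMap.ker (ad K L f) ⊓ Module.End.eigenspace (θ : L →ₗ[K] L) ζ,
      Qf G (e + u) = 0) :
    ∀ x ∈ Module.End.eigenspace (θ : L →ₗ[K] L) ζ, Qf G x = 0 := by
  have hζ0 : ζ ≠ 0 := by rintro rfl; rw [zero_pow (by omega)] at hζ; exact zero_ne_one hζ
  refine density e _ _ {y : L | θ y = y} (fixed_act hθb)
    (by rw [Module.End.mem_eigenspace_iff]; exact hθe) ?_ G hU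
  intro v hv
  rw [Module.End.mem_eigenspace_iff] at hv
  refine avg hm hζ hθb hθm hθe _ ?_ hv (by rw [s.range_sup_ker]; trivial)
  intro z hz
  simp only [LinearMap.mem_ker, ad_apply] at hz ⊢
  have := hθb f z
  rw [hz, map_zero, hθf, smul_lie] at this
  exact (smul_eq_zero.1 this.symm).resolve_left (inv_ne_zero hζ0)


lemma generic_t {V : Type*} [AddCommGroup V] [Module K V] [FiniteDimensional K V]
    (A B : Module.End K V) (hc : Commute A B) (hA : A.IsSemisimple) :
    ∃ t : K, LinearMap.ker (A + t • B) ≤ LinearMap.ker A ⊓ LinearMap.ker B := by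
  classical
  have hfA : {a : K | A.HasEigenvalue a}.Finite := Module.End.finite_hasEigenvalue A
  have hfB : {a : K | B.HasEigenvalue a}.Finite := Module.End.finite_hasEigenvalue B
  obtain ⟨t, ht⟩ := Set.Infinite.exists_notMem_finset (Set.infinite_univ (α := K))
    (insert 0 (hfA.toFinset.biUnion fun a => hfB.toFinset.image fun b => - (a / b)))
  replace ht := ht.2
  simp only [Finset.mem_insert, Finset.mem_biUnion, Finset.mem_image, Set.Finite.mem_toFinset,
    Set.mem_ofPred_eq, not_or, not_exists, not_and] at ht
  obtain ⟨ht0, ht⟩ := ht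
  refine ⟨t, ?_⟩
  have htop : ⨆ μ, A.genEigenspace μ 1 = ⊤ := hA.iSup_eigenspace_eq_top
  have h1 := Submodule.inf_iSup_genEigenspace (f := A) (p := LinearMap.ker (A + t • B)) (fun x hx => by
    rw [LinearMap.mem_ker] at hx ⊢
    have hcc : Commute (A + t • B) A := (Commute.refl A).add_left (hc.symm.smul_left t)
    have := LinearMap.congr_fun hcc.eq x
    simpa [hx] using this) 1
  rw [htop, inf_top_eq] at h1
  rw [h1]
  refine iSup_le fun a v hv => ?_
  obtain ⟨hv1, hv2⟩ := hv
  have hv2 : A v = a • v := Module.End.mem_eigenspace_iff.1 hv2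
  have hv1 : A v + t • B v = 0 := by simpa using hv1
  have hB : B v = (-(a / t)) • v := by
    rw [hv2] at hv1
    have : t • B v = (-a) • v := by rw [neg_smul]; exact eq_neg_of_add_eq_zero_right hv1
    have h2 := congrArg (fun x => t⁻¹ • x) this
    simp only [smul_smul, inv_mul_cancel₀ ht0, one_smul] at h2
    rw [h2]; congr 1; field_simp
  by_cases hv0 : v = 0
  · rw [hv0]; exact Submodule.zero_mem _
  have ea : A.HasEigenvalue a := Module.End.hasEigenvalue_of_hasEigenvector
    ⟨Module.End.mem_eigenspace_iff.2 hv2, hv0⟩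
  have eb : B.HasEigenvalue (-(a / t)) := Module.End.hasEigenvalue_of_hasEigenvector
    ⟨Module.End.mem_eigenspace_iff.2 hB, hv0⟩
  by_cases ha : a = 0
  · subst ha
    refine ⟨?_, ?_⟩
    · simpa using hv2
    · simpa using hB
  · exact absurd (by field_simp) (ht a ea _ eb)

lemma exists_generic (c : Submodule K L) (hab : ∀ x ∈ c, ∀ y ∈ c, ⁅x, y⁆ = 0)
    (hss : ∀ x ∈ c, (ad K L x).IsSemisimple) :
    ∃ x ∈ c, ∀ y ∈ c, ∀ z : L, ⁅x, z⁆ = 0 → ⁅y, z⁆ = 0 := by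
  let S : Set ℕ := {n | ∃ x ∈ c, finrank K (LinearMap.ker (ad K L x)) = n}
  have hS : S.Nonempty := ⟨_, 0, c.zero_mem, rfl⟩
  obtain ⟨x, hx, hxn⟩ := Nat.sInf_mem hS
  refine ⟨x, hx, fun y hy z hz => ?_⟩
  have hcomm : Commute (ad K L x) (ad K L y) := by
    exact comm_ad (hab x hx y hy)
  obtain ⟨t, ht⟩ := generic_t (ad K L x) (ad K L y) hcomm (hss x hx)
  have hmin : sInf S ≤ finrank K (LinearMap.ker (ad K L (x + t • y))) :=
    Nat.sInf_le ⟨_, c.add_mem hx (c.smul_mem t hy), rfl⟩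
  rw [map_add, map_smul, ← hxn] at hmin
  have h1 := Submodule.eq_of_le_of_finrank_le (ht.trans inf_le_left) hmin
  have h2 : z ∈ LinearMap.ker (ad K L x) := by simpa using hz
  rw [← h1] at h2
  simpa using (ht h2).2

lemma ss_sup {V : Type*} [AddCommGroup V] [Module K V] [FiniteDimensional K V]
    (A : Module.End K V) (hA : A.IsSemisimple) : LinearMap.range A ⊔ LinearMap.ker A = ⊤ := by
  have htop : ⨆ μ, A.eigenspace μ = ⊤ := hA.iSup_eigenspace_eq_top
  rw [eq_top_iff, ← htop]
  refine iSup_le fun a v hv => ?_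
  rw [Module.End.mem_eigenspace_iff] at hv
  by_cases ha : a = 0
  · exact Submodule.mem_sup_right (by simpa [ha] using hv)
  · refine Submodule.mem_sup_left ⟨a⁻¹ • v, ?_⟩
    rw [map_smul, hv, smul_smul, inv_mul_cancel₀ ha, one_smul]

lemma dens_cartan {m : ℕ} (hm : 1 ≤ m) {ζ : K} (hζ : ζ ^ m = 1)
    (hθb : ∀ x y : L, θ ⁅x, y⁆ = ⁅θ x, θ y⁆)
    (hθm : θ ^ m = 1) (c : Submodule K L)
    (hc1 : c ≤ Module.End.eigenspace (θ : L →ₗ[K] L) ζ)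
    (hab : ∀ x ∈ c, ∀ y ∈ c, ⁅x, y⁆ = 0)
    (hss : ∀ x ∈ c, (ad K L x).IsSemisimple)
    (hmax : ∀ c' : Submodule K L, c' ≤ Module.End.eigenspace (θ : L →ₗ[K] L) ζ →
      (∀ x ∈ c', ∀ y ∈ c', ⁅x, y⁆ = 0) → (∀ x ∈ c', (ad K L x).IsSemisimple) → c ≤ c' → c = c')
    (G : MvPolynomial ℕ K)
    (hU : ∀ u ∈ c, Qf G u = 0) :
    ∀ x ∈ Module.End.eigenspace (θ : L →ₗ[K] L) ζ, Qf G x = 0 := by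
  have hζ0 : ζ ≠ 0 := by rintro rfl; rw [zero_pow (by omega)] at hζ; exact zero_ne_one hζ
  obtain ⟨x, hx, hgen⟩ := exists_generic c hab hss
  have hθx : θ x = ζ • x := Module.End.mem_eigenspace_iff.1 (hc1 hx)
  have key : ∀ y : L, θ y = ζ • y → ⁅x, y⁆ = 0 → Qf G y = 0 := by
    intro y hy hxy
    obtain ⟨s, hs, hn, hcom⟩ := jordan (K := K) y
    have hys : ⁅y, s⁆ = 0 := by rw [← lie_skew, hcom y (lie_self y), neg_zero]
    have hcm : ∀ {a b : L}, ⁅a, b⁆ = 0 → Commute (ad K L a) (ad K L b) := by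
      exact fun h => comm_ad h
    have hch := charpoly_eq_ss (ad K L y) (ad K L s) (hcm hys) hs hn
    suffices hsc : s ∈ c by
      have := hU s hsc
      unfold Qf at this ⊢
      rw [hch]; exact this
    -- s in degree one
    have hconj : ∀ a : L, (θ : L →ₗ[K] L) ∘ₗ ad K L a = ad K L (θ a) ∘ₗ (θ : L →ₗ[K] L) := by
      intro a; ext z; simp [hθb]
    have hθs : (ad K L (θ s)).IsSemisimple := (LinearEquiv.isSemisimple_iff _ _ θ (hconj s)).1 hs
    have hsθ : θ s = ζ • s := by
      have hyθs : ⁅y, θ s⁆ = 0 := by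
        have := hθb y s
        rw [hys, map_zero, hy, smul_lie] at this
        exact (smul_eq_zero.1 this.symm).resolve_left hζ0
      have hsθs : ⁅s, θ s⁆ = 0 := hcom _ hyθs
      have hcom2 : Commute (ad K L (θ s)) (ζ • ad K L s) := (hcm hsθs).symm.smul_right ζ
      have hss2 : (ad K L (θ s) - ζ • ad K L s).IsSemisimple :=
        hθs.sub_of_commute hcom2 (Module.End.IsSemisimple_smul ζ hs)
      have hnil2 : IsNilpotent (ad K L (θ s) - ζ • ad K L s) := by
        have e1 : ad K L (θ s) - ζ • ad K L s = ζ • (ad K L y - ad K L s) - ad K L (θ (y - s)) := by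
          rw [map_sub θ, hy, map_sub, map_smul, smul_sub]; abel
        rw [e1]
        have n1 : IsNilpotent (ad K L (θ (y - s))) := by
          obtain ⟨N, hN⟩ := hn
          rw [← map_sub] at hN
          refine ⟨N, ?_⟩
          have hpow : ∀ j : ℕ, (θ : L →ₗ[K] L) ∘ₗ ((ad K L (y - s)) ^ j : Module.End K L) =
              ((ad K L (θ (y - s))) ^ j : Module.End K L) ∘ₗ (θ : L →ₗ[K] L) := by
            intro j
            induction j with
            | zero => rfl
            | succ j ih =>
              rw [pow_succ', pow_succ', Module.End.mul_eq_comp, Module.End.mul_eq_comp,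
                ← LinearMap.comp_assoc, hconj, LinearMap.comp_assoc, ih, LinearMap.comp_assoc]
          have := hpow N
          rw [hN, LinearMap.comp_zero] at this
          ext z
          have h3 := LinearMap.congr_fun this (θ.symm z)
          simpa using h3.symm
        have c1 : Commute (ad K L y - ad K L s) (ad K L (θ (y - s))) := by
          rw [map_sub θ, map_sub, hy, map_smul]
          refine Commute.sub_left (Commute.sub_right ((Commute.refl _).smul_right _) (hcm hyθs))
            (Commute.sub_right ((hcm hys).symm.smul_right _) (hcm hsθs))
        exact (c1.smul_left ζ).isNilpotent_sub (hn.smul ζ) n1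
      have h0 := Module.End.eq_zero_of_isNilpotent_isSemisimple hnil2 hss2
      rw [← map_smul, ← map_sub] at h0
      exact sub_eq_zero.1 (ad_inj h0)
    have hsc : ∀ z ∈ c, ⁅s, z⁆ = 0 := by
      intro z hz
      refine hcom _ ?_
      rw [← lie_skew, hgen z hz y hxy, neg_zero]
    have heq := hmax (c ⊔ Submodule.span K {s}) (sup_le hc1 (by
      rw [Submodule.span_singleton_le_iff_mem]; exact Module.End.mem_eigenspace_iff.2 hsθ)) ?_ ?_
        le_sup_left
    · rw [heq]; exact Submodule.mem_sup_right (Submodule.mem_span_singleton_self s)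
    · intro a ha b hb
      obtain ⟨a1, ha1, a2, ha2, rfl⟩ := Submodule.mem_sup.1 ha
      obtain ⟨b1, hb1, b2, hb2, rfl⟩ := Submodule.mem_sup.1 hb
      obtain ⟨r, rfl⟩ := Submodule.mem_span_singleton.1 ha2
      obtain ⟨q, rfl⟩ := Submodule.mem_span_singleton.1 hb2
      have h5 : ⁅a1, s⁆ = 0 := by rw [← lie_skew, hsc a1 ha1, neg_zero]
      simp [hab a1 ha1 b1 hb1, hsc b1 hb1, h5]
    · intro a ha
      obtain ⟨a1, ha1, a2, ha2, rfl⟩ := Submodule.mem_sup.1 ha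
      obtain ⟨r, rfl⟩ := Submodule.mem_span_singleton.1 ha2
      rw [map_add, map_smul]
      refine (hss a1 ha1).add_of_commute ((hcm ?_).smul_right r) (Module.End.IsSemisimple_smul r hs)
      rw [← lie_skew, hsc a1 ha1, neg_zero]
  refine density x _ (LinearMap.ker (ad K L x) ⊓ Module.End.eigenspace (θ : L →ₗ[K] L) ζ)
    {y : L | θ y = y} (fixed_act hθb) (hc1 hx) ?_ G ?_
  · intro v hv
    rw [Module.End.mem_eigenspace_iff] at hv
    refine avg hm hζ hθb hθm hθx _ ?_ hv (by rw [ss_sup _ (hss x hx)]; trivial)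
    intro z hz
    simp only [LinearMap.mem_ker, ad_apply] at hz ⊢
    have := hθb x z
    rw [hz, map_zero, hθx, smul_lie] at this
    exact (smul_eq_zero.1 this.symm).resolve_left hζ0
  · rintro u ⟨hu1, hu2⟩
    have hu2 : θ u = ζ • u := Module.End.mem_eigenspace_iff.1 hu2
    refine key _ (by rw [map_add, hθx, hu2, smul_add]) ?_
    rw [lie_add, lie_self, zero_add]
    simpa using hu1

end Jordan
end NReg


namespace NReg

set_option linter.unusedSectionVars false

section CartanAlg
open LieAlgebra Module MvPolynomial

variable {K L : Type*} [Field K] [IsAlgClosed K] [CharZero K] [LieRing L] [LieAlgebra K L]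
  [FiniteDimensional K L]

lemma coeff_mem_range {ι : Type*} [Fintype ι] (p : L) (b : ι → L) (j : ℕ) :
    (gen K p b).charpoly.coeff j ∈ (phi K p b).range := by
  refine ⟨X j, ?_⟩
  simp [phi]

/-- a root of the generic characteristic polynomial is integral -/
lemma integral_root {ι : Type*} [Fintype ι] (p : L) (b : ι → L) (l : MvPolynomial ι K)
    (hl : (gen K p b).charpoly.eval l = 0) : IsIntegral (phi K p b).range l := by
  have hlift : (gen K p b).charpoly ∈ Polynomial.lifts (algebraMap (phi K p b).range (MvPolynomial ι K)) := by
    rw [Polynomial.lifts_iff_coeff_lifts]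
    intro j
    exact ⟨⟨_, coeff_mem_range p b j⟩, rfl⟩
  obtain ⟨q, hq, -, hqm⟩ := Polynomial.lifts_and_degree_eq_and_monic hlift (Matrix.charpoly_monic _)
  refine ⟨q, hqm, ?_⟩
  rw [← Polynomial.eval_map, hq, hl]

lemma weight_root {ι : Type*} [Fintype ι] (b : ι → L) (a : ι → K) (v : L) (hv : v ≠ 0)
    (hav : ∀ i, ⁅b i, v⁆ = a i • v) :
    (gen K (0 : L) b).charpoly.eval (∑ i, C (a i) * X i) = 0 := by
  classical
  rw [Matrix.eval_charpoly, ← Matrix.exists_mulVec_eq_zero_iff]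
  set w := (finBasis K L).repr v
  refine ⟨fun s => C (w s), ?_, ?_⟩
  · intro h
    apply hv
    have : w = 0 := by
      ext s
      have := congrFun h s
      simpa using this
    simpa [w] using this
  · have h1 : ∀ i, (adM K (b i)).mulVec w = a i • w := by
      intro i
      have := LinearMap.toMatrix_mulVec_repr (finBasis K L) (finBasis K L) (ad K L (b i)) v
      rw [ad_apply, hav, map_smul] at this
      exact this
    have h2 : ∀ i, ((adM K (b i)).map (C : K → MvPolynomial ι K)).mulVec (fun s => C (w s)) =
        fun s => C (a i * w s) := by
      intro i
      ext1 s
      have := congrFun (h1 i) s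
      rw [Pi.smul_apply, smul_eq_mul] at this
      rw [← this]
      simp [Matrix.mulVec, dotProduct]
    rw [Matrix.sub_mulVec, sub_eq_zero]
    unfold gen
    have h0 : adM K (0 : L) = 0 := by simp [adM]
    rw [h0, Matrix.map_zero _ (map_zero _), zero_add, Matrix.sum_mulVec]
    simp_rw [Matrix.smul_mulVec, h2]
    ext1 s
    rw [Matrix.scalar_apply, Matrix.mulVec_diagonal]
    simp only [Finset.sum_apply, Pi.smul_apply, smul_eq_mul, Finset.sum_mul, map_mul]
    exact Finset.sum_congr rfl fun i _ => by ring

variable [LieAlgebra.IsKilling K L]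

lemma cartan_integral {r : ℕ} (b : Fin r → L) (hb : LinearIndependent K b)
    (hab : ∀ i j, ⁅b i, b j⁆ = 0)
    (hss : ∀ i, (ad K L (b i)).IsSemisimple) (i : Fin r) :
    IsIntegral (phi K (0 : L) b).range (X i : MvPolynomial (Fin r) K) := by
  classical
  let T : Set (Fin r → K) := {a | ∃ v : L, v ≠ 0 ∧ ∀ i, ⁅b i, v⁆ = a i • v}
  have hT : Submodule.span K T = ⊤ := by
    by_contra hne
    obtain ⟨φ, hφ, hle⟩ := Submodule.exists_le_ker_of_lt_top _ (lt_top_iff_ne_top.2 hne)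
    have hφa : ∀ a, φ a = ∑ i, a i * φ (Pi.single i 1) := by
      intro a
      conv_lhs => rw [pi_eq_sum_univ' a]
      simp [Pi.single]
    have hx0 : (∑ i, φ (Pi.single i 1) • b i) = 0 := by
      apply ad_inj (K := K)
      have htop := Module.End.iSup_iInf_maxGenEigenspace_eq_top_of_iSup_maxGenEigenspace_eq_top_of_commute
        (fun i => ad K L (b i)) (fun i j _ => comm_ad (hab i j))
        (fun i => Module.End.iSup_maxGenEigenspace_eq_top _)
      rw [← LinearMap.ker_eq_top, eq_top_iff, ← htop]
      refine iSup_le fun a v hv => ?_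
      by_cases hv0 : v = 0
      · rw [hv0]; exact Submodule.zero_mem _
      have hav : ∀ i, ⁅b i, v⁆ = a i • v := by
        intro i
        have := (Submodule.mem_iInf _).1 hv i
        rw [(hss i).isFinitelySemisimple.maxGenEigenspace_eq_eigenspace] at this
        exact Module.End.mem_eigenspace_iff.1 this
      have h1 : φ a = 0 := hle (Submodule.subset_span ⟨v, hv0, hav⟩)
      rw [hφa] at h1
      rw [LinearMap.mem_ker, ad_apply, sum_lie]
      simp only [smul_lie, hav, smul_smul]
      rw [← Finset.sum_smul]
      simp_rw [mul_comm] at h1 ⊢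
      rw [h1, zero_smul]
    have h2 := Fintype.linearIndependent_iff.1 hb _ hx0
    apply hφ
    ext i
    simpa using h2 i
  let Lf : (Fin r → K) →ₗ[K] MvPolynomial (Fin r) K :=
    ∑ i, (LinearMap.toSpanSingleton K (MvPolynomial (Fin r) K) (X i)) ∘ₗ LinearMap.proj i
  have hLf : ∀ a, Lf a = ∑ i, C (a i) * X i := by
    intro a
    simp [Lf, MvPolynomial.smul_eq_C_mul]
  let S : Submodule K (Fin r → K) :=
    ((integralClosure (phi K (0 : L) b).range (MvPolynomial (Fin r) K)).restrictScalars K).toSubmodule.comap Lf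
  have hS : S = ⊤ := by
    rw [eq_top_iff, ← hT, Submodule.span_le]
    rintro a ⟨v, hv, hav⟩
    change IsIntegral _ (Lf a)
    rw [hLf]
    exact integral_root _ _ _ (weight_root b a v hv hav)
  have h3 : Pi.single i 1 ∈ S := by rw [hS]; trivial
  have h4 : IsIntegral (phi K (0 : L) b).range (Lf (Pi.single i 1)) := h3
  rw [hLf] at h4
  simpa [Pi.single_apply] using h4

end CartanAlg
end NReg


namespace NReg

set_option linter.unusedSectionVars false

section SliceNilp
open LieAlgebra Module

/-- graded version of `range E ⊔ ker F = ⊤` -/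
lemma graded_sup {K V : Type*} [Field K] [CharZero K] [IsAlgClosed K] [AddCommGroup V] [Module K V]
    [FiniteDimensional K V] {E F H : Module.End K V} (s : Sl2 E F H)
    (htop : ⨆ n : ℤ, H.eigenspace (2 * (n : K)) = ⊤) (n : ℤ) :
    H.eigenspace (2 * (n : K)) ≤
      (H.eigenspace (2 * ((n - 1 : ℤ) : K))).map E ⊔ LinearMap.ker F := by
  set M := (H.eigenspace (2 * ((n - 1 : ℤ) : K))).map E ⊔
    (LinearMap.ker F ⊓ H.eigenspace (2 * (n : K))) with hM
  set D := ⨆ j : ℤ, ⨆ _ : j ≠ n, H.eigenspace (2 * (j : K)) with hD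
  have hE : ∀ j : ℤ, (H.eigenspace (2 * (j : K))).map E ≤ H.eigenspace (2 * ((j + 1 : ℤ) : K)) := by
    rintro j _ ⟨a, ha, rfl⟩
    have ha := Module.End.mem_eigenspace_iff.1 ha
    rw [Module.End.mem_eigenspace_iff, s.he, ha, map_smul]
    push_cast; module
  have hMD : M ⊔ D = ⊤ := by
    rw [eq_top_iff, ← s.range_sup_ker]
    refine sup_le ?_ ?_
    · rw [LinearMap.range_eq_map, ← htop, Submodule.map_iSup]
      refine iSup_le fun j => ?_
      by_cases hj : j = n - 1
      · subst hj
        exact le_sup_left.trans le_sup_left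
      · refine (hE j).trans (le_trans ?_ le_sup_right)
        exact le_iSup₂_of_le (j + 1) (by omega) le_rfl
    · have hst : ∀ x ∈ LinearMap.ker F, H x ∈ LinearMap.ker F := by
        intro x hx
        rw [LinearMap.mem_ker] at hx ⊢
        have := s.hf x
        rw [hx, map_zero] at this
        simpa using this.symm
      rw [← inf_eig htop hst]
      refine iSup_le fun j => ?_
      by_cases hj : j = n
      · subst hj
        exact le_sup_right.trans le_sup_left
      · exact inf_le_right.trans (le_trans (le_iSup₂_of_le j hj le_rfl) le_sup_right)
  have hdisj : Disjoint (H.eigenspace (2 * (n : K))) D := by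
    have h1 := (Module.End.eigenspaces_iSupIndep H).comp (f := fun n : ℤ => 2 * (n : K)) (by
      intro a b hab
      have : (a : K) = b := by simpa using hab
      exact_mod_cast this)
    exact h1 n
  have hMn : M ≤ H.eigenspace (2 * (n : K)) := by
    refine sup_le ?_ inf_le_right
    have := hE (n - 1)
    simpa using this
  intro y hy
  have hyt : y ∈ M ⊔ D := by rw [hMD]; trivial
  obtain ⟨a, ha, d, hd, rfl⟩ := Submodule.mem_sup.1 hyt
  have hd0 : d = 0 := by
    refine (Submodule.disjoint_def.1 hdisj) d ?_ hd
    have := Submodule.sub_mem _ hy (hMn ha)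
    simpa using this
  rw [hd0, add_zero]
  exact (sup_le_sup le_rfl inf_le_left : M ≤ _) ha

variable {K L : Type*} [Field K] [IsAlgClosed K] [CharZero K] [LieRing L] [LieAlgebra K L]
  [FiniteDimensional K L]

lemma kerF_stable {E F H : Module.End K L} (s : Sl2 E F H) :
    ∀ x ∈ LinearMap.ker F, H x ∈ LinearMap.ker F := by
  intro x hx
  rw [LinearMap.mem_ker] at hx ⊢
  have := s.hf x
  rw [hx, map_zero] at this
  simpa using this.symm

lemma kerF_wt {E F H : Module.End K L} (s : Sl2 E F H) {v : L} (hv0 : v ≠ 0) (hv : F v = 0) {n : ℤ}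
    (hn : H v = (2 * (n : K)) • v) : n ≤ 0 := by
  obtain ⟨d, hd⟩ := s.symm.ker_natural hv0 (n := -(2 * (n : K))) (by simp [hn]) hv
  have : -(2 * n) = (d : ℤ) := by exact_mod_cast hd
  omega

variable [LieAlgebra.IsKilling K L]

lemma slice_sup {e h f : L} (s : Sl2 (ad K L e) (ad K L f) (ad K L h))
    (htop : ⨆ n : ℤ, (ad K L h).eigenspace (2 * (n : K)) = ⊤) {v : L} (hv : ⁅f, v⁆ = 0) :
    LinearMap.range (ad K L (e + v)) ⊔ LinearMap.ker (ad K L f) = ⊤ := by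
  set R := LinearMap.range (ad K L (e + v)) ⊔ LinearMap.ker (ad K L f) with hR
  -- bounded below
  have hfin : {n : ℤ | (ad K L h).eigenspace (2 * (n : K)) ≠ ⊥}.Finite := by
    have h1 : {a : K | (ad K L h).HasEigenvalue a}.Finite := Module.End.finite_hasEigenvalue _
    refine (h1.preimage (f := fun n : ℤ => 2 * (n : K)) ?_)
    intro a _ b _ hab
    have : (a : K) = b := by simpa using hab
    exact_mod_cast this
  obtain ⟨N, hN⟩ := hfin.bddBelow
  have hvmem : v ∈ ⨆ n : ℤ, LinearMap.ker (ad K L f) ⊓ (ad K L h).eigenspace (2 * (n : K)) := by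
    rw [inf_eig htop (kerF_stable s)]
    simpa using hv
  have hlow : ∀ (j : ℤ) (a : L), ⁅h, a⁆ = (2 * (j : K)) • a →
      ⁅v, a⁆ ∈ ⨆ i : ℤ, ⨆ _ : i ≤ j, (ad K L h).eigenspace (2 * (i : K)) := by
    intro j a ha
    clear_value R
    clear hR hv
    induction hvmem using Submodule.iSup_induction' with
    | mem n v hvn =>
      by_cases hv0 : v = 0
      · simp [hv0]
      have hw : ⁅h, v⁆ = (2 * (n : K)) • v := mem_eig.1 hvn.2
      have hn : n ≤ 0 := kerF_wt s hv0 (by simpa using hvn.1) (by simpa using hw)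
      refine Submodule.mem_iSup_of_mem (n + j) (Submodule.mem_iSup_of_mem (by omega) ?_)
      rw [mem_eig, lie_eig hw ha]
      push_cast; congr 1; ring
    | zero => simp
    | add x y _ _ hx hy => rw [add_lie]; exact Submodule.add_mem _ hx hy
  have hind : ∀ k : ℕ, ∀ j : ℤ, j < N + k → (ad K L h).eigenspace (2 * (j : K)) ≤ R := by
    intro k
    induction k with
    | zero =>
      intro j hj
      have : (ad K L h).eigenspace (2 * (j : K)) = ⊥ := by
        by_contra hne
        have := hN hne
        push_cast at hj
        omega
      rw [this]; exact bot_le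
    | succ k ih =>
      intro j hj
      by_cases hjk : j < N + k
      · exact ih j hjk
      refine (graded_sup s htop j).trans (sup_le ?_ le_sup_right)
      rintro _ ⟨a, ha, rfl⟩
      have ha := mem_eig.1 ha
      have e1 : ad K L e a = ad K L (e + v) a - ⁅v, a⁆ := by simp
      rw [e1]
      refine Submodule.sub_mem _ (Submodule.mem_sup_left ⟨a, rfl⟩) ?_
      have h2 := hlow (j - 1) a ha
      have h3 : (⨆ i : ℤ, ⨆ _ : i ≤ j - 1, (ad K L h).eigenspace (2 * (i : K))) ≤ R :=
        iSup₂_le fun i hi => ih i (by push_cast at hj; omega)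
      exact h3 h2
  rw [eq_top_iff, ← htop]
  refine iSup_le fun j => hind (j - N + 1).toNat j (by omega)

lemma slice_disj {e h f : L} (s : Sl2 (ad K L e) (ad K L f) (ad K L h))
    (her : finrank K (LinearMap.ker (ad K L e)) = LieAlgebra.rank K L)
    (htop : ⨆ n : ℤ, (ad K L h).eigenspace (2 * (n : K)) = ⊤) {v : L} (hv : ⁅f, v⁆ = 0) :
    LinearMap.range (ad K L (e + v)) ⊓ LinearMap.ker (ad K L f) = ⊥ := by
  have h1 := slice_sup s htop hv
  have h2 := Submodule.finrank_sup_add_finrank_inf_eq (LinearMap.range (ad K L (e + v)))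
    (LinearMap.ker (ad K L f))
  have h3 := LinearMap.finrank_range_add_finrank_ker (ad K L (e + v))
  have h4 := rank_le_ker (K := K) (e + v)
  have h5 := s.dim_ker_eq
  rw [h1, finrank_top] at h2
  rw [← Submodule.finrank_eq_zero (R := K)]
  omega

lemma nilp_mem_range {x : L} (hx : IsNilpotent (ad K L x)) : x ∈ LinearMap.range (ad K L x) := by
  have hB := LieAlgebra.IsKilling.killingForm_nondegenerate K L
  have hle : LinearMap.range (ad K L x) ≤
      LinearMap.BilinForm.orthogonal (killingForm K L) (LinearMap.ker (ad K L x)) := by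
    rintro _ ⟨y, rfl⟩ z hz
    have hz : ⁅z, x⁆ = 0 := by rw [← lie_skew, neg_eq_zero]; exact hz
    change killingForm K L z ⁅x, y⁆ = 0
    rw [← LieModule.traceForm_apply_lie_apply, hz]
    simp
  have heq := Submodule.eq_of_le_of_finrank_le hle (by
    rw [LinearMap.BilinForm.finrank_orthogonal hB]
    have := LinearMap.finrank_range_add_finrank_ker (ad K L x)
    omega)
  rw [heq]
  intro z hz
  have hz : ⁅z, x⁆ = 0 := by rw [← lie_skew, neg_eq_zero]; exact hz
  change killingForm K L z x = 0
  rw [killingForm_apply_apply]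
  have hc : Commute (ad K L z) (ad K L x) := comm_ad hz
  exact (LinearMap.isNilpotent_trace_of_isNilpotent (hc.isNilpotent_mul_left hx)).eq_zero

lemma slice_nilp {e h f : L} (s : Sl2 (ad K L e) (ad K L f) (ad K L h))
    (her : finrank K (LinearMap.ker (ad K L e)) = LieAlgebra.rank K L)
    (htop : ⨆ n : ℤ, (ad K L h).eigenspace (2 * (n : K)) = ⊤) {v : L} (hv : ⁅f, v⁆ = 0)
    (hhe : ⁅h, e⁆ = (2 : K) • e) (hn : IsNilpotent (ad K L (e + v))) : v = 0 := by
  have hd := slice_disj s her htop hv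
  have h1 : ⁅h, e + v⁆ ∈ LinearMap.range (ad K L (e + v)) :=
    ⟨-h, by rw [ad_apply, lie_neg, lie_skew]⟩
  have h2 := Submodule.sub_mem _ (nilp_mem_range hn) (Submodule.smul_mem _ (2⁻¹ : K) h1)
  have h3 : e + v - (2⁻¹ : K) • ⁅h, e + v⁆ = v - (2⁻¹ : K) • ⁅h, v⁆ := by
    rw [lie_add, hhe, smul_add, smul_smul]; norm_num
  rw [h3] at h2
  have hvF : v ∈ LinearMap.ker (ad K L f) := by simpa using hv
  have h4 : v - (2⁻¹ : K) • ⁅h, v⁆ ∈ LinearMap.ker (ad K L f) :=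
    Submodule.sub_mem _ hvF (Submodule.smul_mem _ _ (kerF_stable s v hvF))
  have h5 : v - (2⁻¹ : K) • ⁅h, v⁆ = 0 := by
    have : v - (2⁻¹ : K) • ⁅h, v⁆ ∈ (⊥ : Submodule K L) := hd ▸ ⟨h2, h4⟩
    simpa using this
  by_contra hv0
  have h6 : ad K L h v = (2 * ((1 : ℤ) : K)) • v := by
    have h7 := congrArg (fun x => (2 : K) • x) (sub_eq_zero.1 h5)
    simp only [smul_smul] at h7
    rw [ad_apply]
    simpa using h7.symm
  have := kerF_wt s hv0 hvF h6
  omega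

end SliceNilp
end NReg


namespace NReg

set_option linter.unusedSectionVars false

section Weighted
open LieAlgebra Module

lemma matrix_charpoly_smul {K n : Type*} [Field K] [Infinite K] [Fintype n] [DecidableEq n]
    (A : Matrix n n K) (c : K) (j : ℕ) :
    (c • A).charpoly.coeff j * c ^ j = c ^ Fintype.card n * A.charpoly.coeff j := by
  have h : (c • A).charpoly.comp (Polynomial.C c * Polynomial.X) =
      Polynomial.C (c ^ Fintype.card n) * A.charpoly := by
    refine Polynomial.funext fun t => ?_
    rw [Polynomial.eval_comp, Polynomial.eval_mul, Polynomial.eval_mul, Polynomial.eval_C,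
      Polynomial.eval_C, Polynomial.eval_X, Matrix.eval_charpoly, Matrix.eval_charpoly,
      ← Matrix.det_smul]
    congr 1
    rw [smul_sub]
    congr 1
    ext a b
    simp [Matrix.scalar_apply, Matrix.diagonal_apply]
  have h2 := congrArg (fun p => Polynomial.coeff p j) h
  rw [Polynomial.coeff_C_mul, Polynomial.comp_C_mul_X_coeff] at h2
  exact h2

lemma charpoly_smul_coeff {K V : Type*} [Field K] [Infinite K] [AddCommGroup V] [Module K V]
    [FiniteDimensional K V] (A : Module.End K V) (c : K) (j : ℕ) :
    (c • A).charpoly.coeff j * c ^ j = c ^ finrank K V * A.charpoly.coeff j := by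
  rw [← LinearMap.charpoly_toMatrix (c • A) (finBasis K V),
    ← LinearMap.charpoly_toMatrix A (finBasis K V), map_smul, matrix_charpoly_smul, Fintype.card_fin]

variable {K L : Type*} [Field K] [IsAlgClosed K] [CharZero K] [LieRing L] [LieAlgebra K L]
  [FiniteDimensional K L]

lemma wt_scale {V : Type*} [AddCommGroup V] [Module K V]
    [FiniteDimensional K V] {H : Module.End K V}
    (htop : ⨆ n : ℤ, H.eigenspace (2 * (n : K)) = ⊤) :
    ∃ ρ : V ≃ₗ[K] V, ∀ (n : ℤ) (v : V), H v = (2 * (n : K)) • v → ρ v = (2 : K) ^ n • v := by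
  obtain ⟨b, d, hb⟩ := graded_basis htop (P := ⊤) (fun _ _ => trivial)
  let B := b.map Submodule.topEquiv
  have hB : ∀ i, H (B i) = (2 * (d i : K)) • B i := by
    intro i
    simpa [B] using hb i
  have h2 : ∀ i, (2 : K) ^ d i ≠ 0 := fun i => zpow_ne_zero _ two_ne_zero
  refine ⟨B.equiv (B.unitsSMul fun i => Units.mk0 _ (h2 i)) (Equiv.refl _), fun n v hv => ?_⟩
  have hc : ∀ i, B.repr v i ≠ 0 → d i = n := by
    intro i hi
    have e1 : H v = ∑ i, (B.repr v i * (2 * (d i : K))) • B i := by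
      conv_lhs => rw [← B.sum_repr v]
      simp only [map_sum, map_smul, hB, smul_smul]
    have e2 := congrArg (fun x => B.repr x i) e1
    simp only [hv, map_smul, Finsupp.smul_apply, smul_eq_mul] at e2
    rw [Basis.repr_sum_self] at e2
    have e3 : (n : K) = d i := by
      have : B.repr v i * 2 * ((n : K) - d i) = 0 := by linear_combination e2
      have h := (mul_eq_zero.1 this).resolve_left (mul_ne_zero hi two_ne_zero)
      exact sub_eq_zero.1 h
    exact_mod_cast e3.symm
  conv_lhs => rw [← B.sum_repr v]
  conv_rhs => rw [← B.sum_repr v]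
  rw [map_sum, Finset.smul_sum]
  refine Finset.sum_congr rfl fun i _ => ?_
  rw [map_smul, Basis.equiv_apply, Equiv.refl_apply, Basis.unitsSMul_apply]
  by_cases hi : B.repr v i = 0
  · rw [hi]; simp
  · rw [← hc i hi, smul_comm]; rfl

variable [LieAlgebra.IsKilling K L]

lemma scale_charpoly {ι : Type*} [Fintype ι] {e h : L} (hhe : ⁅h, e⁆ = (2 : K) • e)
    (htop : ⨆ n : ℤ, (ad K L h).eigenspace (2 * (n : K)) = ⊤) (b : ι → L) (d : ι → ℤ) (w : ι → ℕ)
    (hb : ∀ i, ⁅h, b i⁆ = (2 * (d i : K)) • b i) (hw : ∀ i, (w i : ℤ) = 1 - d i)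
    (u : ι → K) (j : ℕ) :
    (ad K L (e + ∑ i, (2 ^ w i * u i) • b i)).charpoly.coeff j * 2 ^ j =
      2 ^ finrank K L * (ad K L (e + ∑ i, u i • b i)).charpoly.coeff j := by
  obtain ⟨ρ, hρ⟩ := wt_scale htop
  have two0 : (2 : K) ≠ 0 := two_ne_zero
  have hcomm : ∀ (n : ℤ) (y : L), ⁅h, y⁆ = (2 * (n : K)) • y → ∀ z, ρ ⁅y, z⁆ = (2 : K) ^ n • ⁅y, ρ z⁆ := by
    intro n y hy z
    have hz : z ∈ ⨆ n : ℤ, (ad K L h).eigenspace (2 * (n : K)) := by rw [htop]; trivial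
    induction hz using Submodule.iSup_induction' with
    | mem j z hz =>
      have hz := mem_eig.1 hz
      rw [hρ j z hz, hρ (n + j) _ (by
        have := lie_eig hy hz
        rw [ad_apply, this]; push_cast; congr 1; ring), lie_smul, smul_smul, zpow_add₀ two0]
    | zero => simp
    | add x y _ _ hx hy => rw [lie_add, map_add, hx, hy, map_add, lie_add, smul_add]
  set x := e + ∑ i, u i • b i with hx
  set x' := e + ∑ i, (2 ^ w i * u i) • b i with hx'
  have key : ρ.conj (ad K L x') = (2 : K) • ad K L x := by
    ext z
    rw [LinearEquiv.conj_apply_apply, LinearMap.smul_apply, ad_apply, ad_apply, hx, hx', add_lie, add_lie, map_add,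
      hcomm 1 e (by rw [hhe]; simp), LinearEquiv.apply_symm_apply, sum_lie, sum_lie, map_sum,
      smul_add, Finset.smul_sum, zpow_one]
    congr 1
    refine Finset.sum_congr rfl fun i _ => ?_
    rw [smul_lie, smul_lie, map_smul, hcomm _ _ (hb i), LinearEquiv.apply_symm_apply, smul_smul, smul_smul]
    congr 1
    have : (2 : K) ^ w i * 2 ^ d i = 2 := by
      rw [← zpow_natCast, hw, ← zpow_add₀ two0]; simp
    linear_combination u i * this
  rw [← LinearEquiv.charpoly_conj ρ, key, charpoly_smul_coeff]

open MvPolynomial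

lemma weight_supp {ι : Type*} [Fintype ι] {e h : L} (hhe : ⁅h, e⁆ = (2 : K) • e)
    (htop : ⨆ n : ℤ, (ad K L h).eigenspace (2 * (n : K)) = ⊤) (b : ι → L) (d : ι → ℤ) (w : ι → ℕ)
    (hb : ∀ i, ⁅h, b i⁆ = (2 * (d i : K)) • b i) (hw : ∀ i, (w i : ℤ) = 1 - d i)
    (j : ℕ) (m : ι →₀ ℕ) (hm : coeff m ((gen K e b).charpoly.coeff j) ≠ 0) :
    Finsupp.weight w m + j = finrank K L := by
  classical
  set q := (gen K e b).charpoly.coeff j with hq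
  have hev : ∀ u : ι → K, eval u q = (ad K L (e + ∑ i, u i • b i)).charpoly.coeff j := by
    intro u
    have := eval_phi (K := K) e b (X j) u
    simpa [phi, Qf] using this
  have h1 : C (2 ^ j) * aeval (fun i => C (2 ^ w i) * X i) q = C (2 ^ finrank K L) * q := by
    refine MvPolynomial.funext fun u => ?_
    have h2 : eval u (aeval (fun i => C (2 ^ w i) * X i) q) = eval (fun i => 2 ^ w i * u i) q := by
      rw [← MvPolynomial.coe_aeval_eq_eval, ← MvPolynomial.coe_aeval_eq_eval, RingHom.coe_coe, RingHom.coe_coe,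
        ← AlgHom.comp_apply, comp_aeval]
      simp
    rw [map_mul, map_mul, h2, hev, hev, eval_C, eval_C, mul_comm]
    exact scale_charpoly hhe htop b d w hb hw u j
  have h3 : ∀ p : MvPolynomial ι K, coeff m (aeval (fun i => C (2 ^ w i) * X i) p : MvPolynomial ι K) =
      2 ^ (Finsupp.weight w m) * coeff m p := by
    intro p
    induction p using MvPolynomial.induction_on' with
    | add p q hp hq => rw [map_add, coeff_add, hp, hq, coeff_add, mul_add]
    | monomial n a =>
      have : aeval (fun i => (C (2 ^ w i) * X i : MvPolynomial ι K)) (monomial n a) =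
          monomial n (2 ^ (Finsupp.weight w n) * a) := by
        rw [aeval_monomial, monomial_eq (a := 2 ^ _ * a)]
        simp only [mul_pow, Finsupp.prod_mul, MvPolynomial.algebraMap_eq, map_mul]
        rw [← mul_assoc, mul_comm (C a)]
        congr 2
        rw [Finsupp.weight_apply, Finsupp.sum, Finsupp.prod]
        simp only [← map_pow, ← map_prod]
        congr 1
        simp only [← pow_mul, Finset.prod_pow_eq_pow_sum, smul_eq_mul, mul_comm]
      rw [this, coeff_monomial, coeff_monomial]
      split_ifs with hh
      · rw [hh]
      · simp
  have h4 := congrArg (coeff m) h1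
  rw [coeff_C_mul, coeff_C_mul, h3, ← mul_assoc, ← pow_add] at h4
  have h5 := mul_right_cancel₀ hm h4
  have h6 : 2 ^ (j + Finsupp.weight w m) = 2 ^ finrank K L := by exact_mod_cast h5
  have := Nat.pow_right_injective le_rfl h6
  omega

end Weighted
end NReg


namespace NReg

set_option linter.unusedSectionVars false

section FiniteCore
open MvPolynomial

/-- graded Nakayama for quasi-homogeneous systems of parameters -/
lemma finite_core {K ι J : Type*} [Field K] [Finite ι] (w : ι → ℕ)
    (A : Subalgebra K (MvPolynomial ι K)) (q : J → MvPolynomial ι K) (D : J → ℕ)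
    (hD : ∀ j, 0 < D j) (hq : ∀ j, IsWeightedHomogeneous w (q j) (D j)) (hqA : ∀ j, q j ∈ A) (M : ℕ)
    (hM : ∀ i, (X i : MvPolynomial ι K) ^ M ∈ Ideal.span (Set.range q)) (i : ι) :
    IsIntegral A (X i : MvPolynomial ι K) := by
  classical
  cases nonempty_fintype ι
  let T : Set (ι →₀ ℕ) := {a | ∀ i, a i < M}
  have hT : T.Finite := by
    refine (Set.finite_Iic (Finsupp.equivFunOnFinite.symm fun _ => M)).subset ?_
    intro a ha i
    exact (ha i).le
  let S : Submodule A (MvPolynomial ι K) :=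
    Submodule.span A ((fun a => (monomial a (1 : K))) '' T)
  have hK : ∀ (a : K) (x : MvPolynomial ι K), x ∈ S → a • x ∈ S := by
    intro a x hx
    have := S.smul_mem (algebraMap K A a) hx
    rwa [algebraMap_smul] at this
  have key : ∀ n : ℕ, ∀ a : ι →₀ ℕ, Finsupp.weight w a = n → monomial a (1 : K) ∈ S := by
    intro n
    induction n using Nat.strong_induction_on with
    | _ n ih =>
      intro a ha
      by_cases haT : a ∈ T
      · exact Submodule.subset_span ⟨a, haT, rfl⟩
      have : ∃ i, M ≤ a i := by
        by_contra hne
        push Not at hne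
        exact haT hne
      obtain ⟨i, hi⟩ := this
      have hcomp : ∀ z ∈ Ideal.span (Set.range q), ∀ g : MvPolynomial ι K,
          weightedHomogeneousComponent w n (g * z) ∈ S := by
        intro z hz
        induction hz using Submodule.span_induction with
        | mem z hz =>
          obtain ⟨j, rfl⟩ := hz
          intro g
          induction g using MvPolynomial.induction_on' with
          | add g g' hg hg' => rw [add_mul, map_add]; exact S.add_mem hg hg'
          | monomial b c =>
            have h1 := (isWeightedHomogeneous_monomial w b c rfl).mul (hq j)
            rw [weightedHomogeneousComponent_of_mem h1]
            split_ifs with hh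
            · have h2 := ih (Finsupp.weight w b) (by have := hD j; omega) b rfl
              have h3 := S.smul_mem ⟨q j, hqA j⟩ (hK c _ h2)
              rw [smul_monomial, smul_eq_mul, mul_one] at h3
              rw [mul_comm]
              exact h3
            · exact S.zero_mem
        | zero => intro g; simp
        | add x y _ _ hx hy => intro g; rw [mul_add, map_add]; exact S.add_mem (hx g) (hy g)
        | smul c x _ hx => intro g; rw [smul_eq_mul, ← mul_assoc]; exact hx _
      have h4 := hcomp _ (hM i) (monomial (a - Finsupp.single i M) 1)
      have h5 : monomial (a - Finsupp.single i M) (1 : K) * X i ^ M = monomial a 1 := by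
        rw [X_pow_eq_monomial, monomial_mul, mul_one, tsub_add_cancel_of_le]
        rwa [Finsupp.single_le_iff]
      rw [h5, weightedHomogeneousComponent_eq_self (isWeightedHomogeneous_monomial w a _ ha)] at h4
      exact h4
  have htop : S = ⊤ := by
    rw [eq_top_iff]
    rintro p -
    induction p using MvPolynomial.induction_on' with
    | add p q hp hq => exact S.add_mem hp hq
    | monomial a c =>
      have := hK c _ (key _ a rfl)
      rwa [smul_monomial, smul_eq_mul, mul_one] at this
  have hfin : Module.Finite A (MvPolynomial ι K) :=
    ⟨⟨(hT.image _).toFinset, by rw [Set.Finite.coe_toFinset]; exact htop⟩⟩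
  exact IsIntegral.of_finite A _

end FiniteCore

section SliceInt
open LieAlgebra Module MvPolynomial

variable {K L : Type*} [Field K] [IsAlgClosed K] [CharZero K] [LieRing L] [LieAlgebra K L]
  [FiniteDimensional K L] [LieAlgebra.IsKilling K L]

lemma slice_integral {r : ℕ} {e h f : L} (s : Sl2 (ad K L e) (ad K L f) (ad K L h))
    (her : finrank K (LinearMap.ker (ad K L e)) = LieAlgebra.rank K L)
    (htop : ⨆ n : ℤ, (ad K L h).eigenspace (2 * (n : K)) = ⊤)
    (hhe : ⁅h, e⁆ = (2 : K) • e) (b : Fin r → L) (hli : LinearIndependent K b) (d : Fin r → ℤ)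
    (hb : ∀ i, ⁅h, b i⁆ = (2 * (d i : K)) • b i) (hbf : ∀ i, ⁅f, b i⁆ = 0) (i : Fin r) :
    IsIntegral (phi K e b).range (X i : MvPolynomial (Fin r) K) := by
  have hd : ∀ i, d i ≤ 0 := fun i => kerF_wt s (hli.ne_zero i) (hbf i) (hb i)
  let w : Fin r → ℕ := fun i => (1 - d i).toNat
  have hw : ∀ i, (w i : ℤ) = 1 - d i := fun i => by have := hd i; simp only [w]; omega
  let q : Fin (finrank K L) → MvPolynomial (Fin r) K := fun j => (gen K e b).charpoly.coeff j
  have hev : ∀ (j : ℕ) (u : Fin r → K), eval u ((gen K e b).charpoly.coeff j) =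
      (ad K L (e + ∑ i, u i • b i)).charpoly.coeff j := by
    intro j u
    have := eval_phi (K := K) e b (X j) u
    simpa [phi, Qf] using this
  have hz : ∀ u ∈ zeroLocus K (Ideal.span (Set.range q)), u = 0 := by
    intro u hu
    have h1 : (ad K L (e + ∑ i, u i • b i)).charpoly = Polynomial.X ^ finrank K L := by
      have hmon := LinearMap.charpoly_monic (ad K L (e + ∑ i, u i • b i))
      have hdeg := LinearMap.charpoly_natDegree (ad K L (e + ∑ i, u i • b i))
      ext j
      rw [Polynomial.coeff_X_pow]
      rcases lt_trichotomy j (finrank K L) with hj | hj | hj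
      · rw [if_neg hj.ne, ← hev]
        exact hu _ (Ideal.subset_span ⟨⟨j, hj⟩, rfl⟩)
      · rw [if_pos hj, hj, ← hdeg]; exact hmon
      · rw [if_neg hj.ne', Polynomial.coeff_eq_zero_of_natDegree_lt (by rw [hdeg]; exact hj)]
    have h2 := (LinearMap.isNilpotent_iff_charpoly _).2 h1
    have h3 := slice_nilp s her htop (v := ∑ i, u i • b i) (by simp [lie_sum, hbf]) hhe h2
    funext i
    exact Fintype.linearIndependent_iff.1 hli u h3 i
  have hpow : ∀ i, ∃ M : ℕ, (X i : MvPolynomial (Fin r) K) ^ M ∈ Ideal.span (Set.range q) := by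
    intro i
    have : (X i : MvPolynomial (Fin r) K) ∈ (Ideal.span (Set.range q)).radical := by
      rw [← vanishingIdeal_zeroLocus_eq_radical (K := K)]
      intro u hu
      rw [hz u hu]; simp
    exact this
  choose M hM using hpow
  refine finite_core w _ q (fun j => finrank K L - j) (fun j => by have := j.2; omega) ?_
    (fun j => coeff_mem_range _ _ _) (∑ i, M i) ?_ i
  · intro j m hm
    have := weight_supp hhe htop b d w hb hw j m hm
    have := j.2
    omega
  · intro i
    exact Ideal.pow_mem_of_pow_mem _ (hM i) (Finset.single_le_sum (fun _ _ => Nat.zero_le _) (Finset.mem_univ i))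

lemma trdeg_range {r : ℕ} (φ : MvPolynomial ℕ K →ₐ[K] MvPolynomial (Fin r) K)
    (hInt : ∀ i, IsIntegral φ.range (X i : MvPolynomial (Fin r) K)) :
    Algebra.trdeg K φ.range = r := by
  have hI : Algebra.IsIntegral φ.range (MvPolynomial (Fin r) K) := by
    constructor
    intro p
    induction p using MvPolynomial.induction_on with
    | C a => exact isIntegral_algebraMap (x := algebraMap K φ.range a)
    | add p q hp hq => exact hp.add hq
    | mul_X p i hp => exact hp.mul (hInt i)
  have h1 := _root_.trdeg_add_eq K (S := φ.range) (A := MvPolynomial (Fin r) K)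
  rw [MvPolynomial.trdeg_of_isDomain] at h1
  have h2 : Algebra.trdeg φ.range (MvPolynomial (Fin r) K) = 0 := _root_.trdeg_eq_zero
  rw [h2] at h1
  simpa using h1

lemma trdeg_eq_of_ker {r r' : ℕ} (φ : MvPolynomial ℕ K →ₐ[K] MvPolynomial (Fin r) K)
    (ψ : MvPolynomial ℕ K →ₐ[K] MvPolynomial (Fin r') K)
    (hφ : ∀ i, IsIntegral φ.range (X i : MvPolynomial (Fin r) K))
    (hψ : ∀ i, IsIntegral ψ.range (X i : MvPolynomial (Fin r') K))
    (hker : ∀ G, φ G = 0 ↔ ψ G = 0) : r = r' := by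
  have hk : RingHom.ker φ = RingHom.ker ψ := by
    ext G; exact hker G
  have e := (Ideal.quotientKerEquivRange φ).symm.trans
    ((Ideal.quotientEquivAlgOfEq K hk).trans (Ideal.quotientKerEquivRange ψ))
  have h1 := trdeg_range φ hφ
  have h2 := trdeg_range ψ hψ
  have h3 := e.lift_trdeg_eq
  rw [h1, h2] at h3
  simpa using h3

end SliceInt
end NReg


namespace NReg

set_option linter.unusedSectionVars false

section Final
open LieAlgebra Module MvPolynomial

variable {K L : Type*} [Field K] [IsAlgClosed K] [CharZero K] [LieRing L] [LieAlgebra K L]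
  [FiniteDimensional K L] [LieAlgebra.IsKilling K L]

lemma main_dim {m : ℕ} (hm : 1 ≤ m) {ζ : K} (hζ : IsPrimitiveRoot ζ m)
    (θ : L ≃ₗ[K] L) (hθb : ∀ x y : L, θ ⁅x, y⁆ = ⁅θ x, θ y⁆) (hθm : θ ^ m = 1)
    (hθ : θ ∈ Subgroup.closure {τ : L ≃ₗ[K] L | ∃ n : L, IsNilpotent (ad K L n) ∧
      (τ : L →ₗ[K] L) = expSum K (finrank K L + 1) (ad K L n)})
    (e h f : L)
    (hhe : ⁅h, e⁆ = (2 : K) • e) (hhf : ⁅h, f⁆ = -((2 : K) • f)) (hef : ⁅e, f⁆ = h)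
    (hθe : θ e = ζ • e) (hθh : θ h = h) (hθf : θ f = ζ⁻¹ • f)
    (her : finrank K (LinearMap.ker (ad K L e)) = LieAlgebra.rank K L)
    (c : Submodule K L)
    (hc1 : c ≤ Module.End.eigenspace (θ : L →ₗ[K] L) ζ)
    (hab : ∀ x ∈ c, ∀ y ∈ c, ⁅x, y⁆ = 0)
    (hss : ∀ x ∈ c, (ad K L x).IsSemisimple)
    (hmax : ∀ c' : Submodule K L, c' ≤ Module.End.eigenspace (θ : L →ₗ[K] L) ζ →
      (∀ x ∈ c', ∀ y ∈ c', ⁅x, y⁆ = 0) → (∀ x ∈ c', (ad K L x).IsSemisimple) → c ≤ c' → c = c') :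
    finrank K c = ∑ᶠ c : ℤ, if ((c : ZMod m) = -1) then
      finrank K (LinearMap.ker (ad K L e) ⊓ (ad K L h).eigenspace (2 * (c : K)) : Submodule K L)
      else 0 := by
  have s := sl2_ad hhe hhf hef
  obtain ⟨h1, hreg⟩ := regular_triple s her
  have htop := s.even_of h1
  have hζ0 : ζ ≠ 0 := hζ.ne_zero (by omega)
  rw [← slice_dim s h1 hθb hθh hm hζ (fun n x hx =>
    theta_act s h1 hreg hθ hθb hθh hhe hζ0 hθe hθf n hx)]
  set U := (LinearMap.ker (ad K L f) ⊓ End.eigenspace (θ : L →ₗ[K] L) ζ : Submodule K L) with hU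
  have hst : ∀ x ∈ U, ad K L h x ∈ U := by
    rintro x ⟨hx1, hx2⟩
    refine ⟨kerF_stable s x hx1, ?_⟩
    rw [SetLike.mem_coe, End.mem_eigenspace_iff] at hx2 ⊢
    have hx2 : θ x = ζ • x := hx2
    change θ ⁅h, x⁆ = ζ • ⁅h, x⁆
    rw [hθb, hθh, hx2, lie_smul]
  obtain ⟨B, d, hB⟩ := graded_basis htop hst
  have span_of : ∀ (P : Submodule K L) (B : Basis (Fin (finrank K P)) K P),
      Submodule.span K (Set.range fun i => (B i : L)) = P := by
    intro P B
    have h2 := congrArg (Submodule.map P.subtype) B.span_eq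
    rw [Submodule.map_span, ← Set.range_comp, Submodule.map_top, Submodule.range_subtype] at h2
    exact h2
  have li_of : ∀ (P : Submodule K L) (B : Basis (Fin (finrank K P)) K P),
      LinearIndependent K (fun i => (B i : L)) := fun P B =>
    B.linearIndependent.map' P.subtype (Submodule.ker_subtype P)
  have i1 := slice_integral s her htop hhe (fun i => (B i : L)) (li_of U B) d hB
    (fun i => (B i).2.1)
  let B' := finBasis K c
  have i2 := cartan_integral (fun i => (B' i : L)) (li_of c B')
    (fun i j => hab _ (B' i).2 _ (B' j).2) (fun i => hss _ (B' i).2)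
  refine trdeg_eq_of_ker _ _ i2 i1 fun G => ?_
  rw [phi_eq_zero_iff, phi_eq_zero_iff, span_of U B, span_of c B']
  have heg : e ∈ End.eigenspace (θ : L →ₗ[K] L) ζ := End.mem_eigenspace_iff.2 hθe
  constructor
  · intro hG v hv
    refine dens_cartan hm hζ.pow_eq_one hθb hθm c hc1 hab hss hmax G
      (fun u hu => by simpa using hG u hu) _ (Submodule.add_mem _ heg hv.2)
  · intro hG v hv
    refine dens_slice hm hζ.pow_eq_one hθb hθm s hθe hθf G hG _ (by rw [zero_add]; exact hc1 hv)

end Final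
end NReg

theorem dim_cartanSubspace_eq
    (m : ℕ) (hm : 1 ≤ m) (ζ : k) (hζ : IsPrimitiveRoot ζ m)
    (θ : g ≃ₗ[k] g) (hθb : ∀ x y : g, θ ⁅x, y⁆ = ⁅θ x, θ y⁆) (hθm : θ ^ m = 1)
    (hθinner : θ ∈ IntG k g)
    (e h f : g)
    (hhe : ⁅h, e⁆ = (2 : k) • e) (hhf : ⁅h, f⁆ = -((2 : k) • f)) (hef : ⁅e, f⁆ = h)
    (hθe : θ e = ζ • e) (hθh : θ h = h) (hθf : θ f = ζ⁻¹ • f)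
    (hen : IsNilpotent (LieAlgebra.ad k g e))
    (her : Module.finrank k (zc k g e) = LieAlgebra.rank k g)
    (c : Submodule k g) (hc : IsCartanSubspace k g m ζ θ c) :
    Module.finrank k c = kNum k g m e h (-1 : ZMod m) := by
  have hζ1 : ζ ^ (1 : ZMod m).val = ζ := by
    rcases Nat.lt_or_ge 1 m with h1 | h1
    · have : Fact (1 < m) := ⟨h1⟩
      rw [ZMod.val_one, pow_one]
    · have hm1 : m = 1 := le_antisymm h1 hm
      subst hm1
      have h2 : ζ = 1 := by simpa using hζ.pow_eq_one
      rw [h2, one_pow]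
  obtain ⟨hc1, hab, hss, hmax⟩ := hc
  simp only [gradePiece, hζ1] at hc1 hmax
  exact NReg.main_dim hm hζ θ hθb hθm hθinner e h f hhe hhf hef hθe hθh hθf her c hc1 hab hss hmax
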